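/- Let G be a matching covered graph and let M denote the set of perfect matchings of G. If x : E(G) → ℤ is an integer vector that lies in the ℚ-linear span of the incidence vectors {1_M : M ∈ M}, then 2x lies in the perfect matching lattice L(G), i.e., 2x is an integer linear combination of incidence vectors of perfect matchings of G. -/

import Mathlib

open BigOperators

variable {V : Type*}

open Classical in
/-- The incidence vector (over `ℚ`) of the edge set of a subgraph `M` of `G`. -/
noncomputable def incVecQ (G : SimpleGraph V) (M : G.Subgraph) : Sym2 V → ℚ :=
  fun e => if e ∈ M.edgeSet then (1 : ℚ) else 0

/-- A graph is matching covered if it is connected, has an edge, and every edge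
lies in some perfect matching. -/
def MatchingCovered (G : SimpleGraph V) : Prop :=
  G.Connected ∧ G.edgeSet.Nonempty ∧
    ∀ e ∈ G.edgeSet, ∃ M : G.Subgraph, M.IsPerfectMatching ∧ e ∈ M.edgeSet

/-- The perfect matching lattice: all integer linear combinations of incidence
vectors of perfect matchings, inside `ℚ^{Sym2 V}`. -/
noncomputable def pmLattice (G : SimpleGraph V) : Submodule ℤ (Sym2 V → ℚ) :=
  Submodule.span ℤ {x | ∃ M : G.Subgraph, M.IsPerfectMatching ∧ x = incVecQ G M}

namespace PML

set_option linter.unusedSectionVars false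

section Abstract

variable {W : Type*} [AddCommGroup W] [Module ℚ W]

/-- explicit cone membership -/
def InCone (S : Finset W) (x : W) : Prop :=
  ∃ c : W → ℚ, (∀ m, 0 ≤ c m) ∧ x = ∑ m ∈ S, c m • m

lemma InCone.span {S : Finset W} {x : W} (h : InCone S x) : x ∈ Submodule.span ℚ (S : Set W) := by
  obtain ⟨c, -, rfl⟩ := h
  exact Submodule.sum_mem _ fun m hm => Submodule.smul_mem _ _ (Submodule.subset_span hm)

lemma InCone.zero (S : Finset W) : InCone S 0 := ⟨0, by simp, by simp⟩

lemma InCone.add {S : Finset W} {x y : W} (hx : InCone S x) (hy : InCone S y) :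
    InCone S (x + y) := by
  obtain ⟨c, hc, rfl⟩ := hx
  obtain ⟨d, hd, rfl⟩ := hy
  exact ⟨fun m => c m + d m, fun m => add_nonneg (hc m) (hd m), by
    simp [add_smul, Finset.sum_add_distrib]⟩

lemma InCone.smul {S : Finset W} {x : W} (hx : InCone S x) {t : ℚ} (ht : 0 ≤ t) :
    InCone S (t • x) := by
  obtain ⟨c, hc, rfl⟩ := hx
  exact ⟨fun m => t * c m, fun m => mul_nonneg ht (hc m), by
    simp [mul_smul, Finset.smul_sum]⟩

lemma InCone.of_mem {S : Finset W} {x : W} (hx : x ∈ S) : InCone S x := by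
  classical
  refine ⟨fun m => if m = x then 1 else 0, fun m => by dsimp only; split_ifs <;> norm_num, ?_⟩
  simp [hx]

lemma InCone.sum {S : Finset W} {κ : Type*} (I : Finset κ) (x : κ → W)
    (h : ∀ i ∈ I, InCone S (x i)) : InCone S (∑ i ∈ I, x i) := by
  classical
  induction I using Finset.induction_on with
  | empty => simpa using InCone.zero S
  | insert a s ha ih =>
    rw [Finset.sum_insert ha]
    exact (h a (by simp)).add (ih fun i hi => h i (by simp [hi]))

variable {ι : Type*} [Fintype ι]

/-- face of `S` cut out by the functional `g` -/
def face (S : Finset W) (g : W →ₗ[ℚ] ℚ) : Finset W := S.filter fun m => g m = 0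

lemma mem_face {S : Finset W} {g : W →ₗ[ℚ] ℚ} {m : W} : m ∈ face S g ↔ m ∈ S ∧ g m = 0 := by
  simp [face]

lemma face_subset (S : Finset W) (g : W →ₗ[ℚ] ℚ) : face S g ⊆ S := Finset.filter_subset _ _

lemma InCone.face {S : Finset W} {g : W →ₗ[ℚ] ℚ} (h0 : ∀ m ∈ S, 0 ≤ g m) {x : W}
    (hx : InCone S x) (hg : g x = 0) : InCone (face S g) x := by
  obtain ⟨c, hc, rfl⟩ := hx
  refine ⟨c, hc, ?_⟩
  rw [map_sum] at hg
  simp only [map_smul, smul_eq_mul] at hg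
  rw [Finset.sum_eq_zero_iff_of_nonneg (fun m hm => mul_nonneg (hc m) (h0 m hm))] at hg
  symm
  refine Finset.sum_subset (face_subset _ _) fun m hm hm' => ?_
  have := hg m hm
  rcases mul_eq_zero.1 this with h | h
  · simp [h]
  · exact absurd (mem_face.2 ⟨hm, h⟩) hm'

lemma span_face_zero {S : Finset W} {g : W →ₗ[ℚ] ℚ} {x : W}
    (hx : x ∈ Submodule.span ℚ (PML.face S g : Set W)) : g x = 0 := by
  have : Submodule.span ℚ (PML.face S g : Set W) ≤ LinearMap.ker g := by
    rw [Submodule.span_le]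
    intro m hm
    exact (mem_face.1 hm).2
  exact this hx

/-- a system of inequalities describing the cone of `S` inside its span -/
structure Sys (S : Finset W) (g : ι → W →ₗ[ℚ] ℚ) : Prop where
  nn : ∀ i, ∀ m ∈ S, 0 ≤ g i m
  cone : ∀ x ∈ Submodule.span ℚ (S : Set W), (∀ i, 0 ≤ g i x) → InCone S x

/-- the face number `i` is a maximal proper face -/
def Facet (S : Finset W) (g : ι → W →ₗ[ℚ] ℚ) (i : ι) : Prop :=
  face S (g i) ≠ S ∧ ∀ j, face S (g i) ⊆ face S (g j) → face S (g j) ≠ S →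
    face S (g j) = face S (g i)

lemma face_ne_iff {S : Finset W} {g : W →ₗ[ℚ] ℚ} : face S g ≠ S ↔ ∃ m ∈ S, g m ≠ 0 := by
  simp [face, Finset.filter_eq_self]

lemma exists_facet {S : Finset W} {g : ι → W →ₗ[ℚ] ℚ} (i : ι) (hi : face S (g i) ≠ S) :
    ∃ j, Facet S g j ∧ face S (g i) ⊆ face S (g j) := by
  classical
  let J : Finset ι := Finset.univ.filter fun j => face S (g i) ⊆ face S (g j) ∧ face S (g j) ≠ S
  obtain ⟨j, hj, hmax⟩ := Finset.exists_max_image J (fun j => (face S (g j)).card)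
    ⟨i, by simp [J, hi]⟩
  simp only [J, Finset.mem_filter, Finset.mem_univ, true_and] at hj hmax
  refine ⟨j, ⟨hj.2, fun k hk hk' => ?_⟩, hj.1⟩
  exact (Finset.eq_of_subset_of_card_le hk (hmax k ⟨hj.1.trans hk, hk'⟩)).symm

lemma sum_pos_of_not_subset {S : Finset W} {g : ι → W →ₗ[ℚ] ℚ} (hS : Sys S g) {K : Finset W}
    (hK : K ⊆ S) {i : ι} (h : ¬ K ⊆ face S (g i)) : 0 < g i (∑ m ∈ K, m) := by
  rw [map_sum]
  rw [Finset.not_subset] at h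
  obtain ⟨m, hm, hm'⟩ := h
  refine Finset.sum_pos' (fun m hm => hS.nn i m (hK hm)) ⟨m, hm, ?_⟩
  refine lt_of_le_of_ne (hS.nn i m (hK hm)) fun h => hm' (mem_face.2 ⟨hK hm, h.symm⟩)

lemma sum_zero_of_subset {S : Finset W} {g : ι → W →ₗ[ℚ] ℚ} {K : Finset W}
    {i : ι} (h : K ⊆ face S (g i)) : g i (∑ m ∈ K, m) = 0 := by
  rw [map_sum]
  exact Finset.sum_eq_zero fun m hm => (mem_face.1 (h hm)).2

lemma big {S : Finset W} {g : ι → W →ₗ[ℚ] ℚ} (hS : Sys S g) {K : Finset W}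
    (hK : K ⊆ S) {y : W} (hy : y ∈ Submodule.span ℚ (S : Set W))
    (h : ∀ i, K ⊆ face S (g i) → 0 ≤ g i y) :
    ∃ T : ℚ, 0 ≤ T ∧ InCone S (T • (∑ m ∈ K, m) + y) := by
  classical
  have key : ∀ i, ∃ t : ℚ, 0 ≤ t ∧ ∀ T, t ≤ T → 0 ≤ g i (T • (∑ m ∈ K, m) + y) := by
    intro i
    by_cases hi : K ⊆ face S (g i)
    · refine ⟨0, le_rfl, fun T _ => ?_⟩
      rw [map_add, map_smul, sum_zero_of_subset hi]
      simpa using h i hi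
    · have hp := sum_pos_of_not_subset hS hK hi
      refine ⟨|g i y| / g i (∑ m ∈ K, m), div_nonneg (abs_nonneg _) hp.le, fun T hT => ?_⟩
      rw [map_add, map_smul, smul_eq_mul]
      rw [div_le_iff₀ hp] at hT
      have := neg_abs_le (g i y)
      linarith
  choose t ht0 ht using key
  refine ⟨∑ i, t i, Finset.sum_nonneg fun i _ => ht0 i, hS.cone _ ?_ fun i => ht i _ ?_⟩
  · exact Submodule.add_mem _ (Submodule.smul_mem _ _ (Submodule.sum_mem _
      fun m hm => Submodule.subset_span (hK hm))) hy
  · exact Finset.single_le_sum (f := t) (fun i _ => ht0 i) (Finset.mem_univ i)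

lemma facet_span_aux {S : Finset W} {g : ι → W →ₗ[ℚ] ℚ} (hS : Sys S g) {i : ι} (hi : Facet S g i)
    {N N' : W} (hN : N ∈ S) (hN' : N' ∈ S) (h' : g i N' ≠ 0) :
    N - (g i N / g i N') • N' ∈ Submodule.span ℚ (face S (g i) : Set W) := by
  classical
  let J : Finset ι := Finset.univ.filter fun j => face S (g j) = face S (g i)
  obtain ⟨k, hk, hmin⟩ := Finset.exists_min_image J (fun j => g j N / g j N') ⟨i, by simp [J]⟩
  simp only [J, Finset.mem_filter, Finset.mem_univ, true_and] at hk hmin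
  have hpos : ∀ j, face S (g j) = face S (g i) → 0 < g j N' := by
    intro j hj
    refine lt_of_le_of_ne (hS.nn j N' hN') fun h => h' ?_
    have : N' ∈ face S (g j) := mem_face.2 ⟨hN', h.symm⟩
    rw [hj] at this
    exact (mem_face.1 this).2
  set l := g k N / g k N' with hl
  have hsp : N - l • N' ∈ Submodule.span ℚ (S : Set W) :=
    Submodule.sub_mem _ (Submodule.subset_span hN)
      (Submodule.smul_mem _ _ (Submodule.subset_span hN'))
  obtain ⟨T, hT, hc⟩ := big hS (face_subset S (g i)) hsp (by
    intro j hj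
    rw [map_sub, map_smul, smul_eq_mul]
    by_cases hall : face S (g j) = S
    · rw [Finset.ext_iff] at hall
      rw [(mem_face.1 ((hall N).2 hN)).2, (mem_face.1 ((hall N').2 hN')).2]; simp
    · have hj' := hi.2 j hj hall
      have h1 := hmin j hj'
      rw [le_div_iff₀ (hpos j hj')] at h1
      linarith)
  have h0 : g k (T • (∑ m ∈ face S (g i), m) + (N - l • N')) = 0 := by
    rw [map_add, map_smul, sum_zero_of_subset (by rw [hk]), map_sub, map_smul, smul_eq_mul, smul_eq_mul, hl,
      div_mul_cancel₀ _ (hpos k hk).ne']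
    simp
  have h2 := (hc.face (hS.nn k) h0).span
  rw [hk] at h2
  have h3 : N - l • N' ∈ Submodule.span ℚ (face S (g i) : Set W) := by
    have h4 : T • (∑ m ∈ face S (g i), m) ∈ Submodule.span ℚ (face S (g i) : Set W) :=
      Submodule.smul_mem _ _ (Submodule.sum_mem _ fun m hm => Submodule.subset_span hm)
    have := Submodule.sub_mem _ h2 h4
    simpa using this
  have h5 := span_face_zero h3
  rw [map_sub, map_smul, smul_eq_mul] at h5
  have : l = g i N / g i N' := by
    rw [eq_div_iff h']; linarith
  rwa [this] at h3

lemma facet_span {S : Finset W} {g : ι → W →ₗ[ℚ] ℚ} (hS : Sys S g) {i : ι} (hi : Facet S g i)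
    {x N' : W} (hx : x ∈ Submodule.span ℚ (S : Set W)) (hN' : N' ∈ S) (h' : g i N' ≠ 0) :
    x - (g i x / g i N') • N' ∈ Submodule.span ℚ (face S (g i) : Set W) := by
  induction hx using Submodule.span_induction with
  | mem x h => exact facet_span_aux hS hi h hN' h'
  | zero => simp
  | add x y _ _ hx hy =>
    have := Submodule.add_mem _ hx hy
    convert this using 1
    rw [map_add, add_div, add_smul]; abel
  | smul a x _ hx =>
    have := Submodule.smul_mem _ a hx
    convert this using 1
    rw [map_smul, smul_sub, smul_smul, smul_eq_mul, mul_div_assoc]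

lemma facet_span_zero {S : Finset W} {g : ι → W →ₗ[ℚ] ℚ} (hS : Sys S g) {i : ι}
    (hi : Facet S g i) {x : W} (hx : x ∈ Submodule.span ℚ (S : Set W)) (h : g i x = 0) :
    x ∈ Submodule.span ℚ (face S (g i) : Set W) := by
  obtain ⟨m, hm, hm'⟩ := face_ne_iff.1 hi.1
  simpa [h] using facet_span hS hi hx hm hm'

/-- a functional vanishing on a facet is proportional to the facet functional -/
lemma facet_prop {S : Finset W} {g : ι → W →ₗ[ℚ] ℚ} (hS : Sys S g) {i : ι} (hi : Facet S g i)
    {u : W →ₗ[ℚ] ℚ} (hu : ∀ m ∈ face S (g i), u m = 0) {x y : W}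
    (hx : x ∈ Submodule.span ℚ (S : Set W)) (hy : y ∈ Submodule.span ℚ (S : Set W)) :
    u x * g i y = u y * g i x := by
  have h1 : g i y • x - g i x • y ∈ Submodule.span ℚ (face S (g i) : Set W) := by
    apply facet_span_zero hS hi
    · exact Submodule.sub_mem _ (Submodule.smul_mem _ _ hx) (Submodule.smul_mem _ _ hy)
    · simp [mul_comm]
  have h2 : Submodule.span ℚ (face S (g i) : Set W) ≤ LinearMap.ker u :=
    Submodule.span_le.2 fun m hm => hu m hm
  have h3 : u (g i y • x - g i x • y) = 0 := h2 h1
  simp only [map_sub, map_smul, smul_eq_mul] at h3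
  linarith

/-- second facet lemma -/
lemma second_facet {S : Finset W} {g : ι → W →ₗ[ℚ] ℚ} (hS : Sys S g) {i : ι} (hi : Facet S g i)
    (k : ι) (hk : ¬ face S (g i) ⊆ face S (g k)) :
    ∃ j, Facet S g j ∧ face S (g j) ≠ face S (g i) ∧
      ∀ m ∈ face S (g i), m ∈ face S (g k) → m ∈ face S (g j) := by
  classical
  set F' := face S (g i) ∩ face S (g k) with hF'
  have hF'S : F' ⊆ S := Finset.inter_subset_left.trans (face_subset _ _)
  suffices h : ∃ j, F' ⊆ face S (g j) ∧ face S (g j) ≠ S ∧ ¬ face S (g j) ⊆ face S (g i) by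
    obtain ⟨j, h1, h2, h3⟩ := h
    obtain ⟨j', h4, h5⟩ := exists_facet j h2
    exact ⟨j', h4, fun h => h3 (h ▸ h5), fun m hm hm' => h5 (h1 (Finset.mem_inter.2 ⟨hm, hm'⟩))⟩
  by_contra hcon
  push Not at hcon
  obtain ⟨M1, hM1, hM1'⟩ := Finset.not_subset.1 hk
  obtain ⟨N, hN, hN'⟩ := face_ne_iff.1 hi.1
  have hM1S := face_subset _ _ hM1
  let J : Finset ι := Finset.univ.filter fun j => F' ⊆ face S (g j) ∧ g j M1 ≠ 0
  have hkJ : k ∈ J := by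
    simp only [J, Finset.mem_filter, Finset.mem_univ, true_and]
    exact ⟨Finset.inter_subset_right, fun h => hM1' (mem_face.2 ⟨hM1S, h⟩)⟩
  obtain ⟨j, hj, hmin⟩ := Finset.exists_min_image J (fun j => g j N / g j M1) ⟨k, hkJ⟩
  simp only [J, Finset.mem_filter, Finset.mem_univ, true_and] at hj hmin
  have hposM : ∀ l, g l M1 ≠ 0 → 0 < g l M1 := fun l h =>
    lt_of_le_of_ne (hS.nn l M1 hM1S) (Ne.symm h)
  set l := g j N / g j M1 with hl
  have hsp : N - l • M1 ∈ Submodule.span ℚ (S : Set W) :=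
    Submodule.sub_mem _ (Submodule.subset_span hN)
      (Submodule.smul_mem _ _ (Submodule.subset_span hM1S))
  obtain ⟨T, hT, hc⟩ := big hS hF'S hsp (by
    intro q hq
    rw [map_sub, map_smul, smul_eq_mul]
    by_cases hz : g q M1 = 0
    · rw [hz]; simpa using hS.nn q N hN
    · have h1 := hmin q ⟨hq, hz⟩
      rw [le_div_iff₀ (hposM q hz)] at h1
      linarith)
  have h0 : g j (T • (∑ m ∈ F', m) + (N - l • M1)) = 0 := by
    rw [map_add, map_smul, sum_zero_of_subset hj.1, map_sub, map_smul, smul_eq_mul, smul_eq_mul, hl,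
      div_mul_cancel₀ _ hj.2]
    simp
  have h2 := (hc.face (hS.nn j) h0).span
  have hsub : face S (g j) ⊆ face S (g i) := by
    refine hcon j hj.1 (face_ne_iff.2 ⟨M1, hM1S, hj.2⟩)
  have h3 := span_face_zero (Submodule.span_mono (by exact_mod_cast hsub) h2)
  rw [map_add, map_smul, sum_zero_of_subset (hF' ▸ Finset.inter_subset_left), map_sub, map_smul,
    (mem_face.1 hM1).2] at h3
  simp at h3
  exact hN' h3

/-- moving from the barycentre in a direction that leaves the cone -/
lemma ray {S : Finset W} {g : ι → W →ₗ[ℚ] ℚ} (hS : Sys S g) {z : W}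
    (hz : z ∈ Submodule.span ℚ (S : Set W)) (hneg : ∃ i, g i z < 0) :
    ∃ i, face S (g i) ≠ S ∧ ∃ T : ℚ, 0 < T ∧
      InCone (face S (g i)) (T • (∑ m ∈ S, m) + z) := by
  classical
  obtain ⟨i0, hi0⟩ := hneg
  have hz0 : ∀ i, face S (g i) = S → g i z = 0 := by
    intro i hi
    apply span_face_zero (S := S)
    rwa [hi]
  have hp : ∀ i, g i z < 0 → 0 < g i (∑ m ∈ S, m) := by
    intro i hi
    apply sum_pos_of_not_subset hS subset_rfl
    intro h
    have := hz0 i (Finset.Subset.antisymm (face_subset _ _) h)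
    linarith
  let J : Finset ι := Finset.univ.filter fun j => g j z < 0
  obtain ⟨j, hj, hmax⟩ := Finset.exists_max_image J (fun j => - g j z / g j (∑ m ∈ S, m))
    ⟨i0, by simp [J, hi0]⟩
  simp only [J, Finset.mem_filter, Finset.mem_univ, true_and] at hj hmax
  set T := - g j z / g j (∑ m ∈ S, m) with hT
  have hTpos : 0 < T := div_pos (by linarith) (hp j hj)
  refine ⟨j, fun h => ?_, T, hTpos, InCone.face (hS.nn j) (hS.cone _ ?_ ?_) ?_⟩
  · have := hz0 j h
    linarith
  · exact Submodule.add_mem _ (Submodule.smul_mem _ _ (Submodule.sum_mem _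
      fun m hm => Submodule.subset_span hm)) hz
  · intro i
    rw [map_add, map_smul, smul_eq_mul]
    by_cases hi : g i z < 0
    · have := hmax i hi
      rw [div_le_iff₀ (hp i hi)] at this
      linarith
    · have : 0 ≤ g i (∑ m ∈ S, m) := by
        rw [map_sum]; exact Finset.sum_nonneg fun m hm => hS.nn i m hm
      have := mul_nonneg hTpos.le this
      linarith
  · rw [map_add, map_smul, smul_eq_mul, hT, div_mul_cancel₀ _ (hp j hj).ne']
    simp

end Abstract

section Lattice

variable {β : Type*}

/-- all coordinates are integers -/
def Integral (x : β → ℚ) : Prop := ∀ e, ∃ z : ℤ, x e = z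

/-- twice every integral vector of the span lies in the lattice -/
def TT (S : Finset (β → ℚ)) : Prop :=
  ∀ x ∈ Submodule.span ℚ (S : Set (β → ℚ)), Integral x →
    (2 : ℚ) • x ∈ AddSubgroup.closure (S : Set (β → ℚ))

lemma Integral.add {x y : β → ℚ} (hx : Integral x) (hy : Integral y) : Integral (x + y) := by
  intro e
  obtain ⟨a, ha⟩ := hx e
  obtain ⟨b, hb⟩ := hy e
  exact ⟨a + b, by simp [ha, hb]⟩

lemma Integral.sub {x y : β → ℚ} (hx : Integral x) (hy : Integral y) : Integral (x - y) := by
  intro e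
  obtain ⟨a, ha⟩ := hx e
  obtain ⟨b, hb⟩ := hy e
  exact ⟨a - b, by simp [ha, hb]⟩

lemma Integral.zsmul {x : β → ℚ} (hx : Integral x) (z : ℤ) : Integral ((z : ℚ) • x) := by
  intro e
  obtain ⟨a, ha⟩ := hx e
  exact ⟨z * a, by simp [ha]⟩

lemma zsmul_closure {S : Set (β → ℚ)} {x : β → ℚ} (hx : x ∈ AddSubgroup.closure S) (z : ℤ) :
    (z : ℚ) • x ∈ AddSubgroup.closure S := by
  have := AddSubgroup.zsmul_mem _ hx z
  rwa [← Int.cast_smul_eq_zsmul ℚ] at this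

/-- the finishing criterion -/
lemma finish {ι : Type*} [Fintype ι] {S : Finset (β → ℚ)}
    {g : ι → (β → ℚ) →ₗ[ℚ] ℚ} (hS : Sys S g)
    {i : ι} (hi : Facet S g i) (hT : TT (face S (g i)))
    (hint : ∀ x ∈ Submodule.span ℚ (S : Set (β → ℚ)), Integral x → ∃ z : ℤ, g i x = z)
    {γ : β → ℚ} (hγ : γ ∈ Submodule.span ℚ (S : Set (β → ℚ))) (hγi : Integral γ)
    (hγ1 : g i γ = 1) (hγ2 : (2 : ℚ) • γ ∈ AddSubgroup.closure (S : Set (β → ℚ))) : TT S := by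
  intro x hx hxi
  obtain ⟨z, hz⟩ := hint x hx hxi
  have h1 := hT (x - (z : ℚ) • γ) (facet_span_zero hS hi
    (Submodule.sub_mem _ hx (Submodule.smul_mem _ _ hγ)) (by simp [hz, hγ1]))
    (hxi.sub (hγi.zsmul z))
  have h2 := AddSubgroup.closure_mono (by exact_mod_cast face_subset S (g i)) h1
  have h3 := AddSubgroup.add_mem _ h2 (zsmul_closure hγ2 z)
  convert h3 using 1
  rw [smul_sub, smul_comm (z : ℚ) (2 : ℚ) γ]; abel

end Lattice

end PML

namespace PML

set_option linter.unusedSectionVars false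
set_option linter.unusedDecidableInType false
set_option linter.unusedFintypeInType false

universe u v

/-- loopless multigraphs on `α` with edges taken from `β` -/
structure MG (α : Type u) (β : Type v) where
  edges : Finset β
  s : β → α
  t : β → α
  ne : ∀ e ∈ edges, s e ≠ t e

section Basic

variable {α : Type u} [Fintype α] [DecidableEq α] {β : Type v} [Fintype β] [DecidableEq β]

namespace MG

/-- the cut of `X` -/
def cut (G : MG α β) (X : Finset α) : Finset β :=
  G.edges.filter fun e => ¬ (G.s e ∈ X ↔ G.t e ∈ X)

/-- the value of a vector on a cut, as a linear functional -/
noncomputable def d (G : MG α β) (X : Finset α) : (β → ℚ) →ₗ[ℚ] ℚ :=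
  ∑ e ∈ G.cut X, LinearMap.proj e

lemma d_apply (G : MG α β) (X : Finset α) (x : β → ℚ) : G.d X x = ∑ e ∈ G.cut X, x e := by
  simp [d]

lemma d_eq (G : MG α β) (X : Finset α) (x : β → ℚ) :
    G.d X x = ∑ e ∈ G.edges, if ¬ (G.s e ∈ X ↔ G.t e ∈ X) then x e else 0 := by
  rw [d_apply, cut, Finset.sum_filter]

/-- value inside `X` -/
def ins (G : MG α β) (X : Finset α) (x : β → ℚ) : ℚ :=
  ∑ e ∈ G.edges, if (G.s e ∈ X ∧ G.t e ∈ X) then x e else 0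

lemma mem_cut {G : MG α β} {X : Finset α} {e : β} :
    e ∈ G.cut X ↔ e ∈ G.edges ∧ ¬ (G.s e ∈ X ↔ G.t e ∈ X) := by simp [cut]

lemma cut_edges {G : MG α β} {X : Finset α} {e : β} (h : e ∈ G.cut X) : e ∈ G.edges :=
  (mem_cut.1 h).1

lemma mem_cut_singleton {G : MG α β} {v : α} {e : β} :
    e ∈ G.cut {v} ↔ e ∈ G.edges ∧ (G.s e = v ∨ G.t e = v) := by
  rw [mem_cut]
  constructor
  · rintro ⟨h1, h2⟩
    refine ⟨h1, ?_⟩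
    simp only [Finset.mem_singleton] at h2
    tauto
  · rintro ⟨h1, h2⟩
    refine ⟨h1, ?_⟩
    have := G.ne e h1
    simp only [Finset.mem_singleton]
    rintro h3
    rcases h2 with h | h
    · exact this (h.trans (h3.1 h).symm)
    · exact this ((h3.2 h).trans h.symm)

lemma cut_compl (G : MG α β) (X : Finset α) : G.cut Xᶜ = G.cut X := by
  ext e; simp only [mem_cut, Finset.mem_compl]; tauto

lemma d_compl (G : MG α β) (X : Finset α) : G.d Xᶜ = G.d X := by
  simp [d, cut_compl]

lemma handshake (G : MG α β) (X : Finset α) (x : β → ℚ) :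
    ∑ v ∈ X, G.d {v} x = G.d X x + 2 * G.ins X x := by
  simp only [d_eq, ins]
  rw [Finset.sum_comm, Finset.mul_sum, ← Finset.sum_add_distrib]
  refine Finset.sum_congr rfl fun e he => ?_
  have hne := G.ne e he
  have : ∀ v ∈ X, (if ¬ (G.s e ∈ ({v} : Finset α) ↔ G.t e ∈ ({v} : Finset α)) then x e else 0)
      = (if G.s e = v then x e else 0) + (if G.t e = v then x e else 0) := by
    intro v _
    simp only [Finset.mem_singleton]
    by_cases h1 : G.s e = v <;> by_cases h2 : G.t e = v
    · exact absurd (h1.trans h2.symm) hne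
    · simp [h1, h2]
    · simp [h1, h2]
    · simp [h1, h2]
  rw [Finset.sum_congr rfl this, Finset.sum_add_distrib, Finset.sum_ite_eq, Finset.sum_ite_eq]
  by_cases h1 : G.s e ∈ X <;> by_cases h2 : G.t e ∈ X <;> simp [h1, h2]
  ring

/-- regular vectors -/
def Reg (G : MG α β) (r : ℚ) (x : β → ℚ) : Prop :=
  (∀ e, e ∉ G.edges → x e = 0) ∧ ∀ v, G.d {v} x = r

/-- perfect matchings, as vectors -/
def PM (G : MG α β) (m : β → ℚ) : Prop := G.Reg 1 m ∧ ∀ e, m e = 0 ∨ m e = 1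

lemma finite_PM (G : MG α β) : {m | G.PM m}.Finite := by
  have : (Set.univ.pi fun _ : β => ({0, 1} : Set ℚ)).Finite :=
    Set.Finite.pi fun _ => by simp
  refine this.subset fun m hm => ?_
  simpa using hm.2

/-- the finite set of perfect matchings -/
noncomputable def pms (G : MG α β) : Finset (β → ℚ) := G.finite_PM.toFinset

@[simp] lemma mem_pms {G : MG α β} {m : β → ℚ} : m ∈ G.pms ↔ G.PM m := by simp [pms]

lemma Reg.add {G : MG α β} {r r' : ℚ} {x y : β → ℚ} (hx : G.Reg r x) (hy : G.Reg r' y) :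
    G.Reg (r + r') (x + y) :=
  ⟨fun e he => by simp [hx.1 e he, hy.1 e he], fun v => by rw [map_add, hx.2, hy.2]⟩

lemma Reg.sub {G : MG α β} {r r' : ℚ} {x y : β → ℚ} (hx : G.Reg r x) (hy : G.Reg r' y) :
    G.Reg (r - r') (x - y) :=
  ⟨fun e he => by simp [hx.1 e he, hy.1 e he], fun v => by rw [map_sub, hx.2, hy.2]⟩

lemma Reg.smul {G : MG α β} {r : ℚ} {x : β → ℚ} (hx : G.Reg r x) (c : ℚ) :
    G.Reg (c * r) (c • x) :=
  ⟨fun e he => by simp [hx.1 e he], fun v => by rw [map_smul, hx.2, smul_eq_mul]⟩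

lemma Reg.zero (G : MG α β) : G.Reg 0 0 := ⟨fun e he => by simp, fun v => by simp⟩

lemma PM.integral {G : MG α β} {m : β → ℚ} (h : G.PM m) : Integral m := by
  intro e
  rcases h.2 e with h | h
  · exact ⟨0, by simp [h]⟩
  · exact ⟨1, by simp [h]⟩

lemma PM.nonneg {G : MG α β} {m : β → ℚ} (h : G.PM m) (e : β) : 0 ≤ m e := by
  rcases h.2 e with h | h <;> simp [h]

lemma d_nonneg (G : MG α β) {x : β → ℚ} (h : ∀ e, 0 ≤ x e) (X : Finset α) : 0 ≤ G.d X x := by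
  rw [d_apply]; exact Finset.sum_nonneg fun e _ => h e

lemma le_d (G : MG α β) {x : β → ℚ} (h : ∀ e, 0 ≤ x e) {X : Finset α} {e : β} (he : e ∈ G.cut X) :
    x e ≤ G.d X x := by
  rw [d_apply]; exact Finset.single_le_sum (f := x) (fun e _ => h e) he

/-- nonnegative integral vectors with all degrees one are perfect matchings -/
lemma PM.of_nonneg {G : MG α β} {x : β → ℚ} (h : G.Reg 1 x) (hi : Integral x)
    (h0 : ∀ e, 0 ≤ x e) : G.PM x := by
  refine ⟨h, fun e => ?_⟩
  by_cases he : e ∈ G.edges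
  · have h1 : x e ≤ 1 := by
      rw [← h.2 (G.s e)]
      exact G.le_d h0 (mem_cut_singleton.2 ⟨he, Or.inl rfl⟩)
    obtain ⟨z, hz⟩ := hi e
    have h2 := h0 e
    rw [hz] at h1 h2 ⊢
    have h3 : z ≤ 1 := by exact_mod_cast h1
    have h4 : 0 ≤ z := by exact_mod_cast h2
    have : z = 0 ∨ z = 1 := by omega
    rcases this with h | h <;> simp [h]
  · exact Or.inl (h.1 e he)

lemma sum_integral {ι : Type*} (I : Finset ι) (f : ι → ℚ) (h : ∀ i ∈ I, ∃ z : ℤ, f i = z) :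
    ∃ z : ℤ, ∑ i ∈ I, f i = z := by
  classical
  induction I using Finset.induction_on with
  | empty => exact ⟨0, by simp⟩
  | insert a s ha ih =>
    obtain ⟨z, hz⟩ := ih fun i hi => h i (by simp [hi])
    obtain ⟨w, hw⟩ := h a (by simp)
    exact ⟨w + z, by rw [Finset.sum_insert ha, hz, hw]; push_cast; rfl⟩

lemma d_integral (G : MG α β) (X : Finset α) {x : β → ℚ} (hi : Integral x) :
    ∃ z : ℤ, G.d X x = z := by
  rw [d_apply]; exact sum_integral _ _ fun e _ => hi e

lemma ins_integral (G : MG α β) (X : Finset α) {x : β → ℚ} (hi : Integral x) :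
    ∃ z : ℤ, G.ins X x = z := by
  refine sum_integral _ _ fun e _ => ?_
  split_ifs
  · exact hi e
  · exact ⟨0, by simp⟩

lemma Reg.card {G : MG α β} {r : ℚ} {x : β → ℚ} (h : G.Reg r x) (X : Finset α) :
    (X.card : ℚ) * r = G.d X x + 2 * G.ins X x := by
  rw [← handshake, Finset.sum_congr rfl fun v _ => h.2 v]; simp

/-- parity of cuts of sets covered exactly once -/
lemma parity {G : MG α β} {x : β → ℚ} (hi : Integral x) (X : Finset α)
    (h : ∀ v ∈ X, G.d {v} x = 1) : ∃ z : ℤ, G.d X x = X.card - 2 * z := by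
  obtain ⟨z, hz⟩ := G.ins_integral X hi
  refine ⟨z, ?_⟩
  have := G.handshake X x
  rw [Finset.sum_congr rfl h] at this
  simp at this
  rw [← hz]; linarith

lemma Reg.half_integral {G : MG α β} {r : ℚ} {x : β → ℚ} (h : G.Reg r x) (hi : Integral x)
    {X : Finset α} (hX : Odd X.card) : ∃ z : ℤ, (G.d X x - r) / 2 = z := by
  obtain ⟨k, hk⟩ := hX
  have hne : X.Nonempty := by rw [← Finset.card_pos]; omega
  obtain ⟨v, hv⟩ := hne
  obtain ⟨a, ha⟩ := G.d_integral {v} hi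
  rw [h.2] at ha
  obtain ⟨b, hb⟩ := G.ins_integral X hi
  have := h.card X
  rw [hk, ha, hb] at this
  refine ⟨k * a - b, ?_⟩
  rw [ha]
  push_cast at this ⊢
  linarith

lemma PM.one_le_d {G : MG α β} {m : β → ℚ} (h : G.PM m) {X : Finset α} (hX : Odd X.card) :
    1 ≤ G.d X m := by
  obtain ⟨z, hz⟩ := h.1.half_integral h.integral hX
  have h0 := G.d_nonneg h.nonneg X
  have h1 : (-1 : ℚ) ≤ 2 * z := by
    have : G.d X m = 2 * z + 1 := by linarith
    linarith
  have h2 : -1 ≤ 2 * z := by exact_mod_cast h1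
  have h3 : (0 : ℤ) ≤ z := by omega
  have h4 : (0 : ℚ) ≤ z := by exact_mod_cast h3
  linarith

/-- the unique edge of a cut of value one -/
lemma PM.exists_unique_cut {G : MG α β} {m : β → ℚ} (h : G.PM m) {X : Finset α}
    (hX : G.d X m = 1) : ∃ f ∈ G.cut X, m f = 1 ∧ ∀ e ∈ G.cut X, e ≠ f → m e = 0 := by
  rw [d_apply] at hX
  have : ∃ f ∈ G.cut X, m f ≠ 0 := by
    by_contra hcon
    push Not at hcon
    rw [Finset.sum_eq_zero hcon] at hX
    norm_num at hX
  obtain ⟨f, hf, hf0⟩ := this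
  have hf1 : m f = 1 := (h.2 f).resolve_left hf0
  refine ⟨f, hf, hf1, fun e he hef => ?_⟩
  rw [← Finset.add_sum_erase _ _ hf, hf1] at hX
  have h0 : ∑ x ∈ (G.cut X).erase f, m x = 0 := by linarith
  rw [Finset.sum_eq_zero_iff_of_nonneg fun e _ => h.nonneg e] at h0
  exact h0 e (Finset.mem_erase.2 ⟨hef, he⟩)

/-- the common degree functional -/
noncomputable def rr (G : MG α β) : (β → ℚ) →ₗ[ℚ] ℚ :=
  open Classical in if h : Nonempty α then G.d {h.some} else 0

lemma Reg.rr [hα : Nonempty α] {G : MG α β} {r : ℚ} {x : β → ℚ} (h : G.Reg r x) : G.rr x = r := by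
  simp only [MG.rr, dif_pos hα]; exact h.2 _

/-- slack of an odd cut constraint -/
noncomputable def ell (G : MG α β) (X : Finset α) : (β → ℚ) →ₗ[ℚ] ℚ :=
  (1 / 2 : ℚ) • (G.d X - G.rr)

lemma Reg.ell [hα : Nonempty α] {G : MG α β} {r : ℚ} {x : β → ℚ} (h : G.Reg r x) (X : Finset α) :
    G.ell X x = (G.d X x - r) / 2 := by
  simp [MG.ell, h.rr]; ring

/-- all constraints -/
noncomputable def con (G : MG α β) : β ⊕ Finset α → (β → ℚ) →ₗ[ℚ] ℚ
  | Sum.inl e => LinearMap.proj e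
  | Sum.inr X => if Odd X.card then G.ell X else 0

lemma con_inl (G : MG α β) (e : β) (x : β → ℚ) : G.con (Sum.inl e) x = x e := rfl

lemma con_inr (G : MG α β) {X : Finset α} (hX : Odd X.card) : G.con (Sum.inr X) = G.ell X := by
  simp [con, hX]

lemma uncross (G : MG α β) (X Y : Finset α) (x : β → ℚ) :
    G.d (X ∩ Y) x + G.d (X ∪ Y)ᶜ x +
      2 * (∑ e ∈ G.edges, if ((G.s e ∈ X \ Y ∧ G.t e ∈ Y \ X) ∨ (G.t e ∈ X \ Y ∧ G.s e ∈ Y \ X))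
        then x e else 0) = G.d X x + G.d Y x := by
  simp only [d_eq, Finset.mul_sum]
  rw [← Finset.sum_add_distrib, ← Finset.sum_add_distrib, ← Finset.sum_add_distrib]
  refine Finset.sum_congr rfl fun e _ => ?_
  simp only [Finset.mem_inter, Finset.mem_compl, Finset.mem_union, Finset.mem_sdiff]
  by_cases h1 : G.s e ∈ X <;> by_cases h2 : G.t e ∈ X <;> by_cases h3 : G.s e ∈ Y <;>
    by_cases h4 : G.t e ∈ Y <;> simp [h1, h2, h3, h4] <;> ring

/-- the vertex map of a contraction of the complement of `X` -/
def phi (X : Finset α) (v : α) : Option {v // v ∈ X} := if h : v ∈ X then some ⟨v, h⟩ else none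

lemma phi_some {X : Finset α} {v : α} (h : v ∈ X) : phi X v = some ⟨v, h⟩ := by simp [phi, h]

lemma phi_none {X : Finset α} {v : α} (h : v ∉ X) : phi X v = none := by simp [phi, h]

lemma phi_eq_some {X : Finset α} {v : α} {w : {v // v ∈ X}} : phi X v = some w ↔ v = w := by
  by_cases h : v ∈ X
  · rw [phi_some h]; simp [Subtype.ext_iff]
  · rw [phi_none h]; simp; rintro rfl; exact h w.2

lemma phi_eq_none {X : Finset α} {v : α} : phi X v = none ↔ v ∉ X := by
  by_cases h : v ∈ X
  · rw [phi_some h]; simp [h]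
  · rw [phi_none h]; simp [h]

/-- contract the complement of `X` to one vertex -/
def ctr (G : MG α β) (X : Finset α) : MG (Option {v // v ∈ X}) β where
  edges := G.edges.filter fun e => phi X (G.s e) ≠ phi X (G.t e)
  s e := phi X (G.s e)
  t e := phi X (G.t e)
  ne e he := (Finset.mem_filter.1 he).2

lemma mem_ctr_edges {G : MG α β} {X : Finset α} {e : β} :
    e ∈ (G.ctr X).edges ↔ e ∈ G.edges ∧ (G.s e ∈ X ∨ G.t e ∈ X) := by
  simp only [ctr, Finset.mem_filter]
  refine and_congr_right fun he => ?_
  have := G.ne e he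
  by_cases h1 : G.s e ∈ X <;> by_cases h2 : G.t e ∈ X <;>
    simp [phi, h1, h2, this]

/-- preimage of a vertex set under a contraction -/
def pre (X : Finset α) (Z : Finset (Option {v // v ∈ X})) : Finset α :=
  Finset.univ.filter fun v => phi X v ∈ Z

lemma mem_pre {X : Finset α} {Z : Finset (Option {v // v ∈ X})} {v : α} :
    v ∈ pre X Z ↔ phi X v ∈ Z := by simp [pre]

lemma cut_ctr (G : MG α β) (X : Finset α) (Z : Finset (Option {v // v ∈ X})) :
    (G.ctr X).cut Z = G.cut (pre X Z) := by
  ext e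
  simp only [mem_cut, mem_pre, ctr, Finset.mem_filter]
  constructor
  · rintro ⟨⟨h1, -⟩, h3⟩; exact ⟨h1, h3⟩
  · rintro ⟨h1, h3⟩; exact ⟨⟨h1, fun h => h3 (by rw [h])⟩, h3⟩

lemma d_ctr (G : MG α β) (X : Finset α) (Z : Finset (Option {v // v ∈ X})) :
    (G.ctr X).d Z = G.d (pre X Z) := by
  simp [d, cut_ctr]

lemma pre_some {X : Finset α} (w : {v // v ∈ X}) : pre X {some w} = {w.1} := by
  ext v; simp [mem_pre, phi_eq_some]

lemma pre_none {X : Finset α} : pre X {none} = Xᶜ := by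
  ext v; simp [mem_pre, phi_eq_none]

lemma pre_compl {X : Finset α} (Z : Finset (Option {v // v ∈ X})) : pre X Zᶜ = (pre X Z)ᶜ := by
  ext v; simp [mem_pre]

lemma pre_card_of_none {X : Finset α} (Z : Finset (Option {v // v ∈ X})) (hZ : none ∉ Z) :
    (pre X Z).card = Z.card ∧ pre X Z ⊆ X := by
  constructor
  · refine Finset.card_bij (fun v _ => phi X v) (fun v hv => mem_pre.1 hv) ?_ ?_
    · intro a ha b hb hab
      have ha' : a ∈ X := by
        by_contra h; exact hZ (by simpa [mem_pre, phi_none h] using ha)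
      rw [phi_some ha', eq_comm, phi_eq_some] at hab
      exact hab.symm
    · intro w hw
      cases w with
      | none => exact absurd hw hZ
      | some w => exact ⟨w.1, by simpa [mem_pre, phi_some w.2] using hw, by simp [phi_some w.2]⟩
  · intro v hv
    by_contra h
    exact hZ (by simpa [mem_pre, phi_none h] using hv)

lemma card_option (X : Finset α) : Fintype.card (Option {v // v ∈ X}) = X.card + 1 := by
  simp [Fintype.card_option]

lemma pre_odd {X : Finset α} (hX : Odd X.card) (hα : Even (Fintype.card α))
    (Z : Finset (Option {v // v ∈ X})) : Odd (pre X Z).card ↔ Odd Z.card := by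
  by_cases hZ : none ∈ Z
  · have h1 : none ∉ Zᶜ := by simpa using hZ
    have h2 := (pre_card_of_none Zᶜ h1).1
    rw [pre_compl] at h2
    have h3 := Finset.card_compl_add_card (pre X Z)
    have h4 := Finset.card_compl_add_card Z
    rw [card_option] at h4
    rw [h2] at h3
    have : Fintype.card α + Z.card = (X.card + 1) + (pre X Z).card := by omega
    rw [Nat.odd_iff, Nat.odd_iff]
    rw [Nat.even_iff] at hα
    rw [Nat.odd_iff] at hX
    omega
  · rw [(pre_card_of_none Z hZ).1]

/-- restriction to the edges meeting `X` -/
noncomputable def res (G : MG α β) (X : Finset α) : (β → ℚ) →ₗ[ℚ] (β → ℚ) :=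
  LinearMap.pi fun e => if G.s e ∈ X ∨ G.t e ∈ X then LinearMap.proj e else 0

lemma res_apply (G : MG α β) (X : Finset α) (x : β → ℚ) (e : β) :
    G.res X x e = if G.s e ∈ X ∨ G.t e ∈ X then x e else 0 := by
  simp only [res, LinearMap.pi_apply]
  split_ifs <;> simp

lemma d_congr (G : MG α β) {X : Finset α} {x y : β → ℚ} (h : ∀ e ∈ G.cut X, x e = y e) :
    G.d X x = G.d X y := by
  rw [d_apply, d_apply]; exact Finset.sum_congr rfl h

lemma d_ctr_res (G : MG α β) (X : Finset α) (Z : Finset (Option {v // v ∈ X})) (x : β → ℚ) :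
    (G.ctr X).d Z (G.res X x) = G.d (pre X Z) x := by
  rw [← d_ctr]
  refine d_congr _ fun e he => ?_
  rw [res_apply, if_pos (mem_ctr_edges.1 (cut_edges he)).2]

lemma Reg.res {G : MG α β} {r : ℚ} {x : β → ℚ} (h : G.Reg r x) {X : Finset α}
    (hX : G.d X x = r) : (G.ctr X).Reg r (G.res X x) := by
  constructor
  · intro e he
    rw [res_apply]
    split_ifs with h1
    · exact h.1 e fun h2 => he (mem_ctr_edges.2 ⟨h2, h1⟩)
    · rfl
  · intro w
    rw [d_ctr_res]
    cases w with
    | none => rw [pre_none, d_compl, hX]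
    | some w => rw [pre_some, h.2]

lemma PM.res {G : MG α β} {m : β → ℚ} (h : G.PM m) {X : Finset α}
    (hX : G.d X m = 1) : (G.ctr X).PM (G.res X m) := by
  refine ⟨h.1.res hX, fun e => ?_⟩
  rw [res_apply]
  split_ifs
  · exact h.2 e
  · exact Or.inl rfl

lemma PM.res_idem {G : MG α β} {X : Finset α} {m : β → ℚ} (h : (G.ctr X).PM m) :
    G.res X m = m := by
  ext e
  rw [res_apply]
  split_ifs with h1
  · rfl
  · exact (h.1.1 e fun h2 => h1 (mem_ctr_edges.1 h2).2).symm

/-- gluing -/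
def glue (G : MG α β) (X : Finset α) (x y : β → ℚ) : β → ℚ :=
  fun e => if G.s e ∈ X ∨ G.t e ∈ X then x e else y e

lemma ctr_d_some (G : MG α β) {X : Finset α} {v : α} (hv : v ∈ X) :
    (G.ctr X).d {some ⟨v, hv⟩} = G.d {v} := by
  rw [d_ctr, pre_some]

lemma ctr_d_none (G : MG α β) {X : Finset α} :
    (G.ctr X).d {none} = G.d X := by
  rw [d_ctr, pre_none, d_compl]

lemma d_glue_left (G : MG α β) {X Z : Finset α} (hZ : Z ⊆ X) (x y : β → ℚ) :
    G.d Z (G.glue X x y) = G.d Z x := by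
  refine d_congr _ fun e he => ?_
  have := (mem_cut.1 he).2
  rw [glue, if_pos]
  by_contra hcon
  push Not at hcon
  exact this (iff_of_false (fun h => hcon.1 (hZ h)) fun h => hcon.2 (hZ h))

lemma d_glue_right (G : MG α β) {X Z : Finset α} (hZ : Disjoint Z X) {x y : β → ℚ}
    (hxy : ∀ e ∈ G.cut X, x e = y e) :
    G.d Z (G.glue X x y) = G.d Z y := by
  refine d_congr _ fun e he => ?_
  have h2 := mem_cut.1 he
  rw [glue]
  split_ifs with h
  · apply hxy e (mem_cut.2 ⟨h2.1, fun h3 => h2.2 ?_⟩)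
    have h4 : G.s e ∈ X ∧ G.t e ∈ X := by tauto
    rw [Finset.disjoint_left] at hZ
    exact iff_of_false (fun h => hZ h h4.1) fun h => hZ h h4.2
  · rfl

lemma PM.glue {G : MG α β} {X : Finset α} {m m' : β → ℚ} (h : (G.ctr X).PM m)
    (h' : (G.ctr Xᶜ).PM m') (hag : ∀ e ∈ G.cut X, m e = m' e) :
    G.PM (G.glue X m m') ∧ G.d X (G.glue X m m') = 1 := by
  refine ⟨⟨⟨?_, ?_⟩, ?_⟩, ?_⟩
  · intro e he
    simp only [MG.glue]
    split_ifs
    · exact h.1.1 e fun h2 => he (mem_ctr_edges.1 h2).1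
    · exact h'.1.1 e fun h2 => he (mem_ctr_edges.1 h2).1
  · intro v
    by_cases hv : v ∈ X
    · rw [d_glue_left _ (by simpa using hv), ← ctr_d_some _ hv, h.1.2]
    · rw [d_glue_right _ (by simpa using hv) hag]
      have hv' : v ∈ Xᶜ := by simpa using hv
      rw [← ctr_d_some _ hv', h'.1.2]
  · intro e
    simp only [MG.glue]
    split_ifs
    · exact h.2 e
    · exact h'.2 e
  · rw [d_glue_left _ subset_rfl, ← ctr_d_none, h.1.2]

/-- gluing two matchings of `G` itself -/
lemma PM.glue' {G : MG α β} {X : Finset α} {m m' : β → ℚ} (h : G.PM m) (h' : G.PM m')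
    (hX : G.d X m = 1) (hX' : G.d X m' = 1) {f : β} (hf : f ∈ G.cut X) (hm : m f = 1)
    (hm' : m' f = 1) : (∀ e ∈ G.cut X, m e = m' e) ∧ G.PM (G.glue X m m') := by
  have key : ∀ e ∈ G.cut X, m e = m' e := by
    obtain ⟨a, ha, ha1, ha2⟩ := h.exists_unique_cut hX
    obtain ⟨b, hb, hb1, hb2⟩ := h'.exists_unique_cut hX'
    have haf : f = a := by
      by_contra hne; have := ha2 f hf hne; rw [hm] at this; norm_num at this
    have hbf : f = b := by
      by_contra hne; have := hb2 f hf hne; rw [hm'] at this; norm_num at this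
    subst haf; subst hbf
    intro e he
    by_cases hef : e = f
    · rw [hef, hm, hm']
    · rw [ha2 e he hef, hb2 e he hef]
  refine ⟨key, ?_⟩
  have h1 := h.res hX
  have h2 := h'.res (X := Xᶜ) (by rw [d_compl, hX'])
  have := (PM.glue h1 h2 ?_).1
  · convert this using 1
    ext e
    simp only [MG.glue, res_apply, Finset.mem_compl]
    split_ifs <;> first | rfl | tauto
  · intro e he
    have h3 := (mem_cut.1 he).2
    rw [res_apply, res_apply, if_pos (by tauto), if_pos (by simp only [Finset.mem_compl]; tauto),
      key e he]

end MG

end Basic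

end PML

namespace PML

set_option linter.unusedSectionVars false
set_option linter.unusedDecidableInType false
set_option linter.unusedFintypeInType false

universe u v

section Edmonds

variable {α : Type u} [Fintype α] [DecidableEq α] {β : Type v} [Fintype β] [DecidableEq β]

namespace MG

lemma glue_cone_aux {κ κ' : Type*} (S : Finset κ) (S' : Finset κ') (C : Finset β)
    (l : κ → ℚ) (μ : κ' → ℚ) (m : κ → β → ℚ) (m' : κ' → β → ℚ) (x : β → ℚ)
    (hl : ∀ k, 0 ≤ l k) (hm : ∀ k ∈ S, ∀ e, 0 ≤ m k e)
    (h1 : ∀ k ∈ S, ∑ f ∈ C, m k f = 1)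
    (hx : ∀ f ∈ C, x f = ∑ k ∈ S, l k * m k f) (hx' : ∀ f ∈ C, x f = ∑ k ∈ S', μ k * m' k f)
    (e : β) :
    ∑ k ∈ S, ∑ k' ∈ S', (∑ f ∈ C, m k f * m' k' f * l k * μ k' / x f) * m k e
      = ∑ k ∈ S, l k * m k e := by
  refine Finset.sum_congr rfl fun k hk => ?_
  rw [← Finset.sum_mul, Finset.sum_comm]
  congr 1
  have : ∀ f ∈ C, ∑ k' ∈ S', m k f * m' k' f * l k * μ k' / x f = l k * m k f := by
    intro f hf
    have h2 : ∑ k' ∈ S', m k f * m' k' f * l k * μ k' / x f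
        = (l k * m k f) * (∑ k' ∈ S', μ k' * m' k' f) / x f := by
      rw [Finset.mul_sum, Finset.sum_div]
      refine Finset.sum_congr rfl fun k' _ => ?_
      ring
    rw [h2, ← hx' f hf]
    by_cases h0 : x f = 0
    · rw [hx f hf, Finset.sum_eq_zero_iff_of_nonneg
        (fun k hk => mul_nonneg (hl k) (hm k hk f))] at h0
      simp [h0 k hk]
    · field_simp
  rw [Finset.sum_congr rfl this, ← Finset.mul_sum, h1 k hk, mul_one]

lemma glue_cone (G : MG α β) (X : Finset α) (x : β → ℚ)
    (h1 : InCone (G.ctr X).pms (G.res X x)) (h2 : InCone (G.ctr Xᶜ).pms (G.res Xᶜ x)) :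
    InCone G.pms x := by
  obtain ⟨l, hl, hlx⟩ := h1
  obtain ⟨μ, hμ, hμx⟩ := h2
  set S := (G.ctr X).pms with hS
  set S' := (G.ctr Xᶜ).pms with hS'
  set C := G.cut X with hC
  have hd1 : ∀ m ∈ S, ∑ f ∈ C, m f = 1 := by
    intro m hm
    have := (mem_pms.1 hm).1.2 none
    rwa [ctr_d_none, d_apply] at this
  have hd2 : ∀ m ∈ S', ∑ f ∈ C, m f = 1 := by
    intro m hm
    have := (mem_pms.1 hm).1.2 none
    rwa [ctr_d_none, d_apply, cut_compl] at this
  have e1 : ∀ e, (G.s e ∈ X ∨ G.t e ∈ X) → x e = ∑ m ∈ S, l m * m e := by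
    intro e he
    have := congrFun hlx e
    rw [res_apply, if_pos he] at this
    simpa using this
  have e2 : ∀ e, (G.s e ∈ Xᶜ ∨ G.t e ∈ Xᶜ) → x e = ∑ m ∈ S', μ m * m e := by
    intro e he
    have := congrFun hμx e
    rw [res_apply, if_pos he] at this
    simpa using this
  have c1 : ∀ f ∈ C, x f = ∑ m ∈ S, l m * m f := by
    intro f hf
    refine e1 f ?_
    have := (mem_cut.1 hf).2
    tauto
  have c2 : ∀ f ∈ C, x f = ∑ m ∈ S', μ m * m f := by
    intro f hf
    refine e2 f ?_
    have := (mem_cut.1 hf).2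
    simp only [Finset.mem_compl]
    tauto
  have key : x = ∑ p ∈ S ×ˢ S', (∑ f ∈ C, p.1 f * p.2 f * l p.1 * μ p.2 / x f) •
      G.glue X p.1 p.2 := by
    ext e
    rw [Finset.sum_apply, Finset.sum_product]
    simp only [Pi.smul_apply, smul_eq_mul, glue]
    by_cases he : G.s e ∈ X ∨ G.t e ∈ X
    · simp only [he, if_true]
      rw [glue_cone_aux S S' C l μ (fun m => m) (fun m => m) x hl
        (fun m hm e => (mem_pms.1 hm).nonneg e) hd1 c1 c2 e, e1 e he]
    · simp only [he, if_false]
      rw [Finset.sum_comm]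
      have := glue_cone_aux S' S C μ l (fun m => m) (fun m => m) x hμ
        (fun m hm e => (mem_pms.1 hm).nonneg e) hd2 c2 c1 e
      rw [e2 e (by simp only [Finset.mem_compl]; tauto), ← this]
      refine Finset.sum_congr rfl fun k _ => Finset.sum_congr rfl fun k' _ => ?_
      congr 1
      refine Finset.sum_congr rfl fun f _ => ?_
      ring
  rw [key]
  have hx0 : ∀ f ∈ C, 0 ≤ x f := fun f hf => by
    rw [c1 f hf]
    exact Finset.sum_nonneg fun m hm => mul_nonneg (hl m) ((mem_pms.1 hm).nonneg f)
  refine InCone.sum _ _ fun p hp => ?_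
  rw [Finset.mem_product] at hp
  have p1 := mem_pms.1 hp.1
  have p2 := mem_pms.1 hp.2
  by_cases hag : ∃ f ∈ C, p.1 f ≠ 0 ∧ p.2 f ≠ 0
  · obtain ⟨f, hf, hf1, hf2⟩ := hag
    refine InCone.smul (InCone.of_mem (mem_pms.2 (PM.glue p1 p2 ?_).1)) ?_
    · obtain ⟨a, ha, ha1, ha2⟩ := p1.exists_unique_cut (X := {none})
        (by rw [ctr_d_none, d_apply]; exact hd1 _ hp.1)
      obtain ⟨b, hb, hb1, hb2⟩ := p2.exists_unique_cut (X := {none})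
        (by rw [ctr_d_none, d_apply, cut_compl]; exact hd2 _ hp.2)
      rw [cut_ctr, pre_none, cut_compl] at ha ha2
      rw [cut_ctr, pre_none, compl_compl] at hb hb2
      have hfa : f = a := by by_contra h; exact hf1 (ha2 f hf h)
      have hfb : f = b := by by_contra h; exact hf2 (hb2 f hf h)
      subst hfa; subst hfb
      intro e he
      by_cases hef : e = f
      · rw [hef, ha1, hb1]
      · rw [ha2 e he hef, hb2 e he hef]
    · refine Finset.sum_nonneg fun f hf => ?_
      exact div_nonneg (mul_nonneg (mul_nonneg (mul_nonneg (p1.nonneg f) (p2.nonneg f)) (hl _))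
        (hμ _)) (hx0 f hf)
  · push Not at hag
    rw [Finset.sum_eq_zero, zero_smul]
    · exact InCone.zero _
    · intro f hf
      by_cases h : p.1 f = 0
      · simp [h]
      · simp [hag f hf h]

/-- feasible points for Edmonds' description -/
def Feas (G : MG α β) (r : ℚ) (x : β → ℚ) : Prop :=
  (∀ e, 0 ≤ x e) ∧ G.Reg r x ∧ ∀ X : Finset α, Odd X.card → r ≤ G.d X x

lemma ins_nonneg (G : MG α β) {x : β → ℚ} (h : ∀ e, 0 ≤ x e) (X : Finset α) : 0 ≤ G.ins X x := by
  refine Finset.sum_nonneg fun e _ => ?_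
  split_ifs
  · exact h e
  · exact le_rfl

lemma d_univ (G : MG α β) (x : β → ℚ) : G.d Finset.univ x = 0 := by
  rw [d_apply]
  refine Finset.sum_eq_zero fun e he => ?_
  have := (mem_cut.1 he).2
  simp at this

lemma Feas.even {G : MG α β} {r : ℚ} {x : β → ℚ} (h : G.Feas r x) (hr : 0 < r) :
    Even (Fintype.card α) := by
  by_contra hcon
  rw [Nat.not_even_iff_odd] at hcon
  have := h.2.2 Finset.univ (by rwa [Finset.card_univ])
  rw [d_univ] at this
  linarith

/-- the support graph -/
def sup (G : MG α β) (x : β → ℚ) : SimpleGraph α where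
  Adj a b := ∃ e ∈ G.edges, x e ≠ 0 ∧ ((G.s e = a ∧ G.t e = b) ∨ (G.s e = b ∧ G.t e = a))
  symm := ⟨fun a b => by
    rintro ⟨e, h1, h2, h3⟩
    exact ⟨e, h1, h2, h3.symm⟩⟩
  loopless := ⟨fun a => by
    rintro ⟨e, h1, h2, h3⟩
    have := G.ne e h1
    rcases h3 with h3 | h3 <;> exact this (h3.1.trans h3.2.symm)⟩

lemma Feas.tutte {G : MG α β} {r : ℚ} {x : β → ℚ} (h : G.Feas r x) (hr : 0 < r) :
    ∃ M : (G.sup x).Subgraph, M.IsPerfectMatching := by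
  classical
  rw [SimpleGraph.tutte]
  intro S hS
  rw [SimpleGraph.IsTutteViolator] at hS
  set H := ((⊤ : (G.sup x).Subgraph).deleteVerts S).coe with hH
  let XK : H.ConnectedComponent → Finset α := fun K =>
    (Subtype.val '' K.supp : Set α).toFinset
  let S' : Finset α := S.toFinset
  have mem_XK : ∀ K v, v ∈ XK K ↔ ∃ hv : v ∈ ((⊤ : (G.sup x).Subgraph).deleteVerts S).verts,
      H.connectedComponentMk ⟨v, hv⟩ = K := by
    intro K v
    simp only [XK, Set.mem_toFinset, Set.mem_image, Subtype.exists, SimpleGraph.ConnectedComponent.mem_supp_iff]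
    constructor
    · rintro ⟨a, ha, h1, rfl⟩; exact ⟨ha, h1⟩
    · rintro ⟨hv, h1⟩; exact ⟨v, hv, h1, rfl⟩
  have nS : ∀ K v, v ∈ XK K → v ∉ S' := by
    intro K v hv
    obtain ⟨hv, -⟩ := (mem_XK K v).1 hv
    simpa [S'] using hv
  let x' : β → ℚ := fun e => if e ∈ G.cut S' then x e else 0
  have hx' : ∀ e, 0 ≤ x' e := fun e => by
    simp only [x']; split_ifs
    · exact h.1 e
    · exact le_rfl
  have d1 : ∀ K, G.d (XK K) x = G.d (XK K) x' := by
    intro K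
    refine d_congr _ fun e he => ?_
    simp only [x']
    split_ifs with hc
    · rfl
    · by_contra hne
      have h2 := mem_cut.1 he
      have adj : (G.sup x).Adj (G.s e) (G.t e) := ⟨e, h2.1, hne, Or.inl ⟨rfl, rfl⟩⟩
      have hst : G.s e ∈ S' ↔ G.t e ∈ S' := by
        by_contra h3; exact hc (mem_cut.2 ⟨h2.1, h3⟩)
      have h4 : G.s e ∉ S' := by
        intro h5
        exact h2.2 (iff_of_false (fun h6 => nS K _ h6 h5) (fun h6 => nS K _ h6 (hst.1 h5)))
      have h5 : G.t e ∉ S' := fun h => h4 (hst.2 h)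
      have hs : G.s e ∈ ((⊤ : (G.sup x).Subgraph).deleteVerts S).verts := by
        simpa [S'] using h4
      have ht : G.t e ∈ ((⊤ : (G.sup x).Subgraph).deleteVerts S).verts := by
        simpa [S'] using h5
      have hadj : H.Adj ⟨_, hs⟩ ⟨_, ht⟩ := by
        simp only [hH, SimpleGraph.Subgraph.coe_adj, SimpleGraph.Subgraph.deleteVerts_adj]
        simp only [S', Set.mem_toFinset] at h4 h5
        simp [h4, h5, adj]
      have heq := SimpleGraph.ConnectedComponent.connectedComponentMk_eq_of_adj hadj
      refine h2.2 ?_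
      rw [mem_XK, mem_XK]
      constructor
      · rintro ⟨_, h6⟩; exact ⟨ht, heq ▸ h6⟩
      · rintro ⟨_, h6⟩; exact ⟨hs, heq.trans h6⟩
  have d2 : ∀ K, G.d (XK K) x ≤ ∑ v ∈ XK K, G.d {v} x' := by
    intro K
    rw [handshake, d1]
    have := G.ins_nonneg hx' (XK K)
    linarith
  let O : Finset H.ConnectedComponent := H.oddComponents.toFinset
  have hO : S'.card < O.card := by
    rw [Set.ncard_eq_toFinset_card', Set.ncard_eq_toFinset_card'] at hS
    exact hS
  have hodd : ∀ K ∈ O, r ≤ G.d (XK K) x := by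
    intro K hK
    apply h.2.2
    have : Odd K.supp.ncard := by simpa [O, SimpleGraph.oddComponents] using hK
    have h2 : (XK K).card = K.supp.ncard := by
      rw [← Set.ncard_coe_finset]
      simp only [XK, Set.coe_toFinset]
      exact Set.ncard_image_of_injective _ Subtype.val_injective
    rwa [h2]
  have hdisj : (O : Set H.ConnectedComponent).PairwiseDisjoint XK := by
    intro K _ K' _ hne
    rw [Function.onFun, Finset.disjoint_left]
    intro v hv hv'
    obtain ⟨_, h1⟩ := (mem_XK _ _).1 hv
    obtain ⟨_, h2⟩ := (mem_XK _ _).1 hv'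
    exact hne (h1.symm.trans h2)
  have f1 : (O.card : ℚ) * r ≤ ∑ v ∈ O.biUnion XK, G.d {v} x' := by
    rw [Finset.sum_biUnion hdisj]
    have := Finset.sum_le_sum fun K hK => (hodd K hK).trans (d2 K)
    simpa using this
  have f2 : ∑ v ∈ O.biUnion XK, G.d {v} x' ≤ ∑ v ∈ S'ᶜ, G.d {v} x' := by
    refine Finset.sum_le_sum_of_subset_of_nonneg ?_ fun v _ _ => G.d_nonneg hx' _
    intro v hv
    obtain ⟨K, -, hv⟩ := Finset.mem_biUnion.1 hv
    simpa using nS K v hv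
  have f3 : G.ins S'ᶜ x' = 0 := by
    refine Finset.sum_eq_zero fun e he => ?_
    split_ifs with h1
    · simp only [x']
      rw [if_neg]
      intro h2
      have := (mem_cut.1 h2).2
      simp only [Finset.mem_compl] at h1
      tauto
    · rfl
  have f4 : G.d S'ᶜ x' = G.d S' x := by
    rw [d_compl]
    refine d_congr _ fun e he => ?_
    simp [x', he]
  have f5 := h.2.1.card S'
  have f6 := G.ins_nonneg h.1 S'
  rw [G.handshake S'ᶜ, f3, f4] at f2
  have f7 : (S'.card : ℚ) + 1 ≤ O.card := by exact_mod_cast hO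
  nlinarith

lemma Feas.exists_pm {G : MG α β} {r : ℚ} {x : β → ℚ} (h : G.Feas r x) (hr : 0 < r) :
    ∃ m, G.PM m ∧ ∀ e, x e = 0 → m e = 0 := by
  classical
  obtain ⟨M, hM⟩ := h.tutte hr
  have hc : ∀ p : (G.sup x).edgeSet, ∃ e, e ∈ G.edges ∧ x e ≠ 0 ∧ s(G.s e, G.t e) = p.1 := by
    rintro ⟨p, hp⟩
    induction p with
    | _ a b =>
      obtain ⟨e, h1, h2, h3⟩ := hp
      refine ⟨e, h1, h2, ?_⟩
      rw [Sym2.eq_iff]; tauto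
  choose c hc1 hc2 hc3 using hc
  let m : β → ℚ := fun e => if ∃ p : (G.sup x).edgeSet, p.1 ∈ M.edgeSet ∧ c p = e then 1 else 0
  have m0 : ∀ e, (e ∈ G.edges → x e ≠ 0 → False) → m e = 0 := by
    intro e he
    simp only [m]
    rw [if_neg]
    rintro ⟨p, h1, rfl⟩
    exact he (hc1 p) (hc2 p)
  refine ⟨m, ⟨⟨fun e he => m0 e fun h => absurd h he, fun v => ?_⟩, fun e => ?_⟩,
    fun e he => m0 e fun _ h => h he⟩
  · obtain ⟨w, hw, huniq⟩ := SimpleGraph.Subgraph.isPerfectMatching_iff.1 hM v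
    have hvw : s(v, w) ∈ (G.sup x).edgeSet := hw.adj_sub
    rw [d_apply, Finset.sum_eq_single (c ⟨_, hvw⟩)]
    · simp only [m]
      rw [if_pos ⟨⟨_, hvw⟩, hw, rfl⟩]
    · intro e he hne
      simp only [m]
      rw [if_neg]
      rintro ⟨⟨p, hp⟩, h1, rfl⟩
      have h2 := (mem_cut_singleton.1 he).2
      have h3 := hc3 ⟨p, hp⟩
      simp only at h3 h1
      have hvp : v ∈ p := by
        rw [← h3, Sym2.mem_iff]
        rcases h2 with h2 | h2 <;> simp [h2]
      obtain ⟨w', rfl⟩ := hvp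
      have := huniq w' h1
      subst this
      exact hne rfl
    · intro h1
      refine absurd (mem_cut_singleton.2 ⟨hc1 _, ?_⟩) h1
      have := hc3 ⟨_, hvw⟩
      simp only [Sym2.eq_iff] at this
      tauto
  · simp only [m]; split_ifs <;> simp

lemma Feas.res {G : MG α β} {r : ℚ} {x : β → ℚ} (h : G.Feas r x) (hα : Even (Fintype.card α))
    {X : Finset α} (hX : Odd X.card) (hd : G.d X x = r) : (G.ctr X).Feas r (G.res X x) := by
  refine ⟨fun e => ?_, h.2.1.res hd, fun Z hZ => ?_⟩
  · rw [res_apply]; split_ifs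
    · exact h.1 e
    · exact le_rfl
  · rw [d_ctr_res]; exact h.2.2 _ ((pre_odd hX hα Z).2 hZ)

lemma odd_compl {X : Finset α} (hX : Odd X.card) (hα : Even (Fintype.card α)) : Odd Xᶜ.card := by
  have := Finset.card_compl_add_card X
  rw [Nat.odd_iff] at *
  rw [Nat.even_iff] at hα
  omega

theorem edmonds_aux (n : ℕ) : ∀ (α : Type u) [Fintype α] [DecidableEq α] (G : MG α β) (r : ℚ)
    (x : β → ℚ), G.Feas r x → Fintype.card α + (Finset.univ.filter fun e => x e ≠ 0).card ≤ n →
    InCone G.pms x := by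
  induction n using Nat.strong_induction_on with
  | _ n ih =>
  intro α _ _ G r x h hn
  by_cases hx : x = 0
  · rw [hx]; exact InCone.zero _
  obtain ⟨e0, he0⟩ := Function.ne_iff.1 hx
  have he0' : e0 ∈ G.edges := by
    by_contra hcon; exact he0 (h.2.1.1 _ hcon)
  have hr : 0 < r := by
    rw [← h.2.1.2 (G.s e0)]
    refine lt_of_lt_of_le (lt_of_le_of_ne (h.1 e0) (Ne.symm he0)) ?_
    exact G.le_d h.1 (mem_cut_singleton.2 ⟨he0', Or.inl rfl⟩)
  have hα := h.even hr
  obtain ⟨m, hm, hsupp⟩ := h.exists_pm hr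
  let a : β ⊕ Finset α → ℚ := fun i => Sum.elim (fun e => x e) (fun X => G.d X x - r) i
  let b : β ⊕ Finset α → ℚ := fun i => Sum.elim (fun e => m e) (fun X => G.d X m - 1) i
  let ok : β ⊕ Finset α → Prop := fun i => Sum.elim (fun _ => True) (fun X => Odd X.card) i
  classical
  let J := Finset.univ.filter fun i => ok i ∧ 0 < b i
  have hJ : J.Nonempty := by
    have h1 := hm.1.2 (G.s e0)
    rw [d_apply] at h1
    have : ∃ e ∈ G.cut {G.s e0}, m e ≠ 0 := by
      by_contra hcon
      push Not at hcon
      rw [Finset.sum_eq_zero hcon] at h1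
      norm_num at h1
    obtain ⟨e, -, he⟩ := this
    exact ⟨Sum.inl e, by simp [J, ok, b, lt_of_le_of_ne (hm.nonneg e) (Ne.symm he)]⟩
  obtain ⟨i, hi, hmin⟩ := Finset.exists_min_image J (fun i => a i / b i) hJ
  simp only [J, Finset.mem_filter, Finset.mem_univ, true_and] at hi hmin
  have ha : ∀ i, ok i → 0 ≤ a i := by
    rintro (e | X) hok
    · exact h.1 e
    · exact sub_nonneg.2 (h.2.2 X hok)
  set ε := a i / b i with hε
  have hε0 : 0 ≤ ε := div_nonneg (ha i hi.1) hi.2.le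
  have hfeas : ∀ j, ok j → 0 ≤ a j - ε * b j := by
    intro j hj
    by_cases hb : 0 < b j
    · have := hmin j ⟨hj, hb⟩
      rw [le_div_iff₀ hb] at this
      linarith
    · have h1 := ha j hj
      push Not at hb
      nlinarith
  have hi0 : a i - ε * b i = 0 := by
    rw [hε]; field_simp [hi.2.ne']; simp
  set x' := x - ε • m with hx'
  have F : G.Feas (r - ε) x' := by
    refine ⟨fun e => ?_, ?_, fun X hX => ?_⟩
    · have := hfeas (Sum.inl e) trivial
      simpa [a, b, hx'] using this
    · have := h.2.1.sub (hm.1.smul ε)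
      rwa [mul_one] at this
    · have := hfeas (Sum.inr X) hX
      simp only [a, b, Sum.elim_inr] at this
      rw [hx', map_sub, map_smul, smul_eq_mul]
      linarith
  have hsub : ∀ e, x' e ≠ 0 → x e ≠ 0 := by
    intro e he h0
    apply he
    simp [hx', h0, hsupp e h0]
  have hxx : x = x' + ε • m := by simp [hx']
  suffices InCone G.pms x' by
    rw [hxx]
    exact this.add ((InCone.of_mem (mem_pms.2 hm)).smul hε0)
  rcases i with e | X
  · have hme : m e ≠ 0 := hi.2.ne'
    have hxe : x e ≠ 0 := fun h => hme (hsupp e h)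
    have hlt : (Finset.univ.filter fun e => x' e ≠ 0).card <
        (Finset.univ.filter fun e => x e ≠ 0).card := by
      apply Finset.card_lt_card
      refine Finset.ssubset_iff_of_subset (fun e he => ?_) |>.2 ⟨e, ?_, ?_⟩
      · simp only [Finset.mem_filter, Finset.mem_univ, true_and] at he ⊢
        exact hsub e he
      · simpa using hxe
      · simpa [a, b, hx'] using hi0
    exact ih _ (by omega) α G _ x' F le_rfl
  · have hX : Odd X.card := hi.1
    have hb : 0 < G.d X m - 1 := hi.2
    have hd : G.d X x' = r - ε := by
      simp only [a, b, Sum.elim_inr] at hi0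
      rw [hx', map_sub, map_smul, smul_eq_mul]
      linarith
    have hX' := odd_compl hX hα
    have hX1 : X.card ≠ 1 := by
      intro h1
      obtain ⟨v, rfl⟩ := Finset.card_eq_one.1 h1
      rw [hm.1.2] at hb
      norm_num at hb
    have hX2 : Xᶜ.card ≠ 1 := by
      intro h1
      obtain ⟨v, hv⟩ := Finset.card_eq_one.1 h1
      rw [← d_compl, hv, hm.1.2] at hb
      norm_num at hb
    have hcard := Finset.card_compl_add_card X
    have hp1 := hX.pos
    have hp2 := hX'.pos
    have hs : ∀ Y : Finset α, (Finset.univ.filter fun e => G.res Y x' e ≠ 0).card ≤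
        (Finset.univ.filter fun e => x e ≠ 0).card := by
      intro Y
      refine Finset.card_le_card fun e he => ?_
      simp only [Finset.mem_filter, Finset.mem_univ, true_and] at he ⊢
      apply hsub e
      intro h0
      apply he
      rw [res_apply, h0]; simp
    refine glue_cone G X x' ?_ ?_
    · refine ih _ ?_ _ (G.ctr X) _ _ (F.res hα hX hd) le_rfl
      rw [card_option]
      have := hs X
      omega
    · refine ih _ ?_ _ (G.ctr Xᶜ) _ _ (F.res hα hX' (by rw [d_compl, hd])) le_rfl
      rw [card_option]
      have := hs Xᶜ
      omega

theorem edmonds {G : MG α β} {r : ℚ} {x : β → ℚ} (h : G.Feas r x) : InCone G.pms x :=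
  edmonds_aux _ α G r x h le_rfl

lemma span_reg {G : MG α β} {x : β → ℚ} (hx : x ∈ Submodule.span ℚ (G.pms : Set (β → ℚ))) :
    ∃ r, G.Reg r x := by
  induction hx using Submodule.span_induction with
  | mem x h => exact ⟨1, (mem_pms.1 h).1⟩
  | zero => exact ⟨0, Reg.zero G⟩
  | add x y _ _ hx hy =>
    obtain ⟨r, hx⟩ := hx
    obtain ⟨r', hy⟩ := hy
    exact ⟨_, hx.add hy⟩
  | smul c x _ hx =>
    obtain ⟨r, hx⟩ := hx
    exact ⟨_, hx.smul c⟩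

lemma con_nonneg [Nonempty α] {G : MG α β} {m : β → ℚ} (hm : G.PM m) (i : β ⊕ Finset α) :
    0 ≤ G.con i m := by
  rcases i with e | X
  · exact hm.nonneg e
  · by_cases hX : Odd X.card
    · rw [con_inr _ hX, hm.1.ell]
      have := hm.one_le_d hX
      linarith
    · simp [con, hX]

theorem sys [Nonempty α] (G : MG α β) : Sys G.pms G.con where
  nn i m hm := con_nonneg (mem_pms.1 hm) i
  cone x hx h := by
    obtain ⟨r, hr⟩ := span_reg hx
    refine edmonds (r := r) ⟨fun e => h (Sum.inl e), hr, fun X hX => ?_⟩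
    have := h (Sum.inr X)
    rw [con_inr _ hX, hr.ell] at this
    linarith

/-- every edge is covered -/
def Cov (G : MG α β) : Prop := ∀ e ∈ G.edges, ∃ m, G.PM m ∧ m e = 1

/-- no nontrivial tight cut -/
def Brick (G : MG α β) : Prop :=
  ∀ X : Finset α, Odd X.card → (∀ m, G.PM m → G.d X m = 1) → X.card = 1 ∨ Xᶜ.card = 1

theorem elp {G : MG α β} (hcov : G.Cov) (hbr : G.Brick) {r : ℚ} {x : β → ℚ}
    (h : G.Reg r x) : x ∈ Submodule.span ℚ (G.pms : Set (β → ℚ)) := by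
  classical
  set J : β → ℚ := ∑ m ∈ G.pms, m with hJ
  have hJs : J ∈ Submodule.span ℚ (G.pms : Set (β → ℚ)) :=
    Submodule.sum_mem _ fun m hm => Submodule.subset_span hm
  set N : ℚ := (G.pms.card : ℚ) with hN
  have hJr : G.Reg N J := by
    refine ⟨fun e he => ?_, fun v => ?_⟩
    · rw [hJ, Finset.sum_apply]
      exact Finset.sum_eq_zero fun m hm => (mem_pms.1 hm).1.1 e he
    · rw [hJ, map_sum, Finset.sum_congr rfl fun m hm => (mem_pms.1 hm).1.2 v]
      simp [hN]
  have key : ∀ i : β ⊕ Finset α, ∃ t : ℚ, 0 ≤ t ∧ ∀ T, t ≤ T →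
      Sum.elim (fun e => 0 ≤ (T • J + x) e)
        (fun X => Odd X.card → T * N + r ≤ G.d X (T • J + x)) i := by
    have aux : ∀ a b : ℚ, 0 < a → ∃ t : ℚ, 0 ≤ t ∧ ∀ T, t ≤ T → 0 ≤ T * a + b := by
      intro a b ha
      refine ⟨|b| / a, by positivity, fun T hT => ?_⟩
      rw [div_le_iff₀ ha] at hT
      have := neg_abs_le b
      linarith
    rintro (e | X)
    · by_cases he : e ∈ G.edges
      · obtain ⟨m, hm, hme⟩ := hcov e he
        have : 0 < J e := by
          rw [hJ, Finset.sum_apply]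
          exact Finset.sum_pos' (fun m hm => (mem_pms.1 hm).nonneg e)
            ⟨m, mem_pms.2 hm, by rw [hme]; norm_num⟩
        obtain ⟨t, ht0, ht⟩ := aux (J e) (x e) this
        exact ⟨t, ht0, fun T hT => by simpa using ht T hT⟩
      · refine ⟨0, le_rfl, fun T _ => ?_⟩
        simp [hJr.1 e he, h.1 e he]
    · by_cases hX : Odd X.card
      swap
      · exact ⟨0, le_rfl, fun T _ hodd => absurd hodd hX⟩
      by_cases ht : ∀ m, G.PM m → G.d X m = 1
      · refine ⟨0, le_rfl, fun T _ _ => ?_⟩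
        have hv : ∃ v, G.d X = G.d {v} := by
          rcases hbr X hX ht with h1 | h1
          · obtain ⟨v, rfl⟩ := Finset.card_eq_one.1 h1
            exact ⟨v, rfl⟩
          · obtain ⟨v, hv⟩ := Finset.card_eq_one.1 h1
            exact ⟨v, by rw [← hv, d_compl]⟩
        obtain ⟨v, hv⟩ := hv
        rw [hv, map_add, map_smul, hJr.2, h.2]
        exact le_rfl
      · push Not at ht
        obtain ⟨m, hm, hne⟩ := ht
        have : 0 < G.d X J - N := by
          have : G.d X J - N = ∑ m ∈ G.pms, (G.d X m - 1) := by
            rw [hJ, map_sum, Finset.sum_sub_distrib]; simp [hN]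
          rw [this]
          refine Finset.sum_pos' (fun m hm => sub_nonneg.2 ((mem_pms.1 hm).one_le_d hX))
            ⟨m, mem_pms.2 hm, ?_⟩
          have := hm.one_le_d hX
          exact sub_pos.2 (lt_of_le_of_ne this (Ne.symm hne))
        obtain ⟨t, ht0, ht⟩ := aux _ (G.d X x - r) this
        refine ⟨t, ht0, fun T hT _ => ?_⟩
        have := ht T hT
        rw [map_add, map_smul, smul_eq_mul]
        linarith
  choose t ht0 ht using key
  set T := ∑ i, t i with hT
  have hTi : ∀ i, t i ≤ T := fun i => Finset.single_le_sum (fun i _ => ht0 i) (Finset.mem_univ i)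
  have hF : G.Feas (T * N + r) (T • J + x) :=
    ⟨fun e => ht (Sum.inl e) T (hTi _), (hJr.smul T).add h, fun X => ht (Sum.inr X) T (hTi _)⟩
  have := (edmonds hF).span
  have h2 := Submodule.sub_mem _ this (Submodule.smul_mem _ T hJs)
  simpa using h2

end MG

end Edmonds

end PML

namespace PML

set_option linter.unusedSectionVars false
set_option linter.unusedDecidableInType false
set_option linter.unusedFintypeInType false

universe u v

lemma map_closure_le {β : Type v} {S S' : Set (β → ℚ)} (f : (β → ℚ) →ₗ[ℚ] (β → ℚ))
    (h : ∀ x ∈ S, f x ∈ AddSubgroup.closure S') {x : β → ℚ} (hx : x ∈ AddSubgroup.closure S) :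
    f x ∈ AddSubgroup.closure S' := by
  induction hx using AddSubgroup.closure_induction with
  | mem x hx => exact h x hx
  | zero => rw [map_zero]; exact AddSubgroup.zero_mem _
  | add x y _ _ hx hy => rw [map_add]; exact AddSubgroup.add_mem _ hx hy
  | neg x _ hx => rw [map_neg]; exact AddSubgroup.neg_mem _ hx

lemma map_span_le {β : Type v} {S S' : Set (β → ℚ)} (f : (β → ℚ) →ₗ[ℚ] (β → ℚ))
    (h : ∀ x ∈ S, f x ∈ Submodule.span ℚ S') {x : β → ℚ} (hx : x ∈ Submodule.span ℚ S) :
    f x ∈ Submodule.span ℚ S' := by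
  induction hx using Submodule.span_induction with
  | mem x hx => exact h x hx
  | zero => rw [map_zero]; exact Submodule.zero_mem _
  | add x y _ _ hx hy => rw [map_add]; exact Submodule.add_mem _ hx hy
  | smul c x _ hx => rw [map_smul]; exact Submodule.smul_mem _ _ hx

section Glue

variable {α : Type u} [Fintype α] [DecidableEq α] {β : Type v} [Fintype β] [DecidableEq β]

namespace MG

lemma mem_faceX [Nonempty α] {G : MG α β} {X : Finset α} (hX : Odd X.card) {m : β → ℚ} :
    m ∈ face G.pms (G.con (Sum.inr X)) ↔ G.PM m ∧ G.d X m = 1 := by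
  rw [mem_face, mem_pms, con_inr _ hX]
  refine and_congr_right fun h => ?_
  rw [h.1.ell]
  constructor
  · intro h; linarith
  · intro h; rw [h]; norm_num

theorem TT_glue {G : MG α β} {X : Finset α}
    (hcov : ∀ f ∈ G.cut X, ∃ m, G.PM m ∧ G.d X m = 1 ∧ m f = 1)
    (h1 : TT (G.ctr X).pms) (h2 : TT (G.ctr Xᶜ).pms) {F : Finset (β → ℚ)}
    (hF : ∀ m, m ∈ F ↔ G.PM m ∧ G.d X m = 1) : TT F := by
  classical
  have hK : ∀ f, ∃ m, f ∈ G.cut X → G.PM m ∧ G.d X m = 1 ∧ m f = 1 := by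
    intro f
    by_cases hf : f ∈ G.cut X
    · obtain ⟨m, hm⟩ := hcov f hf
      exact ⟨m, fun _ => hm⟩
    · exact ⟨0, fun h => absurd h hf⟩
  choose K hK using hK
  have hKe : ∀ f ∈ G.cut X, ∀ e ∈ G.cut X, K f e = if f = e then 1 else 0 := by
    intro f hf e he
    obtain ⟨k1, k2, k3⟩ := hK f hf
    obtain ⟨a, ha, ha1, ha2⟩ := k1.exists_unique_cut k2
    have hfa : f = a := by
      by_contra h; have := ha2 f hf h; rw [k3] at this; norm_num at this
    subst hfa
    split_ifs with h
    · rw [← h, k3]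
    · exact ha2 e he (Ne.symm h)
  let κ : (β → ℚ) →ₗ[ℚ] (β → ℚ) :=
    ∑ f ∈ G.cut X, (LinearMap.proj (R := ℚ) (φ := fun _ : β => ℚ) f).smulRight (K f)
  have hκ : ∀ x, κ x = ∑ f ∈ G.cut X, x f • K f := by
    intro x; simp [κ]
  have hκc : ∀ x, ∀ e ∈ G.cut X, κ x e = x e := by
    intro x e he
    rw [hκ, Finset.sum_apply]
    simp only [Pi.smul_apply, smul_eq_mul]
    rw [Finset.sum_congr rfl fun f hf => by rw [hKe f hf e he]]
    simp [he]
  have hκ' : ∀ x y, (∀ e ∈ G.cut X, x e = y e) → κ x = κ y := by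
    intro x y h
    rw [hκ, hκ]
    exact Finset.sum_congr rfl fun f hf => by rw [h f hf]
  have hκm : ∀ m : β → ℚ, (∃ f ∈ G.cut X, m f = 1 ∧ ∀ e ∈ G.cut X, e ≠ f → m e = 0) →
      ∃ f ∈ G.cut X, κ m = K f ∧ ∀ e ∈ G.cut X, m e = K f e := by
    rintro m ⟨f, hf, h1, h2⟩
    have : ∀ e ∈ G.cut X, m e = K f e := by
      intro e he
      rw [hKe f hf e he]
      split_ifs with h
      · rw [← h, h1]
      · exact h2 e he (Ne.symm h)
    refine ⟨f, hf, ?_, this⟩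
    rw [hκ, Finset.sum_eq_single f]
    · rw [h1, one_smul]
    · intro b hb hbf; rw [h2 b hb hbf, zero_smul]
    · intro h; exact absurd hf h
  let Ψ : (β → ℚ) →ₗ[ℚ] (β → ℚ) := LinearMap.id + κ - (G.res X).comp κ
  let Φ : (β → ℚ) →ₗ[ℚ] (β → ℚ) := LinearMap.id + κ - (G.res Xᶜ).comp κ
  have hΨ : ∀ x e, Ψ x e = x e + κ x e - G.res X (κ x) e := by intro x e; simp [Ψ]
  have hΦ : ∀ x e, Φ x e = x e + κ x e - G.res Xᶜ (κ x) e := by intro x e; simp [Φ]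
  have hΨF : ∀ m ∈ (G.ctr X).pms, Ψ m ∈ F := by
    intro m hm
    rw [mem_pms] at hm
    have hu := hm.exists_unique_cut (hm.1.2 none)
    rw [cut_ctr, pre_none, cut_compl] at hu
    obtain ⟨f, hf, h3, h4⟩ := hκm m hu
    obtain ⟨k1, k2, k3⟩ := hK f hf
    have hp := PM.glue hm (k1.res (X := Xᶜ) (by rw [d_compl, k2])) (by
      intro e he
      have := (mem_cut.1 he).2
      rw [res_apply, if_pos (by simp only [Finset.mem_compl]; tauto), h4 e he])
    have hEq : Ψ m = G.glue X m (G.res Xᶜ (K f)) := by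
      ext e
      rw [hΨ, h3, glue, res_apply, res_apply]
      simp only [Finset.mem_compl]
      by_cases h5 : G.s e ∈ X ∨ G.t e ∈ X
      · simp [h5]
      · have h6 : m e = 0 := hm.1.1 e fun h => h5 (mem_ctr_edges.1 h).2
        have h7 : G.s e ∉ X := fun h => h5 (Or.inl h)
        have h8 : G.t e ∉ X := fun h => h5 (Or.inr h)
        simp [h6, h7, h8]
    rw [hF, hEq]
    exact hp
  have hΦF : ∀ m ∈ (G.ctr Xᶜ).pms, Φ m ∈ F := by
    intro m hm
    rw [mem_pms] at hm
    have hu := hm.exists_unique_cut (hm.1.2 none)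
    rw [cut_ctr, pre_none, compl_compl] at hu
    obtain ⟨f, hf, h3, h4⟩ := hκm m hu
    obtain ⟨k1, k2, k3⟩ := hK f hf
    have hp := PM.glue (k1.res (X := X) k2) hm (by
      intro e he
      have := (mem_cut.1 he).2
      rw [res_apply, if_pos (by tauto), h4 e he])
    have hEq : Φ m = G.glue X (G.res X (K f)) m := by
      ext e
      rw [hΦ, h3, glue, res_apply, res_apply]
      simp only [Finset.mem_compl]
      by_cases h5 : G.s e ∈ X <;> by_cases h6 : G.t e ∈ X
      · have h7 : m e = 0 := hm.1.1 e fun h => by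
          have := (mem_ctr_edges.1 h).2
          simp only [Finset.mem_compl] at this
          tauto
        simp [h5, h6, h7]
      · by_cases he : e ∈ G.edges
        · have := h4 e (mem_cut.2 ⟨he, by tauto⟩)
          simp [h5, h6, this]
        · have h7 : m e = 0 := hm.1.1 e fun h => he (mem_ctr_edges.1 h).1
          have h8 : K f e = 0 := k1.1.1 e he
          simp [h5, h6, h7, h8]
      · by_cases he : e ∈ G.edges
        · have := h4 e (mem_cut.2 ⟨he, by tauto⟩)
          simp [h5, h6, this]
        · have h7 : m e = 0 := hm.1.1 e fun h => he (mem_ctr_edges.1 h).1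
          have h8 : K f e = 0 := k1.1.1 e he
          simp [h5, h6, h7, h8]
      · simp [h5, h6]
    rw [hF, hEq]
    exact hp
  intro x hx hxi
  have hxe : ∀ e, e ∉ G.edges → x e = 0 := by
    intro e he
    have : Submodule.span ℚ (F : Set (β → ℚ)) ≤ LinearMap.ker (LinearMap.proj (R := ℚ)
        (φ := fun _ : β => ℚ) e) := by
      rw [Submodule.span_le]
      intro m hm
      exact ((hF m).1 hm).1.1.1 e he
    exact this hx
  have hs1 : G.res X x ∈ Submodule.span ℚ ((G.ctr X).pms : Set (β → ℚ)) := by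
    refine map_span_le (G.res X) (fun m hm => Submodule.subset_span ?_) hx
    obtain ⟨k1, k2⟩ := (hF m).1 hm
    exact mem_pms.2 (k1.res k2)
  have hs2 : G.res Xᶜ x ∈ Submodule.span ℚ ((G.ctr Xᶜ).pms : Set (β → ℚ)) := by
    refine map_span_le (G.res Xᶜ) (fun m hm => Submodule.subset_span ?_) hx
    obtain ⟨k1, k2⟩ := (hF m).1 hm
    exact mem_pms.2 (k1.res (by rw [d_compl, k2]))
  have hri : ∀ Y, Integral (G.res Y x) := by
    intro Y e
    rw [res_apply]
    split_ifs
    · exact hxi e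
    · exact ⟨0, by simp⟩
  have t1 := map_closure_le Ψ (fun m hm => AddSubgroup.subset_closure (hΨF m hm)) (h1 _ hs1 (hri _))
  have t2 := map_closure_le Φ (fun m hm => AddSubgroup.subset_closure (hΦF m hm)) (h2 _ hs2 (hri _))
  have t3 : (2 : ℚ) • κ x ∈ AddSubgroup.closure (F : Set (β → ℚ)) := by
    have := zsmul_closure (S := (F : Set (β → ℚ))) (x := κ x) ?_ 2
    · exact_mod_cast this
    · rw [hκ]
      refine AddSubgroup.sum_mem _ fun f hf => ?_
      obtain ⟨z, hz⟩ := hxi f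
      rw [hz]
      obtain ⟨k1, k2, k3⟩ := hK f hf
      exact zsmul_closure (AddSubgroup.subset_closure ((hF _).2 ⟨k1, k2⟩)) z
  have hsum : (2 : ℚ) • x = Ψ ((2 : ℚ) • G.res X x) + Φ ((2 : ℚ) • G.res Xᶜ x) - (2 : ℚ) • κ x := by
    rw [map_smul, map_smul, ← smul_add, ← smul_sub]
    congr 1
    have e1 : κ (G.res X x) = κ x := hκ' _ _ fun e he => by
      have := (mem_cut.1 he).2
      rw [res_apply, if_pos (by tauto)]
    have e2 : κ (G.res Xᶜ x) = κ x := hκ' _ _ fun e he => by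
      have := (mem_cut.1 he).2
      rw [res_apply, if_pos (by simp only [Finset.mem_compl]; tauto)]
    ext e
    simp only [Pi.sub_apply, Pi.add_apply]
    rw [hΨ, hΦ, e1, e2]
    simp only [res_apply, Finset.mem_compl]
    have e0 : e ∉ G.edges → κ x e = 0 := by
      intro he
      rw [hκ, Finset.sum_apply]
      refine Finset.sum_eq_zero fun f hf => ?_
      simp [(hK f hf).1.1.1 e he]
    by_cases h5 : G.s e ∈ X <;> by_cases h6 : G.t e ∈ X
    · simp [h5, h6]
    · by_cases he : e ∈ G.edges
      · have := hκc x e (mem_cut.2 ⟨he, by tauto⟩)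
        simp [h5, h6, this]
      · simp [h5, h6, e0 he, hxe e he]
    · by_cases he : e ∈ G.edges
      · have := hκc x e (mem_cut.2 ⟨he, by tauto⟩)
        simp [h5, h6, this]
      · simp [h5, h6, e0 he, hxe e he]
    · simp [h5, h6]
  rw [hsum]
  exact AddSubgroup.sub_mem _ (AddSubgroup.add_mem _ t1 t2) t3

end MG

end Glue

end PML

namespace PML

set_option linter.unusedSectionVars false
set_option linter.unusedDecidableInType false
set_option linter.unusedFintypeInType false

universe u v

lemma Facet.of_eq {W : Type*} [AddCommGroup W] [Module ℚ W] {ι : Type*} [Fintype ι]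
    {S : Finset W} {g : ι → W →ₗ[ℚ] ℚ} {i j : ι} (hi : Facet S g i)
    (h : face S (g j) = face S (g i)) : Facet S g j :=
  ⟨by rw [h]; exact hi.1, fun k hk hk' => by rw [h] at hk ⊢; exact hi.2 k hk hk'⟩

section Main

variable {α : Type u} [Fintype α] [DecidableEq α] [Nonempty α]
  {β : Type v} [Fintype β] [DecidableEq β]

namespace MG

/-- matchings tight on `X` -/
def Tt (G : MG α β) (X : Finset α) (m : β → ℚ) : Prop := G.PM m ∧ G.d X m = 1

/-- being a facet, for an odd set -/
def Fc (G : MG α β) (X : Finset α) : Prop := Odd X.card ∧ Facet G.pms G.con (Sum.inr X)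

lemma face_sub_iff {G : MG α β} {X Y : Finset α} (hX : Odd X.card) (hY : Odd Y.card) :
    face G.pms (G.con (Sum.inr X)) ⊆ face G.pms (G.con (Sum.inr Y)) ↔
      ∀ m, G.Tt X m → G.Tt Y m := by
  constructor
  · intro h m hm
    exact (mem_faceX hY).1 (h ((mem_faceX hX).2 hm))
  · intro h m hm
    exact (mem_faceX hY).2 (h m ((mem_faceX hX).1 hm))

lemma face_eq_iff {G : MG α β} {X Y : Finset α} (hX : Odd X.card) (hY : Odd Y.card) :
    face G.pms (G.con (Sum.inr X)) = face G.pms (G.con (Sum.inr Y)) ↔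
      ∀ m, G.Tt X m ↔ G.Tt Y m := by
  rw [Finset.Subset.antisymm_iff, face_sub_iff hX hY, face_sub_iff hY hX]
  constructor
  · rintro ⟨h1, h2⟩ m; exact ⟨h1 m, h2 m⟩
  · intro h; exact ⟨fun m => (h m).1, fun m => (h m).2⟩

lemma face_full_iff {G : MG α β} {X : Finset α} (hX : Odd X.card) :
    face G.pms (G.con (Sum.inr X)) = G.pms ↔ ∀ m, G.PM m → G.d X m = 1 := by
  constructor
  · intro h m hm
    have : m ∈ face G.pms (G.con (Sum.inr X)) := by rw [h]; exact mem_pms.2 hm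
    exact ((mem_faceX hX).1 this).2
  · intro h
    refine Finset.Subset.antisymm (face_subset _ _) fun m hm => ?_
    exact (mem_faceX hX).2 ⟨mem_pms.1 hm, h m (mem_pms.1 hm)⟩

lemma Fc.cases {G : MG α β} {X Y : Finset α} (hX : G.Fc X) (hY : Odd Y.card)
    (h : ∀ m, G.Tt X m → G.Tt Y m) :
    (∀ m, G.PM m → G.d Y m = 1) ∨ (G.Fc Y ∧ ∀ m, G.Tt Y m ↔ G.Tt X m) := by
  by_cases hf : face G.pms (G.con (Sum.inr Y)) = G.pms
  · exact Or.inl ((face_full_iff hY).1 hf)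
  · have := hX.2.2 _ ((face_sub_iff hX.1 hY).2 h) hf
    exact Or.inr ⟨⟨hY, hX.2.of_eq this⟩, (face_eq_iff hY hX.1).1 this⟩

lemma Fc.congr {G : MG α β} {X Y : Finset α} (hX : G.Fc X) (hY : Odd Y.card)
    (h : ∀ m, G.Tt Y m ↔ G.Tt X m) : G.Fc Y :=
  ⟨hY, hX.2.of_eq ((face_eq_iff hY hX.1).2 h)⟩

lemma Fc.proper {G : MG α β} {X : Finset α} (hX : G.Fc X) : ∃ m, G.PM m ∧ G.d X m ≠ 1 := by
  by_contra hcon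
  push Not at hcon
  exact hX.2.1 ((face_full_iff hX.1).2 hcon)

lemma Fc.compl {G : MG α β} {X : Finset α} (hX : G.Fc X) (hα : Even (Fintype.card α)) :
    G.Fc Xᶜ :=
  hX.congr (odd_compl hX.1 hα) fun m => by simp only [Tt, d_compl]

lemma Fc.not_sub {G : MG α β} {X Y : Finset α} (hX : G.Fc X) (hY : G.Fc Y)
    (h : ¬ ∀ m, G.Tt X m ↔ G.Tt Y m) : ∃ m, G.Tt X m ∧ ¬ G.Tt Y m := by
  by_contra hcon
  push Not at hcon
  rcases hX.cases hY.1 hcon with h1 | h1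
  · obtain ⟨m, h2, h3⟩ := hY.proper
    exact h3 (h1 m h2)
  · exact h fun m => (h1.2 m).symm

lemma Fc.card {G : MG α β} {X : Finset α} (hX : G.Fc X) : 3 ≤ X.card := by
  have h1 : X.card ≠ 1 := by
    intro h
    obtain ⟨v, rfl⟩ := Finset.card_eq_one.1 h
    obtain ⟨m, h2, h3⟩ := hX.proper
    exact h3 (h2.1.2 v)
  have := hX.1
  rw [Nat.odd_iff] at this
  omega

/-- proportionality on a facet, for regular vectors in the span -/
lemma Fc.prop {G : MG α β} {X : Finset α} (hX : G.Fc X) {u : (β → ℚ) →ₗ[ℚ] ℚ}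
    (hu : ∀ m, G.Tt X m → u m = 0) {x y : β → ℚ}
    (hx : x ∈ Submodule.span ℚ (G.pms : Set (β → ℚ)))
    (hy : y ∈ Submodule.span ℚ (G.pms : Set (β → ℚ))) (hx1 : G.Reg 1 x) (hy1 : G.Reg 1 y) :
    u x * (G.d X y - 1) = u y * (G.d X x - 1) := by
  have := facet_prop G.sys hX.2 (u := u) (fun m hm => hu m ((mem_faceX hX.1).1 hm)) hx hy
  rw [con_inr _ hX.1, hx1.ell, hy1.ell] at this
  linarith

/-- what the hard part produces -/
def Win (G : MG α β) : Prop := ∃ X, G.Fc X ∧ ∃ γ, G.Reg 1 γ ∧ Integral γ ∧ G.d X γ = 3 ∧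
  (2 : ℚ) • γ ∈ AddSubgroup.closure (G.pms : Set (β → ℚ))

lemma Win.of_pm {G : MG α β} {X : Finset α} (hX : G.Fc X) {m : β → ℚ} (hm : G.PM m)
    (hd : G.d X m = 3) : G.Win := by
  refine ⟨X, hX, m, hm.1, hm.integral, hd, ?_⟩
  have := zsmul_closure (S := (G.pms : Set (β → ℚ))) (x := m)
    (AddSubgroup.subset_closure (mem_pms.2 hm)) 2
  exact_mod_cast this

/-- the situation of the hard part -/
structure Hd (G : MG α β) (X : Finset α) : Prop where
  ev : Even (Fintype.card α)
  cov : G.Cov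
  br : G.Brick
  ne : ∀ e ∈ G.edges, ¬ Facet G.pms G.con (Sum.inl e)
  fX : G.Fc X
  min : ∀ Y, G.Fc Y → X.card ≤ Y.card

lemma Hd.fcov {G : MG α β} {X : Finset α} (h : G.Hd X) {Y : Finset α} (hY : G.Fc Y) {e : β}
    (he : e ∈ G.edges) : ∃ m, G.Tt Y m ∧ m e = 1 := by
  by_contra hcon
  push Not at hcon
  have h1 : face G.pms (G.con (Sum.inr Y)) ⊆ face G.pms (G.con (Sum.inl e)) := by
    intro m hm
    have hm' := (mem_faceX hY.1).1 hm
    exact mem_face.2 ⟨mem_pms.2 hm'.1, (hm'.1.2 e).resolve_right (hcon m hm')⟩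
  have h2 : face G.pms (G.con (Sum.inl e)) ≠ G.pms := by
    obtain ⟨m, hm, hme⟩ := h.cov e he
    refine face_ne_iff.2 ⟨m, mem_pms.2 hm, ?_⟩
    rw [con_inl, hme]; norm_num
  exact h.ne e he (hY.2.of_eq (hY.2.2 _ h1 h2))

lemma Hd.cov' {G : MG α β} {X : Finset α} (h : G.Hd X) : (G.ctr X).Cov := by
  intro e he
  have he' := mem_ctr_edges.1 he
  obtain ⟨m, hm, hme⟩ := h.fcov h.fX he'.1
  exact ⟨_, hm.1.res hm.2, by rw [res_apply, if_pos he'.2, hme]⟩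

lemma Hd.br' {G : MG α β} {X : Finset α} (h : G.Hd X) : (G.ctr X).Brick := by
  have key : ∀ Z : Finset (Option {v // v ∈ X}), none ∉ Z → Odd Z.card →
      (∀ m, (G.ctr X).PM m → (G.ctr X).d Z m = 1) → Z.card = 1 ∨ Zᶜ.card = 1 := by
    intro Z hn hZ ht
    obtain ⟨hc, hs⟩ := pre_card_of_none Z hn
    have hodd : Odd (pre X Z).card := by rwa [hc]
    have h1 : ∀ m, G.Tt X m → G.Tt (pre X Z) m := by
      intro m hm
      refine ⟨hm.1, ?_⟩
      rw [← d_ctr_res]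
      exact ht _ (hm.1.res hm.2)
    rcases h.fX.cases hodd h1 with h2 | h2
    · rcases h.br _ hodd h2 with h3 | h3
      · left; rw [← hc, h3]
      · exfalso
        have h4 : Xᶜ ⊆ (pre X Z)ᶜ := Finset.compl_subset_compl.2 hs
        have h5 := Finset.card_le_card h4
        have h6 := (h.fX.compl h.ev).card
        omega
    · right
      have h3 := h.min _ h2.1
      have h4 := Finset.card_compl_add_card Z
      rw [card_option] at h4
      have h5 := Finset.card_le_card hs
      omega
  intro Z hZ ht
  by_cases hn : none ∈ Z
  · have hev : Even (Fintype.card (Option {v // v ∈ X})) := by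
      rw [card_option]
      exact h.fX.1.add_one
    have := key Zᶜ (by simpa using hn) (odd_compl hZ hev) (by simpa [d_compl] using ht)
    rw [compl_compl] at this
    exact this.symm
  · exact key Z hn hZ ht

lemma Tt.glue {G : MG α β} {X : Finset α} {m m' : β → ℚ} {f : β} (h : G.Tt X m) (h' : G.Tt X m')
    (hf : f ∈ G.cut X) (hm : m f = 1) (hm' : m' f = 1) :
    G.Tt X (G.glue X m m') ∧ (∀ Z, Z ⊆ X → G.d Z (G.glue X m m') = G.d Z m) ∧
      (∀ Z, Disjoint Z X → G.d Z (G.glue X m m') = G.d Z m') ∧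
      ∀ e ∈ G.cut X, m e = m' e := by
  obtain ⟨h1, h2⟩ := PM.glue' h.1 h'.1 h.2 h'.2 hf hm hm'
  have h3 := fun Z (hZ : Z ⊆ X) => G.d_glue_left hZ m m'
  exact ⟨⟨h2, (h3 X subset_rfl).trans h.2⟩, h3, fun Z hZ => G.d_glue_right hZ h1, h1⟩

lemma Tt.exists_cut {G : MG α β} {X : Finset α} {m : β → ℚ} (h : G.Tt X m) :
    ∃ f ∈ G.cut X, m f = 1 := by
  obtain ⟨f, hf, h1, -⟩ := h.1.exists_unique_cut h.2
  exact ⟨f, hf, h1⟩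

lemma Tt.unique {G : MG α β} {X : Finset α} {m : β → ℚ} (h : G.Tt X m) {e f : β}
    (he : e ∈ G.cut X) (hf : f ∈ G.cut X) (hme : m e = 1) (hmf : m f = 1) : e = f := by
  obtain ⟨a, ha, h1, h2⟩ := h.1.exists_unique_cut h.2
  have h3 : ∀ e ∈ G.cut X, m e = 1 → e = a := by
    intro e he hme
    by_contra hne
    have := h2 e he hne
    rw [hme] at this; norm_num at this
  rw [h3 e he hme, h3 f hf hmf]

lemma Tt.zero {G : MG α β} {X : Finset α} {m : β → ℚ} (h : G.Tt X m) {e f : β}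
    (he : e ∈ G.cut X) (hf : f ∈ G.cut X) (hmf : m f = 1) (hne : e ≠ f) : m e = 0 :=
  (h.1.2 e).resolve_right fun h1 => hne (h.unique he hf h1 hmf)

lemma sum_y (G : MG α β) (y : α → ℚ) (x : β → ℚ) :
    ∑ v, y v * G.d {v} x = ∑ e ∈ G.edges, x e * (y (G.s e) + y (G.t e)) := by
  simp only [d_eq, Finset.mul_sum]
  rw [Finset.sum_comm]
  refine Finset.sum_congr rfl fun e he => ?_
  have hne := G.ne e he
  have : ∀ v, (y v * if ¬ (G.s e ∈ ({v} : Finset α) ↔ G.t e ∈ ({v} : Finset α)) then x e else 0)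
      = (if G.s e = v then x e * y v else 0) + (if G.t e = v then x e * y v else 0) := by
    intro v
    simp only [Finset.mem_singleton]
    by_cases h1 : G.s e = v <;> by_cases h2 : G.t e = v
    · exact absurd (h1.trans h2.symm) hne
    · simp [h1, h2, mul_comm]
    · simp [h1, h2, mul_comm]
    · simp [h1, h2]
  rw [Finset.sum_congr rfl fun v _ => this v, Finset.sum_add_distrib]
  simp
  ring

end MG

end Main

end PML

namespace PML

set_option linter.unusedSectionVars false
set_option linter.unusedDecidableInType false
set_option linter.unusedFintypeInType false

universe u v

section Main

variable {α : Type u} [Fintype α] [DecidableEq α] [Nonempty α]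
  {β : Type v} [Fintype β] [DecidableEq β]

namespace MG

/-- the data produced by the first half of the uncrossing argument -/
structure Un (G : MG α β) (X Y : Finset α) (P : (β → ℚ) → Prop) : Prop where
  h : G.Hd X
  fY : G.Fc Y
  odd : Odd (X ∩ Y).card
  ne : ¬ ∀ m, G.Tt Y m ↔ G.Tt X m
  PX : ∀ m, P m → G.Tt X m
  PY : ∀ m, P m → G.Tt Y m
  Pg : ∀ m m0 f, G.Tt X m → P m0 → f ∈ G.cut X → m f = 1 → m0 f = 1 → P (G.glue X m0 m)
  Pcov : ∀ e ∈ G.edges, ¬ (G.s e ∈ X ∧ G.t e ∈ X) → ∃ m, P m ∧ m e = 1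
  Pmax : ∀ f1 ∈ G.edges, ∀ f2 ∈ G.edges, (G.s f1 ∈ X ∧ G.t f1 ∈ X) → (G.s f2 ∈ X ∧ G.t f2 ∈ X) →
    (∀ m, P m → m f1 = 0) → (∀ m, P m → m f2 = 0) → ∀ m, G.Tt X m → m f1 = m f2

lemma res_glue_left (G : MG α β) (X : Finset α) (x y : β → ℚ) :
    G.res X (G.glue X x y) = G.res X x := by
  ext e
  simp only [res_apply, glue]
  split_ifs <;> rfl

/-- extending a matching of the contraction -/
lemma Hd.ext {G : MG α β} {X : Finset α} (_h : G.Hd X) {k m : β → ℚ} (hk : (G.ctr X).PM k)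
    (hm : G.Tt X m) {f : β} (hf : f ∈ G.cut X) (hkf : k f = 1) (hmf : m f = 1) :
    G.Tt X (G.glue X k m) ∧ G.res X (G.glue X k m) = k := by
  have hkT := hk.exists_unique_cut (hk.1.2 none)
  rw [cut_ctr, pre_none, cut_compl] at hkT
  obtain ⟨a, ha, h1, h2⟩ := hkT
  have hfa : f = a := by
    by_contra hne; have := h2 f hf hne; rw [hkf] at this; norm_num at this
  subst hfa
  have hag : ∀ e ∈ G.cut X, k e = G.res Xᶜ m e := by
    intro e he
    have h3 := (mem_cut.1 he).2
    rw [res_apply, if_pos (by simp only [Finset.mem_compl]; tauto)]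
    by_cases hef : e = f
    · rw [hef, hkf, hmf]
    · rw [h2 e he hef, hm.zero he hf hmf hef]
  have h3 := PM.glue hk (hm.1.res (X := Xᶜ) (by rw [d_compl, hm.2])) hag
  have h4 : G.glue X k (G.res Xᶜ m) = G.glue X k m := by
    ext e
    simp only [glue, res_apply, Finset.mem_compl]
    split_ifs <;> first | rfl | tauto
  rw [h4] at h3
  exact ⟨h3, by rw [res_glue_left, hk.res_idem]⟩

lemma exists_ctr_cut {G : MG α β} {X : Finset α} {k : β → ℚ} (hk : (G.ctr X).PM k) :
    ∃ f ∈ G.cut X, k f = 1 := by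
  have hkT := hk.exists_unique_cut (hk.1.2 none)
  rw [cut_ctr, pre_none, cut_compl] at hkT
  obtain ⟨a, ha, h1, h2⟩ := hkT
  exact ⟨a, ha, h1⟩

lemma reg_ctr {G : MG α β} {X : Finset α} {z : β → ℚ} (hz : G.Reg 0 z)
    (hin : ∀ e, z e ≠ 0 → G.s e ∈ X ∧ G.t e ∈ X) : (G.ctr X).Reg 0 z := by
  refine ⟨fun e he => ?_, fun w => ?_⟩
  · by_contra hne
    refine he (mem_ctr_edges.2 ⟨?_, Or.inl (hin e hne).1⟩)
    by_contra h; exact hne (hz.1 e h)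
  · cases w with
    | none =>
      rw [ctr_d_none, d_apply]
      refine Finset.sum_eq_zero fun e he => ?_
      by_contra hne
      have := hin e hne
      exact (mem_cut.1 he).2 (iff_of_true this.1 this.2)
    | some w => rw [ctr_d_some, hz.2]

theorem Hd.exists_un {G : MG α β} {X : Finset α} (h : G.Hd X) {z : β → ℚ} (hz : G.Reg 0 z)
    (hin : ∀ e, z e ≠ 0 → G.s e ∈ X ∧ G.t e ∈ X) (h0 : z ≠ 0) : ∃ Y P, G.Un X Y P := by
  classical
  set H := G.ctr X with hH
  have hzH : H.Reg 0 z := reg_ctr hz hin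
  have hzs := elp h.cov' h.br' hzH
  have hneg : ∃ e, z e < 0 := by
    by_contra hcon
    push Not at hcon
    apply h0
    ext e
    by_cases he : e ∈ G.edges
    · have := G.le_d hcon (mem_cut_singleton.2 ⟨he, Or.inl rfl⟩ : e ∈ G.cut {G.s e})
      rw [hz.2] at this
      exact le_antisymm this (hcon e)
    · exact hz.1 e he
  obtain ⟨en, hen⟩ := hneg
  obtain ⟨i, hi, T, hT, hcone⟩ := ray H.sys hzs ⟨Sum.inl en, hen⟩
  have hicov : ∀ f ∈ G.cut X, ∃ k ∈ face H.pms (H.con i), k f = 1 := by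
    intro f hf
    by_contra hcon
    push Not at hcon
    obtain ⟨c, hc, hce⟩ := hcone
    have hf' := (mem_cut.1 hf)
    have h1 := congrFun hce f
    rw [Finset.sum_apply, Finset.sum_eq_zero (s := face H.pms (H.con i))] at h1
    · have hzf : z f = 0 := by
        by_contra hne
        have := hin f hne
        exact hf'.2 (iff_of_true this.1 this.2)
      obtain ⟨m, hm, hmf⟩ := h.cov' f (mem_ctr_edges.2 ⟨hf'.1, by tauto⟩)
      have hpos : 0 < (∑ m ∈ H.pms, m) f := by
        rw [Finset.sum_apply]
        exact Finset.sum_pos' (fun m hm => (mem_pms.1 hm).nonneg f)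
          ⟨m, mem_pms.2 hm, by rw [hmf]; norm_num⟩
      rw [Pi.add_apply, Pi.smul_apply, hzf, add_zero, smul_eq_mul] at h1
      have := mul_pos hT hpos
      linarith
    · intro k hk
      have hk' := mem_pms.1 (mem_face.1 hk).1
      rw [Pi.smul_apply, (hk'.2 f).resolve_right (hcon k hk)]
      simp
  obtain ⟨j, hj, hij⟩ := exists_facet i hi
  let P : (β → ℚ) → Prop := fun m => G.Tt X m ∧ H.con j (G.res X m) = 0
  have hres : ∀ m, G.Tt X m → H.PM (G.res X m) := fun m hm => hm.1.res hm.2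
  -- covering
  have hPcov : ∀ e ∈ G.edges, ¬ (G.s e ∈ X ∧ G.t e ∈ X) → ∃ m, P m ∧ m e = 1 := by
    intro e he hne
    obtain ⟨m, hm, hme⟩ := h.fcov h.fX he
    obtain ⟨f, hf, hmf⟩ := hm.exists_cut
    obtain ⟨k, hk, hkf⟩ := hicov f hf
    have hk' := mem_face.1 (hij hk)
    obtain ⟨h1, h2⟩ := h.ext (mem_pms.1 hk'.1) hm hf hkf hmf
    refine ⟨_, ⟨h1, ?_⟩, ?_⟩
    · rw [h2]; exact hk'.2
    · simp only [glue]
      split_ifs with h3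
      · have hec : e ∈ G.cut X := mem_cut.2 ⟨he, by tauto⟩
        rw [hm.unique hec hf hme hmf, hkf]
      · exact hme
  -- the corresponding constraint of `G`
  have hk : ∃ k, ∀ m, G.Tt X m → (G.con k m = 0 ↔ H.con j (G.res X m) = 0) := by
    rcases j with e | Z
    · refine ⟨Sum.inl e, fun m hm => ?_⟩
      rw [con_inl, con_inl, res_apply]
      have heH : e ∈ H.edges := by
        by_contra hcon
        refine hj.1 (Finset.Subset.antisymm (face_subset _ _) fun m hm => mem_face.2 ⟨hm, ?_⟩)
        exact (mem_pms.1 hm).1.1 e hcon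
      rw [if_pos (mem_ctr_edges.1 heH).2]
    · by_cases hZ : Odd Z.card
      · refine ⟨Sum.inr (pre X Z), fun m hm => ?_⟩
        rw [con_inr _ ((pre_odd h.fX.1 h.ev Z).2 hZ), con_inr _ hZ, hm.1.1.ell,
          (hres m hm).1.ell, d_ctr_res]
      · exfalso
        apply hj.1
        simp [con, hZ, face]
  obtain ⟨k, hk⟩ := hk
  have hkn : ¬ face G.pms (G.con (Sum.inr X)) ⊆ face G.pms (G.con k) := by
    intro hsub
    obtain ⟨km, hkm, hkne⟩ := face_ne_iff.1 hj.1
    have hkm' := mem_pms.1 hkm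
    obtain ⟨f, hf, hkf⟩ := exists_ctr_cut hkm'
    obtain ⟨m, hm, hmf⟩ := h.fcov h.fX (cut_edges hf)
    obtain ⟨h1, h2⟩ := h.ext hkm' hm hf hkf hmf
    have h3 := (mem_face.1 (hsub ((mem_faceX h.fX.1).2 h1))).2
    rw [hk _ h1, h2] at h3
    exact hkne h3
  obtain ⟨j', hj', hjne, hjsub⟩ := second_facet G.sys h.fX.2 k hkn
  have hY : ∃ Y, G.Fc Y ∧ face G.pms (G.con (Sum.inr Y)) = face G.pms (G.con j') := by
    rcases j' with e | Y
    · exfalso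
      by_cases he : e ∈ G.edges
      · exact h.ne e he hj'
      · refine hj'.1 (Finset.Subset.antisymm (face_subset _ _) fun m hm => mem_face.2 ⟨hm, ?_⟩)
        exact (mem_pms.1 hm).1.1 e he
    · by_cases hY : Odd Y.card
      · exact ⟨Y, ⟨hY, hj'⟩, rfl⟩
      · exfalso
        apply hj'.1
        simp [con, hY, face]
  obtain ⟨Y0, hY0, hY0e⟩ := hY
  have hne0 : ¬ ∀ m, G.Tt Y0 m ↔ G.Tt X m := by
    intro hcon
    rw [← face_eq_iff hY0.1 h.fX.1, hY0e] at hcon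
    exact hjne hcon
  have hPY0 : ∀ m, P m → G.Tt Y0 m := by
    intro m hm
    rw [Tt, ← mem_faceX hY0.1, hY0e]
    refine hjsub m ((mem_faceX h.fX.1).2 hm.1) (mem_face.2 ⟨mem_pms.2 hm.1.1, ?_⟩)
    exact (hk m hm.1).2 hm.2
  have hY : ∃ Y, G.Fc Y ∧ Odd (X ∩ Y).card ∧ ∀ m, G.Tt Y m ↔ G.Tt Y0 m := by
    by_cases hodd : Odd (X ∩ Y0).card
    · exact ⟨Y0, hY0, hodd, fun _ => Iff.rfl⟩
    · refine ⟨Y0ᶜ, hY0.compl h.ev, ?_, fun m => by simp only [Tt, d_compl]⟩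
      have h1 := Finset.card_sdiff_add_card_inter X Y0
      rw [← Finset.sdiff_eq_inter_compl]
      have h2 := h.fX.1
      rw [Nat.odd_iff] at *
      omega
  obtain ⟨Y, hY, hodd, hYY⟩ := hY
  refine ⟨Y, P, ⟨h, hY, hodd, ?_, fun m hm => hm.1, fun m hm => (hYY m).2 (hPY0 m hm), ?_,
    hPcov, ?_⟩⟩
  · intro hcon
    exact hne0 fun m => by rw [← hYY, hcon]
  · intro m m0 f hm hm0 hf hmf hm0f
    have := (Tt.glue hm0.1 hm hf hm0f hmf).1
    exact ⟨this, by rw [res_glue_left]; exact hm0.2⟩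
  · have key : ∀ f ∈ G.edges, (G.s f ∈ X ∧ G.t f ∈ X) → (∀ m, P m → m f = 0) →
        face H.pms (H.con (Sum.inl f)) = face H.pms (H.con j) := by
      intro f hf hfX hP0
      have hfH : f ∈ H.edges := mem_ctr_edges.2 ⟨hf, Or.inl hfX.1⟩
      apply hj.2
      · intro km hkm
        have hkm' := mem_face.1 hkm
        obtain ⟨f', hf', hkf⟩ := exists_ctr_cut (mem_pms.1 hkm'.1)
        obtain ⟨m, hm, hmf⟩ := h.fcov h.fX (cut_edges hf')
        obtain ⟨h1, h2⟩ := h.ext (mem_pms.1 hkm'.1) hm hf' hkf hmf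
        have h3 := hP0 _ ⟨h1, by rw [h2]; exact hkm'.2⟩
        rw [glue, if_pos (Or.inl hfX.1)] at h3
        exact mem_face.2 ⟨hkm'.1, h3⟩
      · obtain ⟨m, hm, hmf⟩ := h.cov' f hfH
        refine face_ne_iff.2 ⟨m, mem_pms.2 hm, ?_⟩
        rw [con_inl, hmf]; norm_num
    intro f1 hf1 f2 hf2 hX1 hX2 hP1 hP2 m hm
    have heq := (key f1 hf1 hX1 hP1).trans (key f2 hf2 hX2 hP2).symm
    have hr := hres m hm
    have e1 : G.res X m f1 = m f1 := by rw [res_apply, if_pos (Or.inl hX1.1)]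
    have e2 : G.res X m f2 = m f2 := by rw [res_apply, if_pos (Or.inl hX2.1)]
    have h3 : m f1 = 0 ↔ m f2 = 0 := by
      have h4 := Finset.ext_iff.1 heq (G.res X m)
      rw [mem_face, mem_face, con_inl, con_inl, e1, e2] at h4
      have h5 := mem_pms.2 hr
      tauto
    rcases hm.1.2 f1 with h4 | h4 <;> rcases hm.1.2 f2 with h5 | h5
    · rw [h4, h5]
    · have := h3.1 h4; rw [h5] at this; norm_num at this
    · have := h3.2 h5; rw [h4] at this; norm_num at this
    · rw [h4, h5]

end MG

end Main

end PML

namespace PML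

set_option linter.unusedSectionVars false
set_option linter.unusedDecidableInType false
set_option linter.unusedFintypeInType false

universe u v

section Main

variable {α : Type u} [Fintype α] [DecidableEq α] [Nonempty α]
  {β : Type v} [Fintype β] [DecidableEq β]

namespace MG

lemma d_single (G : MG α β) (Z : Finset α) (f : β) :
    G.d Z (Pi.single f 1) = if f ∈ G.cut Z then 1 else 0 := by
  rw [d_apply]
  simp [Pi.single_apply]

namespace Un

variable {G : MG α β} {X Y : Finset α} {P : (β → ℚ) → Prop}

lemma oddD (h : G.Un X Y P) : Odd (X ∪ Y)ᶜ.card := by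
  refine odd_compl ?_ h.h.ev
  have h1 := Finset.card_union_add_card_inter X Y
  have h2 := h.odd
  have h3 := h.fY.1
  have h4 := h.h.fX.1
  rw [Nat.odd_iff] at *
  omega

lemma noBC (h : G.Un X Y P) {e : β} (he : e ∈ G.edges) :
    ¬ ((G.s e ∈ X \ Y ∧ G.t e ∈ Y \ X) ∨ (G.t e ∈ X \ Y ∧ G.s e ∈ Y \ X)) := by
  intro hcon
  obtain ⟨m, hm, hme⟩ := h.Pcov e he (by
    simp only [Finset.mem_sdiff] at hcon
    tauto)
  have h1 := G.uncross X Y m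
  rw [(h.PX m hm).2, (h.PY m hm).2] at h1
  have h2 := (h.PX m hm).1.one_le_d h.odd
  have h3 := (h.PX m hm).1.one_le_d h.oddD
  have h4 := Finset.single_le_sum (s := G.edges) (f := fun e =>
    if ((G.s e ∈ X \ Y ∧ G.t e ∈ Y \ X) ∨ (G.t e ∈ X \ Y ∧ G.s e ∈ Y \ X)) then m e else 0)
    (fun e _ => by
      split_ifs
      · exact (h.PX m hm).1.nonneg e
      · exact le_rfl) he
  simp only [hcon, if_true, hme] at h4
  linarith

lemma add (h : G.Un X Y P) (x : β → ℚ) :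
    G.d (X ∩ Y) x + G.d (X ∪ Y)ᶜ x = G.d X x + G.d Y x := by
  rw [← G.uncross X Y x, Finset.sum_eq_zero]
  · ring
  · intro e he
    rw [if_neg (h.noBC he)]

lemma TA (h : G.Un X Y P) {m : β → ℚ} (hX : G.Tt X m) (hY : G.Tt Y m) :
    G.d (X ∩ Y) m = 1 ∧ G.d (X ∪ Y)ᶜ m = 1 := by
  have h1 := h.add m
  rw [hX.2, hY.2] at h1
  have h2 := hX.1.one_le_d h.odd
  have h3 := hX.1.one_le_d h.oddD
  constructor <;> linarith

lemma disjD (X Y : Finset α) : Disjoint (X ∪ Y)ᶜ X := by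
  rw [Finset.disjoint_left]
  intro v hv hv'
  simp [hv'] at hv

lemma disjD' (X Y : Finset α) : Disjoint (X ∪ Y)ᶜ Y := by
  rw [Finset.disjoint_left]
  intro v hv hv'
  simp [hv'] at hv

lemma XD (h : G.Un X Y P) {m : β → ℚ} (hX : G.Tt X m) : G.Tt (X ∪ Y)ᶜ m := by
  refine ⟨hX.1, ?_⟩
  obtain ⟨f, hf, hmf⟩ := hX.exists_cut
  have hf' := mem_cut.1 hf
  obtain ⟨m0, hm0, hm0f⟩ := h.Pcov f hf'.1 (by tauto)
  have h1 := h.Pg m m0 f hX hm0 hf hmf hm0f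
  have h2 := (h.TA (h.PX _ h1) (h.PY _ h1)).2
  rwa [(Tt.glue (h.PX _ hm0) hX hf hm0f hmf).2.2.1 _ (disjD X Y)] at h2

lemma D (h : G.Un X Y P) (m : β → ℚ) : G.Tt (X ∪ Y)ᶜ m ↔ G.Tt X m := by
  rcases h.h.fX.cases h.oddD (fun m hm => h.XD hm) with h1 | h1
  · exfalso
    have hX3 := h.h.fX.card
    have hD : (X ∪ Y)ᶜ.card = 1 := by
      rcases h.h.br _ h.oddD h1 with h2 | h2
      · exact h2
      · rw [compl_compl] at h2
        have := Finset.card_le_card (Finset.subset_union_left : X ⊆ X ∪ Y)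
        omega
    have h2 := h.h.min _ (h.fY.compl h.h.ev)
    have h3 := Finset.card_compl_add_card Y
    have h4 := Finset.card_compl_add_card (X ∪ Y)
    have h5 := Finset.card_union_add_card_inter X Y
    have h6 := h.odd.pos
    have h7 : (X ∩ Y).card = 1 := by omega
    obtain ⟨a, ha⟩ := Finset.card_eq_one.1 h7
    obtain ⟨m, hm, hne⟩ := h.h.fX.proper
    have h8 := h.add m
    rw [ha, hm.1.2, h1 m hm] at h8
    have h9 := hm.one_le_d h.h.fX.1
    have h10 := hm.one_le_d h.fY.1
    exact hne (by linarith)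
  · exact h1.2 m

lemma contra (h : G.Un X Y P) {x : β → ℚ} (hx : G.Reg 1 x) (h1 : G.d (X ∩ Y) x = G.d Y x)
    (h2 : G.d X x ≠ 1) : False := by
  have hs := elp h.h.cov h.h.br hx
  have h3 : ∀ m, G.PM m → G.d (X ∩ Y) m = G.d Y m := by
    intro m hm
    have := h.h.fX.prop (u := G.ell (X ∪ Y)ᶜ) (fun m hm => by
      rw [hm.1.1.ell, (h.XD hm).2]; norm_num) hs (Submodule.subset_span (mem_pms.2 hm)) hx hm.1
    rw [hx.ell, hm.1.ell] at this
    have e1 := h.add x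
    have e2 := h.add m
    have e3 : G.d (X ∪ Y)ᶜ x = G.d X x := by linarith
    rw [e3] at this
    have e4 : (G.d X x - 1) * (G.d X m - G.d (X ∪ Y)ᶜ m) = 0 := by linarith
    rcases mul_eq_zero.1 e4 with e | e
    · exact absurd (by linarith) h2
    · linarith
  have h4 : ∀ m, G.Tt (X ∩ Y) m ↔ G.Tt Y m := by
    intro m
    constructor
    · rintro ⟨k1, k2⟩; exact ⟨k1, by rw [← h3 m k1, k2]⟩
    · rintro ⟨k1, k2⟩; exact ⟨k1, by rw [h3 m k1, k2]⟩
  have h5 := h.h.min _ (h.fY.congr h.odd h4)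
  have h6 := Finset.eq_of_subset_of_card_le Finset.inter_subset_left h5
  rw [h6] at h4
  exact h.ne fun m => (h4 m).symm

lemma nocov (h : G.Un X Y P) {M : β → ℚ} {f : β} (hM : G.Tt Y M) (hMX : ¬ G.Tt X M)
    (hf : f ∈ G.cut Y) (hMf : M f = 1) {M0 : β → ℚ} (h1 : G.Tt X M0) (h2 : G.Tt Y M0) :
    M0 f = 0 := by
  refine (h1.1.2 f).resolve_right fun h3 => ?_
  obtain ⟨k1, k2, k3, -⟩ := Tt.glue h2 hM hf h3 hMf
  have e1 := k2 _ (Finset.inter_subset_right : X ∩ Y ⊆ Y)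
  have e2 := k3 _ (disjD' X Y)
  rw [(h.TA h1 h2).1] at e1
  refine h.contra k1.1.1 (e1.trans k1.2.symm) ?_
  intro e3
  have e4 := h.add (G.glue Y M0 M)
  rw [e1, e2, k1.2, e3] at e4
  exact hMX ((h.D M).1 ⟨hM.1, by linarith⟩)

lemma inX (h : G.Un X Y P) {f : β} (hf : f ∈ G.cut Y)
    (hno : ∀ m, G.Tt X m → G.Tt Y m → m f = 0) : G.s f ∈ X ∧ G.t f ∈ X := by
  by_contra hcon
  obtain ⟨m, hm, hmf⟩ := h.Pcov f (cut_edges hf) hcon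
  rw [hno m (h.PX m hm) (h.PY m hm)] at hmf
  norm_num at hmf

lemma uniq (h : G.Un X Y P) {f1 f2 : β} (hf1 : f1 ∈ G.cut Y) (hf2 : f2 ∈ G.cut Y)
    (hno1 : ∀ m, G.Tt X m → G.Tt Y m → m f1 = 0) (hno2 : ∀ m, G.Tt X m → G.Tt Y m → m f2 = 0) :
    f1 = f2 := by
  by_contra hne
  have heq := h.Pmax f1 (cut_edges hf1) f2 (cut_edges hf2) (h.inX hf1 hno1) (h.inX hf2 hno2)
    (fun m hm => hno1 m (h.PX m hm) (h.PY m hm)) (fun m hm => hno2 m (h.PX m hm) (h.PY m hm))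
  obtain ⟨M1, hM1, hM1f⟩ := h.h.fcov h.fY (cut_edges hf1)
  obtain ⟨M2, hM2, hM2f⟩ := h.h.fcov h.fY (cut_edges hf2)
  have n1 : ¬ G.Tt X M1 := fun hX => by
    rw [hno1 M1 hX hM1] at hM1f; norm_num at hM1f
  have n2 : ¬ G.Tt X M2 := fun hX => by
    rw [hno2 M2 hX hM2] at hM2f; norm_num at hM2f
  have p : ∀ M, G.PM M → ¬ G.Tt X M → 0 < G.d X M - 1 := by
    intro M hM hn
    have h1 := hM.one_le_d h.h.fX.1
    have h2 : G.d X M ≠ 1 := fun h3 => hn ⟨hM, h3⟩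
    have := lt_of_le_of_ne h1 (Ne.symm h2)
    linarith
  have hu : ∀ m, G.Tt X m →
      (LinearMap.proj (R := ℚ) (φ := fun _ : β => ℚ) f1 -
        LinearMap.proj (R := ℚ) (φ := fun _ : β => ℚ) f2) m = 0 := by
    intro m hm
    rw [LinearMap.sub_apply, LinearMap.proj_apply, LinearMap.proj_apply, heq m hm, sub_self]
  have key := h.h.fX.prop hu (Submodule.subset_span (mem_pms.2 hM1.1))
    (Submodule.subset_span (mem_pms.2 hM2.1)) hM1.1.1 hM2.1.1
  simp only [LinearMap.sub_apply, LinearMap.proj_apply] at key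
  rw [hM1f, hM2f, hM1.zero hf2 hf1 hM1f (Ne.symm hne), hM2.zero hf1 hf2 hM2f hne] at key
  have := p M1 hM1.1 n1
  have := p M2 hM2.1 n2
  linarith

end Un

/-- degree vectors of integral vectors living inside `A` -/
def Dg (G : MG α β) (A : Finset α) (δ : α → ℚ) : Prop :=
  ∃ ζ : β → ℚ, Integral ζ ∧ (∀ e, ζ e ≠ 0 → e ∈ G.edges ∧ G.s e ∈ A ∧ G.t e ∈ A) ∧
    ∀ w, G.d {w} ζ = δ w

lemma Dg.add {G : MG α β} {A : Finset α} {δ δ' : α → ℚ} (h : G.Dg A δ) (h' : G.Dg A δ') :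
    G.Dg A (δ + δ') := by
  obtain ⟨z, h1, h2, h3⟩ := h
  obtain ⟨z', h1', h2', h3'⟩ := h'
  refine ⟨z + z', h1.add h1', fun e he => ?_, fun w => by rw [map_add, h3, h3']; rfl⟩
  by_cases hz : z e = 0
  · exact h2' e fun h => he (by simp [hz, h])
  · exact h2 e hz

lemma Dg.sub {G : MG α β} {A : Finset α} {δ δ' : α → ℚ} (h : G.Dg A δ) (h' : G.Dg A δ') :
    G.Dg A (δ - δ') := by
  obtain ⟨z, h1, h2, h3⟩ := h
  obtain ⟨z', h1', h2', h3'⟩ := h'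
  refine ⟨z - z', h1.sub h1', fun e he => ?_, fun w => by rw [map_sub, h3, h3']; rfl⟩
  by_cases hz : z e = 0
  · exact h2' e fun h => he (by simp [hz, h])
  · exact h2 e hz

lemma Dg.zero (G : MG α β) (A : Finset α) : G.Dg A 0 :=
  ⟨0, fun e => ⟨0, by simp⟩, fun e he => absurd rfl he, fun w => by simp⟩

lemma Dg.edge {G : MG α β} {A : Finset α} {e : β} (he : e ∈ G.edges) (hs : G.s e ∈ A)
    (ht : G.t e ∈ A) : G.Dg A (Pi.single (G.s e) 1 + Pi.single (G.t e) 1) := by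
  refine ⟨Pi.single e 1, fun f => ?_, fun f hf => ?_, fun w => ?_⟩
  · by_cases h : f = e
    · subst h; exact ⟨1, by simp⟩
    · exact ⟨0, by simp [h]⟩
  · have : f = e := by
      by_contra h; exact hf (by simp [h])
    subst this; exact ⟨he, hs, ht⟩
  · rw [d_single]
    have hne := G.ne e he
    simp only [mem_cut_singleton, Pi.add_apply, Pi.single_apply]
    by_cases h1 : G.s e = w <;> by_cases h2 : G.t e = w
    · exact absurd (h1.trans h2.symm) hne
    · simp [he, h1, h2, Ne.symm h2]
    · simp [he, h1, h2, Ne.symm h1]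
    · simp [h1, h2, Ne.symm h1, Ne.symm h2]

end MG

end Main

end PML

namespace PML

set_option linter.unusedSectionVars false
set_option linter.unusedDecidableInType false
set_option linter.unusedFintypeInType false

universe u v

section Main

variable {α : Type u} [Fintype α] [DecidableEq α] [Nonempty α]
  {β : Type v} [Fintype β] [DecidableEq β]

namespace MG

/-- the end inside `A` of a cut edge -/
def en (G : MG α β) (A : Finset α) (e : β) : α := if G.s e ∈ A then G.s e else G.t e

lemma en_mem {G : MG α β} {A : Finset α} {e : β} (he : e ∈ G.cut A) : G.en A e ∈ A := by
  have := (mem_cut.1 he).2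
  unfold en
  split_ifs with h
  · exact h
  · grind

lemma en_cut {G : MG α β} {A : Finset α} {e : β} (he : e ∈ G.cut A) {v : α} (hv : v ∈ A) :
    e ∈ G.cut {v} ↔ v = G.en A e := by
  have h1 := mem_cut.1 he
  rw [mem_cut_singleton]
  unfold en
  split_ifs with h
  · constructor
    · rintro ⟨-, h2 | h2⟩
      · exact h2.symm
      · rw [h2] at h1; grind
    · intro h2; exact ⟨h1.1, Or.inl h2.symm⟩
  · constructor
    · rintro ⟨-, h2 | h2⟩
      · rw [h2] at h; exact absurd hv h
      · exact h2.symm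
    · intro h2; exact ⟨h1.1, Or.inr h2.symm⟩

namespace Un

variable {G : MG α β} {X Y : Finset α} {P : (β → ℚ) → Prop}

lemma exists_Ms (h : G.Un X Y P) {M : β → ℚ} {f : β} (hM : G.Tt Y M)
    (hf : f ∈ G.cut Y) (hMf : M f = 1) (hfX : G.s f ∈ X ∧ G.t f ∈ X) :
    ∃ Ms, P Ms ∧ ∀ e ∈ G.cut (Y \ X), Ms e = 0 := by
  have h1 := hM.1.one_le_d h.oddD
  obtain ⟨g, hg, hMg⟩ : ∃ g ∈ G.cut (X ∪ Y)ᶜ, M g = 1 := by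
    by_contra hcon
    push Not at hcon
    rw [d_apply, Finset.sum_eq_zero fun e he => (hM.1.2 e).resolve_right (hcon e he)] at h1
    norm_num at h1
  have hgY : g ∉ G.cut Y := by
    intro hgY
    have := hM.unique hgY hf hMg hMf
    subst this
    have := mem_cut.1 hg
    simp [hfX.1, hfX.2] at this
  have hg' := mem_cut.1 hg
  simp only [mem_cut, not_and, not_not] at hgY
  have hgY' := hgY hg'.1
  simp only [Finset.mem_compl, Finset.mem_union] at hg'
  obtain ⟨Ms, hMs, hMsg⟩ := h.Pcov g hg'.1 (by grind)
  refine ⟨Ms, hMs, fun e he => ?_⟩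
  have hX := h.PX _ hMs
  have hD := h.XD hX
  refine (hX.1.2 e).resolve_right fun hme => ?_
  have he' := mem_cut.1 he
  have hbc := h.noBC he'.1
  simp only [Finset.mem_sdiff] at he' hbc
  have hne : e ≠ g := by
    rintro rfl
    grind
  have e1 : e ∉ G.cut X := fun h2 => hne (hX.unique h2 (mem_cut.2 ⟨hg'.1, by grind⟩) hme hMsg)
  have e2 : e ∉ G.cut (X ∪ Y)ᶜ := fun h2 => hne (hD.unique h2 hg hme hMsg)
  simp only [mem_cut, Finset.mem_compl, Finset.mem_union] at e1 e2
  grind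

lemma exitR (h : G.Un X Y P) {M : β → ℚ} {f : β} (hM : G.Tt Y M) (hMX : ¬ G.Tt X M)
    (hf : f ∈ G.cut Y) (hMf : M f = 1) (hfX : G.s f ∈ X ∧ G.t f ∈ X) {M0 : β → ℚ}
    (hX0 : G.Tt X M0) (hY0 : G.Tt Y M0) {f0 : β} (hf0 : f0 ∈ G.cut (X ∩ Y)) (hM0 : M0 f0 = 1)
    (hR : G.Dg (X ∩ Y) (Pi.single (G.en (X ∩ Y) f0) 1 - Pi.single (G.en (X ∩ Y) f) 1)) :
    False := by
  obtain ⟨Ms, hMs, hMsC⟩ := h.exists_Ms hM hf hMf hfX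
  obtain ⟨ζ, -, hζ, hζd⟩ := hR
  have hfA : f ∈ G.cut (X ∩ Y) := by
    have := mem_cut.1 hf
    rw [mem_cut]
    simp only [Finset.mem_inter]
    grind
  have hMc : ∀ e ∈ G.cut Y, M e = Pi.single (M := fun _ : β => ℚ) f 1 e := by
    intro e he
    by_cases hef : e = f
    · subst hef; simp [hMf]
    · simp [hef, hM.zero he hf hMf hef]
  have hA0 : G.Tt (X ∩ Y) M0 := ⟨hX0.1, (h.TA hX0 hY0).1⟩
  have hM0c : ∀ e ∈ G.cut (X ∩ Y), M0 e = Pi.single (M := fun _ : β => ℚ) f0 1 e := by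
    intro e he
    by_cases hef : e = f0
    · subst hef; simp [hM0]
    · simp [hef, hA0.zero he hf0 hM0 hef]
  have hζ0 : ∀ e, ¬ (G.s e ∈ X ∩ Y ∧ G.t e ∈ X ∩ Y) → ζ e = 0 := by
    intro e he
    by_contra h0
    exact he (hζ e h0).2
  let x : β → ℚ := fun e => if ¬ (G.s e ∈ Y ∧ G.t e ∈ Y) then M e else
    if G.s e ∈ X ∧ G.t e ∈ X then M0 e + ζ e else if G.s e ∉ X ∧ G.t e ∉ X then Ms e else 0
  have hreg : G.Reg 1 x := by
    constructor
    · intro e he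
      have z : ζ e = 0 := by
        by_contra h0; exact he (hζ e h0).1
      simp only [x, hM.1.1.1 e he, hX0.1.1.1 e he, (h.PX _ hMs).1.1.1 e he, z]
      simp
    · intro v
      by_cases hvY : v ∈ Y
      · by_cases hvX : v ∈ X
        · have hvA : v ∈ X ∩ Y := Finset.mem_inter.2 ⟨hvX, hvY⟩
          have e1 : G.d {v} x = G.d {v} (Pi.single f 1 + M0 - Pi.single f0 1 + ζ) := by
            refine G.d_congr fun e he => ?_
            have he' := mem_cut_singleton.1 he
            have hv' : (G.s e ∈ X ∧ G.s e ∈ Y) ∨ (G.t e ∈ X ∧ G.t e ∈ Y) := by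
              rcases he'.2 with h2 | h2
              · left; rw [h2]; exact ⟨hvX, hvY⟩
              · right; rw [h2]; exact ⟨hvX, hvY⟩
            simp only [Pi.add_apply, Pi.sub_apply]
            by_cases c1 : G.s e ∈ Y ∧ G.t e ∈ Y
            · by_cases c2 : G.s e ∈ X ∧ G.t e ∈ X
              · have n1 : e ≠ f := by
                  rintro rfl
                  have := mem_cut.1 hf
                  grind
                have n2 : e ≠ f0 := by
                  rintro rfl
                  have := mem_cut.1 hf0
                  simp only [Finset.mem_inter] at this
                  grind
                simp [x, c1, c2, n1, n2]
              · have n1 : e ≠ f := by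
                  rintro rfl
                  grind
                have hc : e ∈ G.cut (X ∩ Y) := by
                  rw [mem_cut]
                  simp only [Finset.mem_inter]
                  grind
                have c3 : ¬ (G.s e ∉ X ∧ G.t e ∉ X) := by grind
                rw [hζ0 e (by simp only [Finset.mem_inter]; grind), hM0c e hc]
                simp only [x]
                rw [if_neg (not_not.2 c1), if_neg c2, if_neg c3]
                simp [n1]
            · have hc : e ∈ G.cut (X ∩ Y) := by
                rw [mem_cut]
                simp only [Finset.mem_inter]
                grind
              have hc' : e ∈ G.cut Y := by
                rw [mem_cut]
                grind
              rw [hζ0 e (by simp only [Finset.mem_inter]; grind), hM0c e hc]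
              simp only [x]
              rw [if_pos c1, hMc e hc']
              ring
          rw [e1, map_add, map_sub, map_add, hζd, d_single, d_single, hX0.1.1.2]
          simp only [en_cut hfA hvA, en_cut hf0 hvA, Pi.sub_apply, Pi.single_apply]
          ring
        · rw [← (h.PX _ hMs).1.1.2 v]
          refine G.d_congr fun e he => ?_
          have he' := mem_cut_singleton.1 he
          have hv' : (G.s e ∉ X ∧ G.s e ∈ Y) ∨ (G.t e ∉ X ∧ G.t e ∈ Y) := by
            rcases he'.2 with h2 | h2
            · left; rw [h2]; exact ⟨hvX, hvY⟩
            · right; rw [h2]; exact ⟨hvX, hvY⟩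
          simp only [x]
          by_cases c1 : G.s e ∈ Y ∧ G.t e ∈ Y
          · have c2 : ¬ (G.s e ∈ X ∧ G.t e ∈ X) := by grind
            rw [if_neg (not_not.2 c1), if_neg c2]
            split_ifs with c3
            · rfl
            · rw [hMsC e]
              rw [mem_cut]
              simp only [Finset.mem_sdiff]
              grind
          · have hc' : e ∈ G.cut Y := by
              rw [mem_cut]
              grind
            have n1 : e ≠ f := by
              rintro rfl
              grind
            rw [if_pos c1, hMc e hc', hMsC e]
            · simp [n1]
            · rw [mem_cut]
              simp only [Finset.mem_sdiff]
              grind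
      · rw [← hM.1.1.2 v]
        refine G.d_congr fun e he => ?_
        have he' := mem_cut_singleton.1 he
        have c1 : ¬ (G.s e ∈ Y ∧ G.t e ∈ Y) := by
          rintro ⟨c, c'⟩
          rcases he'.2 with h2 | h2
          · rw [h2] at c; exact hvY c
          · rw [h2] at c'; exact hvY c'
        simp only [x]
        rw [if_pos c1]
  have dY : G.d Y x = 1 := by
    rw [← hM.2]
    refine G.d_congr fun e he => ?_
    have he' := mem_cut.1 he
    simp only [x]
    rw [if_pos (by grind)]
  have dA : G.d (X ∩ Y) x = 1 := by
    have : G.d (X ∩ Y) (Pi.single f 1) = 1 := by rw [d_single, if_pos hfA]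
    rw [← this]
    refine G.d_congr fun e he => ?_
    have he' := mem_cut.1 he
    simp only [Finset.mem_inter] at he'
    simp only [x]
    by_cases c1 : G.s e ∈ Y ∧ G.t e ∈ Y
    · have n1 : e ≠ f := by
        rintro rfl
        grind
      rw [if_neg (not_not.2 c1), if_neg (by grind), if_neg (by grind)]
      simp [n1]
    · rw [if_pos c1, hMc e]
      rw [mem_cut]
      grind
  have dD : G.d (X ∪ Y)ᶜ x = G.d (X ∪ Y)ᶜ M := by
    refine G.d_congr fun e he => ?_
    have he' := mem_cut.1 he
    simp only [Finset.mem_compl, Finset.mem_union] at he'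
    simp only [x]
    rw [if_pos (by grind)]
  refine h.contra hreg (dA.trans dY.symm) fun h1 => ?_
  have h2 := h.add x
  rw [dA, dY, h1, dD] at h2
  exact hMX ((h.D M).1 ⟨hM.1, by linarith⟩)

theorem win (h : G.Un X Y P) : G.Win := by
  classical
  obtain ⟨M, hM, hMX⟩ := h.fY.not_sub h.h.fX h.ne
  obtain ⟨f, hf, hMf⟩ := hM.exists_cut
  have hno : ∀ m, G.Tt X m → G.Tt Y m → m f = 0 := fun m h1 h2 => h.nocov hM hMX hf hMf h1 h2
  have hfX := h.inX hf hno
  obtain ⟨Ms, hMs, -⟩ := h.exists_Ms hM hf hMf hfX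
  have hfA : f ∈ G.cut (X ∩ Y) := by
    have := mem_cut.1 hf
    rw [mem_cut]
    simp only [Finset.mem_inter]
    grind
  have hex := fun {M0 : β → ℚ} => h.exitR (M0 := M0) hM hMX hf hMf hfX
  have hcov : ∀ e ∈ G.cut (X ∩ Y), e ≠ f → ∃ m, G.Tt X m ∧ G.Tt Y m ∧ m e = 1 := by
    intro e he hef
    by_cases heY : e ∈ G.cut Y
    · by_contra hcon
      push Not at hcon
      exact hef (h.uniq heY hf (fun m h1 h2 => (h1.1.2 e).resolve_right (hcon m h1 h2)) hno)
    · obtain ⟨m, hm, hme⟩ := h.Pcov e (cut_edges he) (by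
        have := mem_cut.1 he
        rw [mem_cut] at heY
        simp only [Finset.mem_inter] at this
        grind)
      exact ⟨m, h.PX m hm, h.PY m hm, hme⟩
  generalize hA : X ∩ Y = A at *
  set a := G.en A f with ha
  have haA : a ∈ A := en_mem hfA
  let R : α → Prop := fun v => v ∈ A ∧ G.Dg A (Pi.single v 1 - Pi.single a 1)
  let Q : α → Prop := fun v => v ∈ A ∧ G.Dg A (Pi.single v 1 + Pi.single a 1)
  have RQ : ∀ v w, v ∈ A → w ∈ A → G.Dg A (Pi.single v 1 + Pi.single w 1) → R v → Q w := by
    intro v w hv hw h1 h2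
    refine ⟨hw, ?_⟩
    have := h1.sub h2.2
    convert this using 1
    abel
  have QR : ∀ v w, v ∈ A → w ∈ A → G.Dg A (Pi.single v 1 + Pi.single w 1) → Q v → R w := by
    intro v w hv hw h1 h2
    refine ⟨hw, ?_⟩
    have := h1.sub h2.2
    convert this using 1
    abel
  have edge' : ∀ e ∈ G.edges, G.s e ∈ A → G.t e ∈ A →
      G.Dg A (Pi.single (G.t e) 1 + Pi.single (G.s e) 1) := by
    intro e h1 h2 h3
    rw [add_comm]
    exact Dg.edge h1 h2 h3
  have hRa : R a := ⟨haA, by rw [sub_self]; exact Dg.zero G A⟩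
  have hnR : ∀ e ∈ G.cut A, e ≠ f → ¬ R (G.en A e) := by
    intro e he hef hR
    obtain ⟨m, h1, h2, h3⟩ := hcov e he hef
    exact hex h1 h2 he h3 hR.2
  have TA : ∀ m, G.Tt X m → G.Tt Y m → G.Tt A m := fun m h1 h2 =>
    ⟨h1.1, by rw [← hA]; exact (h.TA h1 h2).1⟩
  by_cases hQ : ∀ e ∈ G.cut A, e ≠ f → Q (G.en A e)
  · -- case beta
    obtain ⟨f0, hf0, hMs0⟩ := (TA _ (h.PX _ hMs) (h.PY _ hMs)).exists_cut
    have hf0f : f0 ≠ f := by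
      rintro rfl
      rw [hno _ (h.PX _ hMs) (h.PY _ hMs)] at hMs0
      norm_num at hMs0
    have hdisj : ∀ v, R v → ¬ Q v := by
      intro v hR hQv
      have h1 := hQv.2.sub hR.2
      refine hnR f0 hf0 hf0f ⟨en_mem hf0, ?_⟩
      have := (hQ f0 hf0 hf0f).2.sub h1
      convert this using 1
      abel
    let y : α → ℚ := fun v => (if R v then 1 else 0) - (if Q v then 1 else 0)
    have hy0 : ∀ v, v ∉ A → y v = 0 := by
      intro v hv
      have h1 : ¬ R v := fun h => hv h.1
      have h2 : ¬ Q v := fun h => hv h.1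
      simp [y, h1, h2]
    have hyR : ∀ v, R v → y v = 1 := by
      intro v hv
      simp [y, hv, hdisj v hv]
    have hyQ : ∀ v, Q v → y v = -1 := by
      intro v hv
      have : ¬ R v := fun hR => hdisj v hR hv
      simp [y, hv, this]
    have key : ∀ m, G.PM m → ∑ v, y v = - G.d A m + 2 * m f := by
      intro m hm
      have h1 := G.sum_y y m
      rw [Finset.sum_congr rfl fun v _ => by rw [hm.1.2 v, mul_one]] at h1
      rw [h1]
      have h2 : 2 * m f = ∑ e ∈ G.edges, if e = f then 2 * m e else 0 := by
        rw [Finset.sum_ite_eq' G.edges f, if_pos (cut_edges hf)]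
      rw [h2, d_eq, ← Finset.sum_neg_distrib, ← Finset.sum_add_distrib]
      refine Finset.sum_congr rfl fun e he => ?_
      by_cases hcut : e ∈ G.cut A
      · have h3 : y (G.s e) + y (G.t e) = y (G.en A e) := by
          have := mem_cut.1 hcut
          unfold en
          split_ifs with h4
          · rw [hy0 (G.t e) (by grind)]; ring
          · rw [hy0 (G.s e) h4]; ring
        rw [h3, if_pos (mem_cut.1 hcut).2]
        by_cases hef : e = f
        · subst hef
          rw [hyR _ hRa, if_pos rfl]; ring
        · rw [hyQ _ (hQ e hcut hef), if_neg hef]; ring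
      · have hcut' : G.s e ∈ A ↔ G.t e ∈ A := by
          rw [mem_cut] at hcut; grind
        have hef : e ≠ f := by rintro rfl; exact hcut hfA
        rw [if_neg (not_not.2 hcut'), if_neg hef]
        have : y (G.s e) + y (G.t e) = 0 := by
          by_cases hs : G.s e ∈ A
          · have ht := hcut'.1 hs
            have i1 := RQ _ _ hs ht (Dg.edge he hs ht)
            have i2 := QR _ _ hs ht (Dg.edge he hs ht)
            have i3 := RQ _ _ ht hs (edge' e he hs ht)
            have i4 := QR _ _ ht hs (edge' e he hs ht)
            by_cases c1 : R (G.s e)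
            · rw [hyR _ c1, hyQ _ (i1 c1)]; ring
            · by_cases c2 : Q (G.s e)
              · rw [hyQ _ c2, hyR _ (i2 c2)]; ring
              · have c3 : ¬ R (G.t e) := fun c => c2 (i3 c)
                have c4 : ¬ Q (G.t e) := fun c => c1 (i4 c)
                simp [y, c1, c2, c3, c4]
          · rw [hy0 _ hs, hy0 _ (fun ht => hs (hcut'.2 ht))]; ring
        rw [this]; ring
    obtain ⟨M1, hM1, hM1f⟩ := h.h.fcov h.h.fX (cut_edges hf)
    have k1 := key _ (h.PX _ hMs).1
    have k2 := key _ hM1.1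
    rw [(TA _ (h.PX _ hMs) (h.PY _ hMs)).2, hno _ (h.PX _ hMs) (h.PY _ hMs)] at k1
    rw [hM1f, k1] at k2
    have k3 := h.add M1
    rw [hA, (h.XD hM1).2, hM1.2] at k3
    exact Win.of_pm h.fY hM1.1 (by linarith)
  · -- case alpha
    exfalso
    push Not at hQ
    obtain ⟨f0, hf0, hf0f, hnQ⟩ := hQ
    obtain ⟨M0, hX0, hY0, hM0⟩ := hcov f0 hf0 hf0f
    let K : Finset α := Finset.univ.filter fun v => R v ∨ Q v
    have hK : ∀ v, v ∈ K ↔ R v ∨ Q v := by intro v; simp [K]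
    have hKA : K ⊆ A := by
      intro v hv
      rcases (hK v).1 hv with h1 | h1
      · exact h1.1
      · exact h1.1
    have hKcut : ∀ e ∈ G.cut K, e ∈ G.cut A ∧ G.en A e ∈ K := by
      intro e he
      have he' := mem_cut.1 he
      have hnot : ¬ (G.s e ∈ A ∧ G.t e ∈ A) := by
        rintro ⟨hs, ht⟩
        have i1 := RQ _ _ hs ht (Dg.edge he'.1 hs ht)
        have i2 := QR _ _ hs ht (Dg.edge he'.1 hs ht)
        have i3 := RQ _ _ ht hs (edge' e he'.1 hs ht)
        have i4 := QR _ _ ht hs (edge' e he'.1 hs ht)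
        rw [hK, hK] at he'
        grind
      have j1 := @hKA (G.s e)
      have j2 := @hKA (G.t e)
      have hcA : e ∈ G.cut A := by
        rw [mem_cut]; grind
      refine ⟨hcA, ?_⟩
      unfold en
      split_ifs with hs <;> grind
    have hd0 : G.d K M0 = 0 := by
      rw [d_apply]
      refine Finset.sum_eq_zero fun e he => ?_
      obtain ⟨h1, h2⟩ := hKcut e he
      refine (hX0.1.2 e).resolve_right fun h3 => ?_
      have : e = f0 := (TA _ hX0 hY0).unique h1 hf0 h3 hM0
      subst this
      rcases (hK _).1 h2 with h4 | h4
      · exact hnR _ h1 hf0f h4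
      · exact hnQ h4
    have hpar : ∀ m, G.PM m → G.d K m ≠ 1 := by
      intro m hm h1
      obtain ⟨z, hz⟩ := parity hX0.1.integral K (fun v _ => hX0.1.1.2 v)
      obtain ⟨z', hz'⟩ := parity hm.integral K (fun v _ => hm.1.2 v)
      rw [hd0] at hz
      rw [h1] at hz'
      have : (1 : ℚ) = 2 * (z - z') := by linarith
      have : (1 : ℤ) = 2 * (z - z') := by exact_mod_cast this
      omega
    have hKf : G.cut K = {f} := by
      ext e
      rw [Finset.mem_singleton]
      constructor
      · intro he
        by_contra hef
        obtain ⟨m, h1, h2, h3⟩ := hcov e (hKcut e he).1 hef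
        have h4 := TA _ h1 h2
        refine hpar m h1.1 (le_antisymm ?_ ?_)
        · rw [← h4.2, d_apply, d_apply]
          exact Finset.sum_le_sum_of_subset_of_nonneg (fun e he => (hKcut e he).1)
            fun e _ _ => h1.1.nonneg e
        · rw [← h3]
          exact G.le_d h1.1.nonneg he
      · rintro rfl
        have h1 : a ∈ K := (hK a).2 (Or.inl hRa)
        have h2 := (mem_cut.1 hfA)
        rw [mem_cut]
        refine ⟨h2.1, ?_⟩
        have j1 := @hKA (G.s e)
        have j2 := @hKA (G.t e)
        rw [ha] at h1
        unfold en at h1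
        split_ifs at h1 <;> grind
    refine hpar M hM.1 ?_
    rw [d_apply, hKf, Finset.sum_singleton, hMf]

end Un

end MG

end Main

end PML

namespace PML

set_option linter.unusedSectionVars false
set_option linter.unusedDecidableInType false
set_option linter.unusedFintypeInType false

universe u v

section Main

variable {α : Type u} [Fintype α] [DecidableEq α] [Nonempty α]
  {β : Type v} [Fintype β] [DecidableEq β]

namespace MG

/-- edges inside `X` -/
def EX (G : MG α β) (X : Finset α) : Finset β := G.edges.filter fun e => G.s e ∈ X ∧ G.t e ∈ X

lemma mem_EX {G : MG α β} {X : Finset α} {e : β} :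
    e ∈ G.EX X ↔ e ∈ G.edges ∧ G.s e ∈ X ∧ G.t e ∈ X := by simp [EX]

/-- no dependency inside `X` -/
def Fr (G : MG α β) (X : Finset α) : Prop :=
  ∀ z, G.Reg 0 z → (∀ e, z e ≠ 0 → G.s e ∈ X ∧ G.t e ∈ X) → z = 0

lemma Fr.card_le {G : MG α β} {X : Finset α} (h : G.Fr X) : (G.EX X).card ≤ X.card := by
  let ext : ({e // e ∈ G.EX X} → ℚ) →ₗ[ℚ] (β → ℚ) :=
    Function.ExtendByZero.linearMap ℚ Subtype.val
  have ext1 : ∀ y (e : {e // e ∈ G.EX X}), ext y e.1 = y e := by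
    intro y e
    simp only [ext, Function.ExtendByZero.linearMap_apply]
    exact Subtype.val_injective.extend_apply _ _ _
  have ext0 : ∀ y e, e ∉ G.EX X → ext y e = 0 := by
    intro y e he
    simp only [ext, Function.ExtendByZero.linearMap_apply]
    rw [Function.extend_apply']
    · rfl
    · rintro ⟨a, rfl⟩; exact he a.2
  let F : ({e // e ∈ G.EX X} → ℚ) →ₗ[ℚ] ({v // v ∈ X} → ℚ) :=
    LinearMap.pi fun v => (G.d {v.1}).comp ext
  have hF : Function.Injective F := by
    rw [← LinearMap.ker_eq_bot, LinearMap.ker_eq_bot']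
    intro y hy
    have h1 : ext y = 0 := by
      refine h _ ⟨fun e he => ext0 y e fun h' => he (mem_EX.1 h').1, fun v => ?_⟩ fun e he => ?_
      · by_cases hv : v ∈ X
        · have := congrFun hy ⟨v, hv⟩
          simpa [F] using this
        · rw [d_apply]
          refine Finset.sum_eq_zero fun e he => ext0 y e fun h' => ?_
          have h1 := mem_EX.1 h'
          rcases (mem_cut_singleton.1 he).2 with h2 | h2
          · exact hv (h2 ▸ h1.2.1)
          · exact hv (h2 ▸ h1.2.2)
      · by_contra hc
        exact he (ext0 y e fun h' => hc (mem_EX.1 h').2)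
    funext e
    rw [← ext1 y e, h1]
    rfl
  have := LinearMap.finrank_le_finrank_of_injective hF
  simpa using this

lemma Hd.two_nb {G : MG α β} {X : Finset α} (h : G.Hd X) (h5 : 5 ≤ X.card) {p p' : α} (hp : p ∈ X)
    (hp' : p' ∈ X) (hne : p ≠ p') : ∃ e ∈ G.EX X, e ∈ G.cut {p} ∧ e ∉ G.cut {p'} := by
  by_contra hcon
  push Not at hcon
  set Z := (X.erase p).erase p' with hZ
  have hcard : Z.card = X.card - 2 := by
    rw [hZ, Finset.card_erase_of_mem (Finset.mem_erase.2 ⟨hne.symm, hp'⟩),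
      Finset.card_erase_of_mem hp]
    omega
  have hodd : Odd Z.card := by
    have := h.fX.1
    rw [Nat.odd_iff] at *
    omega
  have hle : ∀ m, G.PM m → G.d Z m ≤ G.d {p'} m + G.d X m - G.d {p} m := by
    intro m hm
    simp only [d_eq]
    rw [← Finset.sum_add_distrib, ← Finset.sum_sub_distrib]
    refine Finset.sum_le_sum fun e he => ?_
    have h0 := hm.nonneg e
    have h1 := hcon e
    have h2 := G.ne e he
    simp only [mem_EX, mem_cut_singleton, he, true_and] at h1
    simp only [hZ, Finset.mem_erase, Finset.mem_singleton]
    by_cases c1 : G.s e = p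
    · have c1' : G.t e ≠ p := fun h3 => h2 (c1.trans h3.symm)
      by_cases c2 : G.t e = p'
      · simp [c1, c2, hp, hp', hne, hne.symm]
      · have c3 : G.t e ∉ X := fun h3 => by
          rcases h1 ⟨by rw [c1]; exact hp, h3⟩ (Or.inl c1) with h4 | h4
          · exact hne (c1.symm.trans h4)
          · exact c2 h4
        simp [c1, c1', c2, c3, hp, hne, hne.symm]
    · by_cases c1' : G.t e = p
      · by_cases c2 : G.s e = p'
        · simp [c1', c2, hp, hp', hne, hne.symm]
        · have c3 : G.s e ∉ X := fun h3 => by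
            rcases h1 ⟨h3, by rw [c1']; exact hp⟩ (Or.inr c1') with h4 | h4
            · exact c2 h4
            · exact hne (c1'.symm.trans h4)
          simp [c1, c1', c2, c3, hp, hne, hne.symm]
      · by_cases c2 : G.s e = p' <;> by_cases c2' : G.t e = p' <;> by_cases c3 : G.s e ∈ X <;>
          by_cases c3' : G.t e ∈ X <;> simp [c1, c1', c2, c2', c3, c3', h0, hp', hne.symm]
  have hsub : ∀ m, G.Tt X m → G.Tt Z m := by
    intro m hm
    refine ⟨hm.1, le_antisymm ?_ (hm.1.one_le_d hodd)⟩
    have := hle m hm.1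
    rw [hm.1.1.2, hm.1.1.2, hm.2] at this
    linarith
  rcases h.fX.cases hodd hsub with h1 | h1
  · rcases h.br _ hodd h1 with h2 | h2
    · omega
    · have h3 := (h.fX.compl h.ev).card
      have h4 : Xᶜ ⊆ Zᶜ := by
        refine Finset.compl_subset_compl.2 fun v hv => ?_
        exact Finset.mem_of_mem_erase (Finset.mem_of_mem_erase hv)
      have := Finset.card_le_card h4
      omega
  · have := h.min _ h1.1
    omega

/-- the graph induced on `X` -/
def gX (G : MG α β) (X : Finset α) : SimpleGraph α where
  Adj u w := u ≠ w ∧ ∃ e ∈ G.EX X, (G.s e = u ∧ G.t e = w) ∨ (G.s e = w ∧ G.t e = u)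
  symm := ⟨by
    rintro u w ⟨h1, e, he, h2⟩
    exact ⟨h1.symm, e, he, h2.symm⟩⟩
  loopless := ⟨fun u h => h.1 rfl⟩

lemma gX_adj {G : MG α β} {X : Finset α} {u w : α} : (G.gX X).Adj u w ↔
    u ≠ w ∧ ∃ e ∈ G.EX X, (G.s e = u ∧ G.t e = w) ∨ (G.s e = w ∧ G.t e = u) := Iff.rfl

/-- the other end -/
def oth (G : MG α β) (v : α) (e : β) : α := if G.s e = v then G.t e else G.s e

lemma oth_adj {G : MG α β} {X : Finset α} {v : α} {e : β} (he : e ∈ G.EX X) (hv : e ∈ G.cut {v}) :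
    (G.gX X).Adj v (G.oth v e) := by
  have h1 := G.ne e (mem_EX.1 he).1
  have h2 := (mem_cut_singleton.1 hv).2
  rw [gX_adj]
  unfold oth
  split_ifs with h
  · exact ⟨fun h3 => h1 (h.trans h3), e, he, Or.inl ⟨h, rfl⟩⟩
  · exact ⟨fun h3 => h h3.symm, e, he, Or.inr ⟨rfl, h2.resolve_left h⟩⟩

lemma adj_oth {G : MG α β} {X : Finset α} {v w : α} (h : (G.gX X).Adj v w) :
    ∃ e ∈ G.EX X, e ∈ G.cut {v} ∧ G.oth v e = w := by
  obtain ⟨h1, e, he, h2⟩ := gX_adj.1 h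
  refine ⟨e, he, mem_cut_singleton.2 ⟨(mem_EX.1 he).1, by tauto⟩, ?_⟩
  unfold oth
  rcases h2 with ⟨h3, h4⟩ | ⟨h3, h4⟩
  · rw [if_pos h3, h4]
  · rw [if_neg, h3]
    rw [h3]; exact h1.symm

lemma adj_mem {G : MG α β} {X : Finset α} {v w : α} (h : (G.gX X).Adj v w) : v ∈ X ∧ w ∈ X := by
  obtain ⟨h1, e, he, h2⟩ := gX_adj.1 h
  have := (mem_EX.1 he).2
  rcases h2 with ⟨h3, h4⟩ | ⟨h3, h4⟩
  · rw [h3, h4] at this; exact this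
  · rw [h3, h4] at this; exact this.symm

lemma Hd.two_adj {G : MG α β} {X : Finset α} (h : G.Hd X) (h5 : 5 ≤ X.card) {v : α} (hv : v ∈ X) :
    ∃ a b e e', a ≠ b ∧ (G.gX X).Adj v a ∧ (G.gX X).Adj v b ∧ e ∈ G.EX X ∧ e' ∈ G.EX X ∧
      e ∈ G.cut {v} ∧ e' ∈ G.cut {v} ∧ e ≠ e' := by
  obtain ⟨p', hp', hne⟩ : ∃ p' ∈ X, p' ≠ v := Finset.exists_mem_ne (by omega) v
  obtain ⟨e, he, hev, -⟩ := h.two_nb h5 hv hp' hne.symm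
  have hadj := oth_adj he hev
  obtain ⟨e', he', hev', hno⟩ := h.two_nb h5 hv (adj_mem hadj).2 hadj.ne
  have hadj' := oth_adj he' hev'
  have k1 : G.oth v e ≠ G.oth v e' := by
    intro h1
    apply hno
    rw [h1, mem_cut_singleton]
    refine ⟨(mem_EX.1 he').1, ?_⟩
    unfold oth
    split_ifs <;> simp
  refine ⟨_, _, e, e', k1, hadj, hadj', he, he', hev, hev', ?_⟩
  rintro rfl
  exact k1 rfl

lemma Hd.deg2 {G : MG α β} {X : Finset α} (h : G.Hd X) (hfr : G.Fr X) (h5 : 5 ≤ X.card) :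
    ∀ v ∈ X, ((G.EX X).filter fun e => e ∈ G.cut {v}).card = 2 := by
  have hd : ∀ v, G.d {v} (fun e => if e ∈ G.EX X then 1 else 0) =
      ((G.EX X).filter fun e => e ∈ G.cut {v}).card := by
    intro v
    rw [d_apply, Finset.sum_ite_mem, Finset.inter_comm, Finset.filter_mem_eq_inter]
    simp
  have h2 : ∀ v ∈ X, (2 : ℚ) ≤ G.d {v} (fun e => if e ∈ G.EX X then 1 else 0) := by
    intro v hv
    obtain ⟨a, b, e, e', -, -, -, he, he', hev, hev', hne⟩ := h.two_adj h5 hv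
    rw [hd]
    have : ({e, e'} : Finset β).card ≤ ((G.EX X).filter fun e => e ∈ G.cut {v}).card := by
      refine Finset.card_le_card fun f hf => ?_
      rw [Finset.mem_insert, Finset.mem_singleton] at hf
      rw [Finset.mem_filter]
      rcases hf with rfl | rfl
      · exact ⟨he, hev⟩
      · exact ⟨he', hev'⟩
    rw [Finset.card_pair hne] at this
    exact_mod_cast this
  have hh := G.handshake X (fun e => if e ∈ G.EX X then 1 else 0)
  have h3 : G.d X (fun e => if e ∈ G.EX X then 1 else 0) = 0 := by
    rw [d_apply]
    refine Finset.sum_eq_zero fun e he => ?_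
    rw [if_neg]
    intro he'
    have := (mem_EX.1 he').2
    have := (mem_cut.1 he).2
    tauto
  have h4 : G.ins X (fun e => if e ∈ G.EX X then 1 else 0) = (G.EX X).card := by
    unfold ins
    have : ∀ e ∈ G.edges, (if G.s e ∈ X ∧ G.t e ∈ X then (if e ∈ G.EX X then (1 : ℚ) else 0) else 0)
        = if e ∈ G.EX X then (1 : ℚ) else 0 := by
      intro e he
      by_cases h' : G.s e ∈ X ∧ G.t e ∈ X
      · simp [h']
      · rw [if_neg h', if_neg]
        intro h''; exact h' (mem_EX.1 h'').2
    rw [Finset.sum_congr rfl this, Finset.sum_ite_mem, Finset.inter_eq_right.2]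
    · simp
    · intro e he; exact (mem_EX.1 he).1
  rw [h3, h4] at hh
  have h6 : ((G.EX X).card : ℚ) ≤ X.card := by exact_mod_cast hfr.card_le
  intro v hv
  have h7 : ∑ w ∈ X, (G.d {w} (fun e => if e ∈ G.EX X then 1 else 0) - 2) ≤ 0 := by
    rw [Finset.sum_sub_distrib, hh]
    simp
    linarith
  have h8 := Finset.single_le_sum (s := X)
    (f := fun w => G.d {w} (fun e => if e ∈ G.EX X then 1 else 0) - 2)
    (fun w hw => by have := h2 w hw; linarith) hv
  have h9 := h2 v hv
  have h10 : G.d {v} (fun e => if e ∈ G.EX X then 1 else 0) = 2 := by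
    linarith
  rw [hd] at h10
  exact_mod_cast h10

lemma Hd.isCycles {G : MG α β} {X : Finset α} (h : G.Hd X) (hfr : G.Fr X) (h5 : 5 ≤ X.card) :
    (G.gX X).IsCycles := by
  rintro v ⟨w, hw⟩
  have hv := (adj_mem hw).1
  refine le_antisymm ?_ ?_
  · have : (G.gX X).neighborSet v ⊆
        (((G.EX X).filter fun e => e ∈ G.cut {v}).image (G.oth v) : Finset α) := by
      intro w hw
      obtain ⟨e, he, hev, hw'⟩ := adj_oth hw
      rw [Finset.mem_coe, Finset.mem_image]
      exact ⟨e, Finset.mem_filter.2 ⟨he, hev⟩, hw'⟩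
    refine (Set.ncard_le_ncard this (Finset.finite_toSet _)).trans ?_
    rw [Set.ncard_coe_finset]
    refine Finset.card_image_le.trans ?_
    rw [h.deg2 hfr h5 v hv]
  · obtain ⟨a, b, e, e', hab, ha, hb, -⟩ := h.two_adj h5 hv
    have : ({a, b} : Set α) ⊆ (G.gX X).neighborSet v := by
      rintro x (rfl | rfl)
      · exact ha
      · exact hb
    have := Set.ncard_le_ncard this (Set.toFinite _)
    rwa [Set.ncard_pair hab] at this

/-- a cycle of length `n` inside `X` -/
structure Cy (G : MG α β) (X : Finset α) (n : ℕ) (c : ℕ → α) (ε : ℕ → β) : Prop where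
  three : 3 ≤ n
  inj : ∀ i < n, ∀ j < n, c i = c j → i = j
  last : c n = c 0
  mem : ∀ i < n, ε i ∈ G.EX X
  ends : ∀ i < n, (G.s (ε i) = c i ∧ G.t (ε i) = c (i + 1)) ∨
    (G.s (ε i) = c (i + 1) ∧ G.t (ε i) = c i)

lemma Hd.exists_cy {G : MG α β} {X : Finset α} (h : G.Hd X) (hfr : G.Fr X) (h5 : 5 ≤ X.card)
    {v : α} (hv : v ∈ X) : ∃ n c ε, G.Cy X n c ε ∧ c 0 = v ∧
      ∀ w, (∃ i < n, c i = w) ↔ (G.gX X).Reachable v w := by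
  classical
  obtain ⟨a, b, e, e', hab, ha, -⟩ := h.two_adj h5 hv
  obtain ⟨p, hp, hpv⟩ := (h.isCycles hfr h5).exists_cycle_toSubgraph_verts_eq_connectedComponentSupp
    (v := v) (c := (G.gX X).connectedComponentMk v) rfl ⟨a, ha⟩
  have hadj : ∀ i, i < p.length → (G.gX X).Adj (p.getVert i) (p.getVert (i + 1)) :=
    fun i hi => p.adj_getVert_succ hi
  have hex : ∀ i, ∃ e, i < p.length → e ∈ G.EX X ∧ ((G.s e = p.getVert i ∧
      G.t e = p.getVert (i + 1)) ∨ (G.s e = p.getVert (i + 1) ∧ G.t e = p.getVert i)) := by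
    intro i
    by_cases hi : i < p.length
    · obtain ⟨-, e, he, h2⟩ := gX_adj.1 (hadj i hi)
      exact ⟨e, fun _ => ⟨he, h2⟩⟩
    · exact ⟨e, fun h => absurd h hi⟩
  choose ε hε using hex
  have h3 := hp.three_le_length
  refine ⟨p.length, p.getVert, ε, ⟨h3, ?_, by simp, fun i hi => (hε i hi).1,
    fun i hi => (hε i hi).2⟩, by simp, fun w => ?_⟩
  · intro i hi j hj hij
    exact hp.getVert_injOn' (by simp only [Set.mem_ofPred_eq]; omega)
      (by simp only [Set.mem_ofPred_eq]; omega) hij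
  · have h6 : w ∈ p.toSubgraph.verts ↔ w ∈ ((G.gX X).connectedComponentMk v).supp := by rw [hpv]
    rw [SimpleGraph.Walk.mem_verts_toSubgraph, SimpleGraph.ConnectedComponent.mem_supp_iff,
      SimpleGraph.ConnectedComponent.eq, SimpleGraph.Walk.mem_support_iff_exists_getVert] at h6
    rw [SimpleGraph.reachable_comm, ← h6]
    constructor
    · rintro ⟨i, hi, rfl⟩; exact ⟨i, rfl, hi.le⟩
    · rintro ⟨i, rfl, hi⟩
      rcases hi.lt_or_eq with h7 | h7
      · exact ⟨i, h7, rfl⟩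
      · exact ⟨0, by omega, by rw [h7]; simp⟩

namespace Cy

variable {G : MG α β} {X : Finset α} {n : ℕ} {c : ℕ → α} {ε : ℕ → β}

lemma ne_succ (h : G.Cy X n c ε) {i : ℕ} (hi : i < n) : c i ≠ c (i + 1) := by
  have h1 := G.ne _ (mem_EX.1 (h.mem i hi)).1
  rcases h.ends i hi with h2 | h2
  · rw [← h2.1, ← h2.2]; exact h1
  · rw [← h2.1, ← h2.2]; exact h1.symm

lemma mem_cut (h : G.Cy X n c ε) {i : ℕ} (hi : i < n) (w : α) :
    ε i ∈ G.cut {w} ↔ w = c i ∨ w = c (i + 1) := by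
  rw [mem_cut_singleton]
  have h1 := (mem_EX.1 (h.mem i hi)).1
  rcases h.ends i hi with ⟨h2, h3⟩ | ⟨h2, h3⟩
  · rw [h2, h3]; constructor
    · rintro ⟨-, h4 | h4⟩
      · exact Or.inl h4.symm
      · exact Or.inr h4.symm
    · rintro (h4 | h4)
      · exact ⟨h1, Or.inl h4.symm⟩
      · exact ⟨h1, Or.inr h4.symm⟩
  · rw [h2, h3]; constructor
    · rintro ⟨-, h4 | h4⟩
      · exact Or.inr h4.symm
      · exact Or.inl h4.symm
    · rintro (h4 | h4)
      · exact ⟨h1, Or.inr h4.symm⟩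
      · exact ⟨h1, Or.inl h4.symm⟩

lemma c_mem (h : G.Cy X n c ε) {i : ℕ} (hi : i < n) : c i ∈ X := by
  have h1 := (mem_EX.1 (h.mem i hi)).2
  rcases h.ends i hi with h2 | h2
  · rw [← h2.1]; exact h1.1
  · rw [← h2.2]; exact h1.2

/-- positions of equal vertices, allowing the closing one -/
lemma inj_succ (h : G.Cy X n c ε) {i j : ℕ} (hi : i < n) (hj : j < n) (he : c (i + 1) = c j) :
    j = i + 1 ∨ (i + 1 = n ∧ j = 0) := by
  have := h.three
  rcases Nat.lt_or_ge (i + 1) n with h1 | h1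
  · left; exact (h.inj _ h1 _ hj he).symm
  · have h2 : i + 1 = n := by omega
    right
    refine ⟨h2, ?_⟩
    rw [h2, h.last] at he
    exact (h.inj 0 (by omega) _ hj he).symm

lemma ε_inj (h : G.Cy X n c ε) {i j : ℕ} (hi : i < n) (hj : j < n) (he : ε i = ε j) : i = j := by
  have h3 := h.three
  have h1 := (h.mem_cut hj (c i)).1 (by rw [← he]; exact (h.mem_cut hi _).2 (Or.inl rfl))
  have h2 := (h.mem_cut hj (c (i + 1))).1 (by rw [← he]; exact (h.mem_cut hi _).2 (Or.inr rfl))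
  rcases h1 with h1 | h1
  · exact h.inj _ hi _ hj h1
  · have h4 := h.inj_succ hj hi h1.symm
    rcases h2 with h2 | h2
    · have h5 := h.inj_succ hi hj h2
      omega
    · exact absurd (h1.trans h2.symm) (h.ne_succ hi)

/-- a vector on the cycle -/
noncomputable def vec (n : ℕ) (ε : ℕ → β) (co : ℕ → ℚ) : β → ℚ :=
  ∑ i ∈ Finset.range n, co i • (Pi.single (ε i) 1 : β → ℚ)

lemma vec_ε (h : G.Cy X n c ε) (co : ℕ → ℚ) {i : ℕ} (hi : i < n) : vec n ε co (ε i) = co i := by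
  unfold vec
  rw [Finset.sum_apply, Finset.sum_eq_single_of_mem i (Finset.mem_range.2 hi)]
  · simp
  · intro j hj hji
    have : ε i ≠ ε j := fun h' => hji (h.ε_inj hi (Finset.mem_range.1 hj) h').symm
    simp [this]

lemma vec_off (n : ℕ) (ε : ℕ → β) (co : ℕ → ℚ) {e : β} (he : ∀ i < n, e ≠ ε i) :
    vec n ε co e = 0 := by
  unfold vec
  rw [Finset.sum_apply]
  refine Finset.sum_eq_zero fun i hi => ?_
  simp [he i (Finset.mem_range.1 hi)]

lemma d_vec (h : G.Cy X n c ε) (co : ℕ → ℚ) (w : α) : G.d {w} (vec n ε co) =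
    (∑ i ∈ Finset.range n, if w = c i then co i else 0) +
      ∑ i ∈ Finset.range n, if w = c (i + 1) then co i else 0 := by
  unfold vec
  rw [map_sum, ← Finset.sum_add_distrib]
  refine Finset.sum_congr rfl fun i hi => ?_
  have hi' := Finset.mem_range.1 hi
  rw [map_smul, d_single]
  simp only [h.mem_cut hi' w]
  have := h.ne_succ hi'
  by_cases h1 : w = c i <;> by_cases h2 : w = c (i + 1)
  · exact absurd (h1.symm.trans h2) this
  · simp [← h1, h2]
  · simp [← h2, h1]
  · simp [h1, h2]

lemma d_vec_zero (h : G.Cy X n c ε) (co : ℕ → ℚ) :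
    G.d {c 0} (vec n ε co) = co 0 + co (n - 1) := by
  have h3 := h.three
  rw [h.d_vec]
  congr 1
  · rw [Finset.sum_eq_single_of_mem 0 (Finset.mem_range.2 (by omega)), if_pos rfl]
    intro j hj hj0
    rw [if_neg]
    intro h'
    exact hj0 (h.inj 0 (by omega) j (Finset.mem_range.1 hj) h').symm
  · rw [Finset.sum_eq_single_of_mem (n - 1) (Finset.mem_range.2 (by omega)), if_pos]
    · rw [Nat.sub_add_cancel (by omega), h.last]
    · intro j hj hj0
      have hj' := Finset.mem_range.1 hj
      rw [if_neg]
      intro h'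
      have := h.inj_succ hj' (show 0 < n by omega) h'.symm
      omega

lemma d_vec_succ (h : G.Cy X n c ε) (co : ℕ → ℚ) {k : ℕ} (hk : k + 1 < n) :
    G.d {c (k + 1)} (vec n ε co) = co (k + 1) + co k := by
  rw [h.d_vec]
  congr 1
  · rw [Finset.sum_eq_single_of_mem (k + 1) (Finset.mem_range.2 hk), if_pos rfl]
    intro j hj hj0
    rw [if_neg]
    intro h'
    exact hj0 (h.inj _ hk j (Finset.mem_range.1 hj) h').symm
  · rw [Finset.sum_eq_single_of_mem k (Finset.mem_range.2 (by omega)), if_pos rfl]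
    intro j hj hj0
    have hj' := Finset.mem_range.1 hj
    rw [if_neg]
    intro h'
    have := h.inj_succ hj' hk h'.symm
    omega

lemma d_vec_off (h : G.Cy X n c ε) (co : ℕ → ℚ) {w : α} (hw : ∀ i < n, w ≠ c i) :
    G.d {w} (vec n ε co) = 0 := by
  have h3 := h.three
  rw [h.d_vec, Finset.sum_eq_zero, Finset.sum_eq_zero, add_zero]
  · intro i hi
    have hi' := Finset.mem_range.1 hi
    rw [if_neg]
    rcases Nat.lt_or_ge (i + 1) n with h1 | h1
    · exact hw _ h1
    · have : i + 1 = n := by omega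
      rw [this, h.last]
      exact hw 0 (by omega)
  · intro i hi
    rw [if_neg (hw i (Finset.mem_range.1 hi))]

lemma odd (h : G.Cy X n c ε) (hfr : G.Fr X) : Odd n := by
  by_contra hn
  rw [Nat.not_odd_iff_even] at hn
  have h3 := h.three
  have hin : ∀ e, vec n ε (fun i => (-1 : ℚ) ^ i) e ≠ 0 → e ∈ G.EX X := by
    intro e he
    by_contra h1
    refine he (vec_off n ε _ fun i hi h2 => h1 ?_)
    rw [h2]; exact h.mem i hi
  have h0 := hfr (vec n ε (fun i => (-1 : ℚ) ^ i)) ⟨fun e he => ?_, fun w => ?_⟩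
    fun e he => (mem_EX.1 (hin e he)).2
  · have h1 := h.vec_ε (fun i => (-1 : ℚ) ^ i) (show 0 < n by omega)
    rw [h0] at h1
    norm_num at h1
  · by_contra h1
    exact he (mem_EX.1 (hin e h1)).1
  · by_cases hw : ∃ i < n, w = c i
    · obtain ⟨i, hi, rfl⟩ := hw
      cases i with
      | zero =>
        rw [h.d_vec_zero]
        have : Odd (n - 1) := by
          rw [Nat.odd_iff]; rw [Nat.even_iff] at hn; omega
        rw [this.neg_one_pow]; norm_num
      | succ k =>
        rw [h.d_vec_succ _ hi, pow_succ]; ring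
    · push Not at hw
      exact h.d_vec_off _ hw

end Cy

/-- an odd cycle spanning `X` and containing all inner edges -/
structure Cyc (G : MG α β) (X : Finset α) (n : ℕ) (c : ℕ → α) (ε : ℕ → β) : Prop where
  cy : G.Cy X n c ε
  odd : Odd n
  card : X.card = n
  surj : ∀ v ∈ X, ∃ i < n, c i = v
  esurj : ∀ e ∈ G.EX X, ∃ i < n, e = ε i

theorem Hd.exists_cyc {G : MG α β} {X : Finset α} (h : G.Hd X) (hfr : G.Fr X) (h5 : 5 ≤ X.card)
    {v : α} (hv : v ∈ X) : ∃ n c ε, G.Cyc X n c ε ∧ c 0 = v := by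
  classical
  obtain ⟨M, hM, -⟩ := h.fX.proper
  obtain ⟨e0, he0⟩ : ∃ e, e ∈ G.edges := by
    have := hM.1.2 v
    by_contra hcon
    push Not at hcon
    rw [d_eq, Finset.sum_eq_zero fun e he => absurd he (hcon e)] at this
    norm_num at this
  obtain ⟨m, hm, -⟩ := h.fcov h.fX he0
  obtain ⟨f, hf, hmf⟩ := hm.exists_cut
  have hcomp : ∀ w ∈ X, (G.gX X).Reachable w (G.en X f) := by
    intro w hw
    obtain ⟨n, c, ε, hcy, h0, hr⟩ := h.exists_cy hfr h5 hw
    by_contra hnr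
    set K := (Finset.range n).image c with hK
    have hKm : ∀ u, u ∈ K ↔ (G.gX X).Reachable w u := by
      intro u
      rw [← hr, hK, Finset.mem_image]
      simp only [Finset.mem_range]
    have hKX : ∀ u ∈ K, u ∈ X := by
      intro u hu
      rw [hK, Finset.mem_image] at hu
      obtain ⟨i, hi, rfl⟩ := hu
      exact hcy.c_mem (Finset.mem_range.1 hi)
    have hKc : K.card = n := by
      rw [hK, Finset.card_image_of_injOn, Finset.card_range]
      intro i hi j hj hij
      simp only [Finset.coe_range, Set.mem_Iio] at hi hj
      exact hcy.inj i hi j hj hij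
    have hd0 : G.d K m = 0 := by
      rw [d_apply]
      refine Finset.sum_eq_zero fun e he => ?_
      refine (hm.1.2 e).resolve_right fun hme => ?_
      have he' := MG.mem_cut.1 he
      by_cases hc : e ∈ G.cut X
      · have : e = f := hm.unique hc hf hme hmf
        subst this
        have k0 := MG.mem_cut.1 hc
        have k1 := hKX (G.s e)
        have k2 := hKX (G.t e)
        apply hnr
        rw [← hKm]
        unfold en
        split_ifs with hs <;> tauto
      · have k0 : G.s e ∈ X ↔ G.t e ∈ X := by
          rw [MG.mem_cut] at hc; tauto
        have k1 := hKX (G.s e)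
        have k2 := hKX (G.t e)
        have k3 : G.s e ∈ X := by tauto
        have kadj : (G.gX X).Adj (G.s e) (G.t e) :=
          gX_adj.2 ⟨G.ne e he'.1, e, mem_EX.2 ⟨he'.1, k3, k0.1 k3⟩, Or.inl ⟨rfl, rfl⟩⟩
        apply he'.2
        rw [hKm, hKm]
        exact ⟨fun h' => h'.trans kadj.reachable, fun h' => h'.trans kadj.symm.reachable⟩
    obtain ⟨z, hz⟩ := parity hm.1.integral K fun u _ => hm.1.1.2 u
    rw [hd0, hKc] at hz
    have h1 := hcy.odd hfr
    obtain ⟨k, hk⟩ := h1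
    rw [hk] at hz
    have : (0 : ℤ) = (2 * k + 1 : ℤ) - 2 * z := by
      push_cast at hz
      exact_mod_cast hz
    omega
  obtain ⟨n, c, ε, hcy, h0, hr⟩ := h.exists_cy hfr h5 hv
  have hsurj : ∀ w ∈ X, ∃ i < n, c i = w := fun w hw =>
    (hr w).2 ((hcomp v hv).trans (hcomp w hw).symm)
  have hX : X = (Finset.range n).image c := by
    ext w
    simp only [Finset.mem_image, Finset.mem_range]
    constructor
    · exact hsurj w
    · rintro ⟨i, hi, rfl⟩; exact hcy.c_mem hi
  have hcard : X.card = n := by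
    rw [hX, Finset.card_image_of_injOn, Finset.card_range]
    intro i hi j hj hij
    simp only [Finset.coe_range, Set.mem_Iio] at hi hj
    exact hcy.inj i hi j hj hij
  refine ⟨n, c, ε, ⟨hcy, hcy.odd hfr, hcard, hsurj, fun e he => ?_⟩, h0⟩
  have hE : (Finset.range n).image ε = G.EX X := by
    refine Finset.eq_of_subset_of_card_le (fun e he => ?_) ?_
    · obtain ⟨i, hi, rfl⟩ := Finset.mem_image.1 he
      exact hcy.mem i (Finset.mem_range.1 hi)
    · rw [Finset.card_image_of_injOn, Finset.card_range, ← hcard]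
      · exact hfr.card_le
      · intro i hi j hj hij
        simp only [Finset.coe_range, Set.mem_Iio] at hi hj
        exact hcy.ε_inj hi hj hij
  rw [← hE] at he
  obtain ⟨i, hi, rfl⟩ := Finset.mem_image.1 he
  exact ⟨i, Finset.mem_range.1 hi, rfl⟩

end MG

end Main

end PML

namespace PML

set_option linter.unusedSectionVars false
set_option linter.unusedDecidableInType false
set_option linter.unusedFintypeInType false

universe u v

section Main

variable {α : Type u} [Fintype α] [DecidableEq α] [Nonempty α]
  {β : Type v} [Fintype β] [DecidableEq β]

namespace MG

lemma bin_cut {G : MG α β} {N : β → ℚ} (hN : ∀ e, N e = 0 ∨ N e = 1) {Z : Finset α}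
    (hZ : G.d Z N = 1) : ∃ f ∈ G.cut Z, N f = 1 ∧ ∀ e ∈ G.cut Z, e ≠ f → N e = 0 := by
  rw [d_apply] at hZ
  have h0 : ∀ e, 0 ≤ N e := by
    intro e; rcases hN e with h | h <;> rw [h]; norm_num
  have : ∃ f ∈ G.cut Z, N f ≠ 0 := by
    by_contra hcon
    push Not at hcon
    rw [Finset.sum_eq_zero hcon] at hZ
    norm_num at hZ
  obtain ⟨f, hf, hf0⟩ := this
  have hf1 : N f = 1 := (hN f).resolve_left hf0
  refine ⟨f, hf, hf1, fun e he hef => ?_⟩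
  rw [← Finset.add_sum_erase _ _ hf, hf1] at hZ
  have h1 : ∑ x ∈ (G.cut Z).erase f, N x = 0 := by linarith
  rw [Finset.sum_eq_zero_iff_of_nonneg fun e _ => h0 e] at h1
  exact h1 e (Finset.mem_erase.2 ⟨hef, he⟩)

lemma exch_core (G : MG α β) : ∀ (k : ℕ) (U : Finset α), U.card = k → ∀ N1 N2 : β → ℚ,
    (∀ e, N1 e = 0 ∨ N1 e = 1) → (∀ e, N2 e = 0 ∨ N2 e = 1) → (∀ u ∈ U, G.d {u} N1 = 1) →
    (∀ u ∈ U, G.d {u} N2 = 1) → ∀ f ∈ G.cut U, N1 f = 1 → N2 f = 0 →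
    ∃ (f' : β) (w : β → ℚ), f' ∈ G.cut U ∧ f' ≠ f ∧ N1 f' ≠ N2 f' ∧
      (∀ e, w e = 0 ∨ w e = N1 e - N2 e) ∧ w f = 1 ∧ w f' = N1 f' - N2 f' ∧
      (∀ e ∈ G.cut U, e ≠ f → e ≠ f' → w e = 0) ∧ (∀ e, w e ≠ 0 → G.s e ∈ U ∨ G.t e ∈ U) ∧
      ∀ u ∈ U, G.d {u} w = 0 := by
  intro k
  induction k with
  | zero =>
    intro U hU N1 N2 _ _ _ _ f hf
    rw [Finset.card_eq_zero] at hU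
    subst hU
    have := (mem_cut.1 hf).2
    simp at this
  | succ k ih =>
    intro U hU N1 N2 b1 b2 c1 c2 f hf hf1 hf2
    have hf' := mem_cut.1 hf
    set u := G.en U f with hu
    have huU : u ∈ U := en_mem hf
    have hfu : f ∈ G.cut {u} := (en_cut hf huU).2 rfl
    obtain ⟨f1, k1, k2, k3⟩ := bin_cut b1 (c1 u huU)
    have hff1 : f = f1 := by
      by_contra hne
      rw [k3 f hfu hne] at hf1; norm_num at hf1
    subst hff1
    obtain ⟨g, hg, hg2, hg3⟩ := bin_cut b2 (c2 u huU)
    have hgf : g ≠ f := by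
      rintro rfl; rw [hg2] at hf2; norm_num at hf2
    have hg1 : N1 g = 0 := k3 g hg hgf
    have hgs := mem_cut_singleton.1 hg
    have hfs := mem_cut_singleton.1 hfu
    have hgne := G.ne g hgs.1
    by_cases hgU : g ∈ G.cut U
    · refine ⟨g, Pi.single f 1 - Pi.single g 1, hgU, hgf, by rw [hg1, hg2]; norm_num, fun e => ?_,
        ?_, ?_, ?_, ?_, ?_⟩
      · by_cases e1 : e = f
        · subst e1; right; simp [hf1, hf2, Ne.symm hgf]
        · by_cases e2 : e = g
          · subst e2; right; simp [hg1, hg2, e1]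
          · left; simp [e1, e2]
      · simp [Ne.symm hgf]
      · simp [hgf, hg1, hg2]
      · intro e _ e1 e2
        simp [e1, e2]
      · intro e he
        by_cases e1 : e = f
        · subst e1; have := hf'.2; grind
        · by_cases e2 : e = g
          · subst e2; have := (mem_cut.1 hgU).2; grind
          · exact absurd (by simp [e1, e2]) he
      · intro u' hu'
        rw [map_sub, d_single, d_single]
        have h1 := en_cut hf hu'
        have h2 := en_cut hgU hu'
        have h3 := (en_cut hgU huU).1 hg
        rw [← h3] at h2
        rw [← hu] at h1
        simp only [h1, h2, sub_self]
    · have hgin : G.s g ∈ U ∧ G.t g ∈ U := by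
        rw [mem_cut] at hgU
        rcases hgs.2 with h1 | h1
        · rw [h1] at hgU ⊢; grind
        · rw [h1] at hgU ⊢; grind
      have hgU' : g ∈ G.cut (U.erase u) := by
        rw [mem_cut]
        simp only [Finset.mem_erase]
        refine ⟨hgs.1, ?_⟩
        rcases hgs.2 with h1 | h1
        · have : G.t g ≠ u := fun h2 => hgne (h1.trans h2.symm)
          grind
        · have : G.s g ≠ u := fun h2 => hgne (h2.trans h1.symm)
          grind
      obtain ⟨f', w, i1, i2, i3, i4, i5, i6, i7, i8, i9⟩ := ih (U.erase u)
        (by rw [Finset.card_erase_of_mem huU, hU]; rfl) N2 N1 b2 b1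
        (fun x hx => c2 x (Finset.mem_of_mem_erase hx)) (fun x hx => c1 x (Finset.mem_of_mem_erase hx))
        g hgU' hg2 hg1
      have hfU' : f ∉ G.cut (U.erase u) := by
        have h1 := G.ne f hf'.1
        rw [mem_cut]
        simp only [Finset.mem_erase]
        rcases hfs.2 with h2 | h2
        · rw [h2] at hf'; grind
        · rw [h2] at hf'; grind
      have hf'f : f' ≠ f := by rintro rfl; exact hfU' i1
      have hf'u : f' ∉ G.cut {u} := by
        intro h1
        apply i3
        rw [hg3 f' h1 i2, k3 f' h1 hf'f]
      have hf'U : f' ∈ G.cut U := by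
        rw [mem_cut] at i1 ⊢
        rw [mem_cut_singleton] at hf'u
        simp only [Finset.mem_erase] at i1
        grind
      have hwf : w f = 0 := by
        by_contra h1
        have h2 := i8 f h1
        have h3 := G.ne f hf'.1
        simp only [Finset.mem_erase] at h2
        rcases hfs.2 with h4 | h4
        · rw [h4] at hf' h2; grind
        · rw [h4] at hf' h2; grind
      refine ⟨f', Pi.single f 1 - w, hf'U, hf'f, Ne.symm i3, fun e => ?_, ?_, ?_, ?_, ?_, ?_⟩
      · by_cases e1 : e = f
        · subst e1; right; simp [hwf, hf1, hf2]
        · rcases i4 e with h1 | h1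
          · left; simp [e1, h1]
          · right; simp [e1, h1]
      · simp [hwf]
      · simp [hf'f, i6]
      · intro e he e1 e2
        have : w e = 0 := by
          by_contra h1
          have h2 := i8 e h1
          have h3 := mem_cut.1 he
          by_cases e3 : e = g
          · subst e3; exact hgU he
          · refine h1 (i7 e ?_ e3 e2)
            rw [mem_cut]
            simp only [Finset.mem_erase] at h2 ⊢
            grind
        simp [e1, this]
      · intro e he
        by_cases e1 : e = f
        · subst e1; have := hf'.2; grind
        · have h1 : w e ≠ 0 := by
            intro h1; exact he (by simp [e1, h1])
          have h2 := i8 e h1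
          simp only [Finset.mem_erase] at h2
          grind
      · intro u' hu'
        by_cases huu : u' = u
        · subst huu
          rw [map_sub, d_single, if_pos hfu]
          have : G.d {G.en U f} w = G.d {G.en U f} (Pi.single g 1) := by
            refine G.d_congr fun e he => ?_
            by_cases e3 : e = g
            · subst e3; rw [i5]; simp
            · rw [Pi.single_eq_of_ne e3]
              by_contra h1
              have h2 := i8 e h1
              have h3 := mem_cut_singleton.1 he
              have h4 := G.ne e h3.1
              have e4 : e ≠ f' := by rintro rfl; exact hf'u he
              refine h1 (i7 e ?_ e3 e4)
              rw [mem_cut]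
              simp only [Finset.mem_erase] at h2 ⊢
              rcases h3.2 with h5 | h5
              · rw [← hu] at h5
                rw [h5] at h2 ⊢; grind
              · rw [← hu] at h5
                rw [h5] at h2 ⊢; grind
          rw [this, d_single, if_pos hg, sub_self]
        · rw [map_sub, d_single, i9 u' (Finset.mem_erase.2 ⟨huu, hu'⟩), if_neg, sub_zero]
          rw [en_cut hf hu']
          exact huu

/-- outer parts of matchings, with set of exits `S` -/
structure Nv (G : MG α β) (X : Finset α) (N : β → ℚ) (S : Finset β) : Prop where
  bin : ∀ e, N e = 0 ∨ N e = 1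
  sup : ∀ e, N e ≠ 0 → e ∈ G.edges ∧ ¬ (G.s e ∈ X ∧ G.t e ∈ X)
  cov : ∀ u, u ∉ X → G.d {u} N = 1
  sub : S ⊆ G.cut X
  ex : ∀ e ∈ G.cut X, N e = if e ∈ S then 1 else 0

lemma Nv.exch {G : MG α β} {X : Finset α} {N1 N2 : β → ℚ} {S1 S2 : Finset β} (h1 : G.Nv X N1 S1)
    (h2 : G.Nv X N2 S2) {f : β} (hf1 : f ∈ S1) (hf2 : f ∉ S2) :
    ∃ (f' : β) (N1' N2' : β → ℚ), f' ≠ f ∧ ((f' ∈ S1 ∧ f' ∉ S2) ∨ (f' ∈ S2 ∧ f' ∉ S1)) ∧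
      N1 + N2 = N1' + N2' ∧ G.Nv X N1' (symmDiff S1 {f, f'}) ∧
      G.Nv X N2' (symmDiff S2 {f, f'}) := by
  have hfc : f ∈ G.cut X := h1.sub hf1
  obtain ⟨f', w, i1, i2, i3, i4, i5, i6, i7, i8, i9⟩ := G.exch_core _ Xᶜ rfl N1 N2 h1.bin h2.bin
    (fun u hu => h1.cov u (Finset.mem_compl.1 hu)) (fun u hu => h2.cov u (Finset.mem_compl.1 hu))
    f (by rwa [cut_compl]) (by rw [h1.ex f hfc, if_pos hf1]) (by rw [h2.ex f hfc, if_neg hf2])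
  rw [cut_compl] at i1 i7
  have hw : ∀ e, w e ≠ 0 → e ∈ G.edges ∧ ¬ (G.s e ∈ X ∧ G.t e ∈ X) := by
    intro e he
    have h3 := i8 e he
    simp only [Finset.mem_compl] at h3
    refine ⟨?_, by grind⟩
    rcases i4 e with h4 | h4
    · exact absurd h4 he
    · by_cases h5 : N1 e = 0
      · by_cases h6 : N2 e = 0
        · rw [h5, h6] at h4; exact absurd (by linarith) he
        · exact (h2.sup e h6).1
      · exact (h1.sup e h5).1
  have hsub : ∀ S ⊆ G.cut X, symmDiff S {f, f'} ⊆ G.cut X := by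
    intro S hS e he
    rw [Finset.mem_symmDiff] at he
    simp only [Finset.mem_insert, Finset.mem_singleton] at he
    rcases he with he | he
    · exact hS he.1
    · rcases he.1 with rfl | rfl
      · exact hfc
      · exact i1
  have hval : ∀ e ∈ G.cut X, w e = if e ∈ ({f, f'} : Finset β) then N1 e - N2 e else 0 := by
    intro e he
    simp only [Finset.mem_insert, Finset.mem_singleton]
    by_cases e1 : e = f
    · subst e1; simp [i5, h1.ex e hfc, h2.ex e hfc, hf1, hf2]
    · by_cases e2 : e = f'
      · subst e2; simp [i6]
      · simp [e1, e2, i7 e he e1 e2]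
  have hf'12 : (f' ∈ S1 ∧ f' ∉ S2) ∨ (f' ∈ S2 ∧ f' ∉ S1) := by
    rw [h1.ex f' i1, h2.ex f' i1] at i3
    by_cases a : f' ∈ S1 <;> by_cases b : f' ∈ S2 <;> simp [a, b] at i3 ⊢
  refine ⟨f', N1 - w, N2 + w, i2, hf'12, by abel, ⟨?_, ?_, ?_, hsub _ h1.sub, ?_⟩,
    ⟨?_, ?_, ?_, hsub _ h2.sub, ?_⟩⟩
  · intro e
    rcases i4 e with h3 | h3
    · simpa [h3] using h1.bin e
    · simpa [h3] using h2.bin e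
  · intro e he
    by_cases h3 : w e = 0
    · exact h1.sup e fun h4 => he (by simp [h3, h4])
    · exact hw e h3
  · intro u hu
    rw [map_sub, h1.cov u hu, i9 u (Finset.mem_compl.2 hu), sub_zero]
  · intro e he
    rw [Pi.sub_apply, hval e he, h1.ex e he, h2.ex e he]
    simp only [Finset.mem_symmDiff]
    by_cases a : e ∈ ({f, f'} : Finset β)
    · have hb : ¬ (e ∈ S1 ↔ e ∈ S2) := by
        simp only [Finset.mem_insert, Finset.mem_singleton] at a
        rcases a with rfl | rfl <;> grind
      by_cases c1 : e ∈ S1 <;> by_cases c2 : e ∈ S2 <;> simp [a, c1, c2] <;> grind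
    · simp [a]
  · intro e
    rcases i4 e with h3 | h3
    · simpa [h3] using h2.bin e
    · simpa [h3] using h1.bin e
  · intro e he
    by_cases h3 : w e = 0
    · exact h2.sup e fun h4 => he (by simp [h3, h4])
    · exact hw e h3
  · intro u hu
    rw [map_add, h2.cov u hu, i9 u (Finset.mem_compl.2 hu), add_zero]
  · intro e he
    rw [Pi.add_apply, hval e he, h1.ex e he, h2.ex e he]
    simp only [Finset.mem_symmDiff]
    by_cases a : e ∈ ({f, f'} : Finset β)
    · have hb : ¬ (e ∈ S1 ↔ e ∈ S2) := by
        simp only [Finset.mem_insert, Finset.mem_singleton] at a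
        rcases a with rfl | rfl <;> grind
      by_cases c1 : e ∈ S1 <;> by_cases c2 : e ∈ S2 <;> simp [a, c1, c2] <;> grind
    · simp [a]

lemma PM.nv {G : MG α β} {m : β → ℚ} (h : G.PM m) (X : Finset α) :
    G.Nv X (fun e => if G.s e ∈ X ∧ G.t e ∈ X then 0 else m e)
      ((G.cut X).filter fun e => m e = 1) := by
  refine ⟨fun e => ?_, fun e he => ?_, fun u hu => ?_, Finset.filter_subset _ _, fun e he => ?_⟩
  · split_ifs
    · exact Or.inl rfl
    · exact h.2 e
  · split_ifs at he with h1
    · exact absurd rfl he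
    · refine ⟨?_, h1⟩
      by_contra h2
      exact he (h.1.1 e h2)
  · rw [← h.1.2 u]
    refine G.d_congr fun e he => ?_
    rw [if_neg]
    rintro ⟨h1, h2⟩
    rcases (mem_cut_singleton.1 he).2 with h3 | h3
    · exact hu (h3 ▸ h1)
    · exact hu (h3 ▸ h2)
  · have h1 := (mem_cut.1 he).2
    rw [if_neg (by grind)]
    rcases h.2 e with h2 | h2
    · simp [h2]
    · simp [h2, he]

lemma Tt.nv {G : MG α β} {m : β → ℚ} {X : Finset α} (h : G.Tt X m) {e : β} (he : e ∈ G.cut X)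
    (hm : m e = 1) : G.Nv X (fun e => if G.s e ∈ X ∧ G.t e ∈ X then 0 else m e) {e} := by
  have h1 := h.1.nv X
  have : ((G.cut X).filter fun e => m e = 1) = {e} := by
    ext f
    rw [Finset.mem_filter, Finset.mem_singleton]
    constructor
    · rintro ⟨h2, h3⟩; exact h.unique h2 he h3 hm
    · rintro rfl; exact ⟨he, hm⟩
  rwa [this] at h1

end MG

end Main

end PML

namespace PML

set_option linter.unusedSectionVars false
set_option linter.unusedDecidableInType false
set_option linter.unusedFintypeInType false

universe u v

section Main

variable {α : Type u} [Fintype α] [DecidableEq α] [Nonempty α]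
  {β : Type v} [Fintype β] [DecidableEq β]

/-- alternating sums over exits -/
def sg (p : β → ℕ) (S : Finset β) (i : ℕ) : ℚ := ∑ e ∈ S, if p e ≤ i then (-1) ^ p e else 0

/-- the condition for extending to a perfect matching -/
def Val (p : β → ℕ) (n : ℕ) (S : Finset β) : Prop :=
  ∀ i < n, |2 * sg p S i - sg p S (n - 1)| ≤ 1

lemma sg_int (p : β → ℕ) (S : Finset β) (i : ℕ) : ∃ z : ℤ, sg p S i = z := by
  refine MG.sum_integral _ _ fun e _ => ?_
  split_ifs
  · exact ⟨(-1) ^ p e, by push_cast; rfl⟩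
  · exact ⟨0, by simp⟩

lemma sg_last (p : β → ℕ) (S : Finset β) {n : ℕ} (hp : ∀ e ∈ S, p e < n) :
    ∃ z : ℤ, sg p S (n - 1) = S.card - 2 * z := by
  have h1 : ∀ e ∈ S, ∃ z : ℤ, (1 - (-1 : ℚ) ^ p e) / 2 = z := by
    intro e _
    rcases neg_one_pow_eq_or ℚ (p e) with h | h
    · exact ⟨0, by rw [h]; norm_num⟩
    · exact ⟨1, by rw [h]; norm_num⟩
  obtain ⟨z, hz⟩ := MG.sum_integral S _ h1
  refine ⟨z, ?_⟩
  rw [← hz, Finset.mul_sum, Finset.cast_card, ← Finset.sum_sub_distrib]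
  refine Finset.sum_congr rfl fun e he => ?_
  rw [if_pos (by have := hp e he; omega)]
  ring

lemma val1 {p : β → ℕ} {n : ℕ} {a : β} (ha : p a < n) : Val p n {a} := by
  intro i hi
  unfold sg
  simp only [Finset.sum_singleton]
  rw [if_pos (show p a ≤ n - 1 by omega)]
  rcases neg_one_pow_eq_or ℚ (p a) with h | h <;> rw [h] <;> split_ifs <;> norm_num

lemma neg_one_flip {a b : ℕ} (h : Odd (a + b)) : (-1 : ℚ) ^ b = - (-1) ^ a := by
  have h1 : (-1 : ℚ) ^ (a + b) = -1 := h.neg_one_pow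
  rw [pow_add] at h1
  rcases neg_one_pow_eq_or ℚ a with h | h <;> rw [h] at h1 ⊢ <;> linarith

lemma val3 {p : β → ℕ} {n : ℕ} {a b c : β} (h1 : p a < p b) (h2 : p b < p c) (h3 : p c < n)
    (o1 : Odd (p a + p b)) (o2 : Odd (p b + p c)) : Val p n {a, b, c} := by
  have ab : a ≠ b := by rintro rfl; omega
  have ac : a ≠ c := by rintro rfl; omega
  have bc : b ≠ c := by rintro rfl; omega
  intro i hi
  unfold sg
  rw [Finset.sum_insert (by simp [ab, ac]), Finset.sum_insert (by simp [bc]),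
    Finset.sum_singleton, Finset.sum_insert (by simp [ab, ac]), Finset.sum_insert (by simp [bc]),
    Finset.sum_singleton, neg_one_flip o2, neg_one_flip o1]
  rw [if_pos (show p a ≤ n - 1 by omega), if_pos (show p b ≤ n - 1 by omega),
    if_pos (show p c ≤ n - 1 by omega)]
  rcases neg_one_pow_eq_or ℚ (p a) with h | h <;> rw [h] <;>
    split_ifs <;> first | (exfalso; omega) | norm_num

lemma val5 {p : β → ℕ} {n : ℕ} {a b c d e : β} (h1 : p a < p b) (h2 : p b < p c) (h3 : p c < p d)
    (h4 : p d < p e) (h5 : p e < n) (o1 : Odd (p a + p b)) (o2 : Odd (p b + p c))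
    (o3 : Odd (p c + p d)) (o4 : Odd (p d + p e)) : Val p n {a, b, c, d, e} := by
  have hne : ∀ x y, p x < p y → x ≠ y := by rintro x y h rfl; omega
  have ab := hne a b (by omega)
  have ac := hne a c (by omega)
  have ad := hne a d (by omega)
  have ae := hne a e (by omega)
  have bc := hne b c (by omega)
  have bd := hne b d (by omega)
  have be := hne b e (by omega)
  have cd := hne c d (by omega)
  have ce := hne c e (by omega)
  have de := hne d e (by omega)
  intro i hi
  have key : ∀ j, sg p {a, b, c, d, e} j = (if p a ≤ j then (-1) ^ p a else 0) +
      ((if p b ≤ j then (-1) ^ p b else 0) + ((if p c ≤ j then (-1) ^ p c else 0) +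
      ((if p d ≤ j then (-1) ^ p d else 0) + (if p e ≤ j then (-1) ^ p e else 0)))) := by
    intro j
    unfold sg
    rw [Finset.sum_insert (by simp [ab, ac, ad, ae]), Finset.sum_insert (by simp [bc, bd, be]),
      Finset.sum_insert (by simp [cd, ce]), Finset.sum_insert (by simp [de]), Finset.sum_singleton]
  rw [key, key, neg_one_flip o4, neg_one_flip o3, neg_one_flip o2, neg_one_flip o1]
  rw [if_pos (show p a ≤ n - 1 by omega), if_pos (show p b ≤ n - 1 by omega),
    if_pos (show p c ≤ n - 1 by omega), if_pos (show p d ≤ n - 1 by omega),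
    if_pos (show p e ≤ n - 1 by omega)]
  rcases neg_one_pow_eq_or ℚ (p a) with h | h <;> rw [h] <;>
    split_ifs <;> first | (exfalso; omega) | norm_num

namespace MG

/-- positions of exits -/
def Ps (G : MG α β) (X : Finset α) (n : ℕ) (c : ℕ → α) (p : β → ℕ) : Prop :=
  ∀ e ∈ G.cut X, p e < n ∧ c (p e) = G.en X e

lemma Cyc.exists_ps {G : MG α β} {X : Finset α} {n : ℕ} {c : ℕ → α} {ε : ℕ → β}
    (h : G.Cyc X n c ε) : ∃ p, G.Ps X n c p := by
  have : ∀ e, ∃ i, e ∈ G.cut X → i < n ∧ c i = G.en X e := by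
    intro e
    by_cases he : e ∈ G.cut X
    · obtain ⟨i, hi, h1⟩ := h.surj _ (en_mem he)
      exact ⟨i, fun _ => ⟨hi, h1⟩⟩
    · exact ⟨0, fun h => absurd h he⟩
  choose p hp using this
  exact ⟨p, hp⟩

/-- alternating sums -/
def Fi (G : MG α β) (X : Finset α) (p : β → ℕ) (N : β → ℚ) (i : ℕ) : ℚ :=
  ∑ e ∈ G.cut X, N e * if p e ≤ i then (-1) ^ p e else 0

lemma Nv.Fi {G : MG α β} {X : Finset α} {N : β → ℚ} {S : Finset β} (h : G.Nv X N S) (p : β → ℕ)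
    (i : ℕ) : G.Fi X p N i = sg p S i := by
  unfold MG.Fi sg
  rw [← Finset.inter_eq_right.2 h.sub, ← Finset.sum_ite_mem]
  refine Finset.sum_congr rfl fun e he => ?_
  rw [h.ex e he]
  simp only [ite_mul, one_mul, zero_mul]

lemma Nv.d_pos {G : MG α β} {X : Finset α} {N : β → ℚ} {S : Finset β} (h : G.Nv X N S) {n : ℕ}
    {c : ℕ → α} {ε : ℕ → β} (hc : G.Cyc X n c ε) {p : β → ℕ} (hp : G.Ps X n c p) {j : ℕ}
    (hj : j < n) : G.d {c j} N = ∑ e ∈ G.cut X, if p e = j then N e else 0 := by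
  have hcj := hc.cy.c_mem hj
  rw [← Finset.sum_filter, d_apply]
  symm
  refine Finset.sum_subset ?_ ?_
  · intro e he
    obtain ⟨h1, h2⟩ := Finset.mem_filter.1 he
    rw [en_cut h1 hcj, ← (hp e h1).2, h2]
  · intro e he he'
    by_contra h0
    have h1 := (h.sup e h0).2
    have h2 := mem_cut_singleton.1 he
    have h3 : e ∈ G.cut X := by
      rw [mem_cut]
      refine ⟨h2.1, ?_⟩
      rcases h2.2 with h4 | h4 <;> rw [h4] at h1 ⊢ <;> grind
    refine he' (Finset.mem_filter.2 ⟨h3, ?_⟩)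
    rw [en_cut h3 hcj, ← (hp e h3).2] at he
    exact (hc.cy.inj _ hj _ (hp e h3).1 he).symm

lemma Fi_zero {G : MG α β} {X : Finset α} {N : β → ℚ} {p : β → ℕ} : G.Fi X p N 0 =
    ∑ e ∈ G.cut X, if p e = 0 then N e else 0 := by
  refine Finset.sum_congr rfl fun e _ => ?_
  by_cases h : p e = 0 <;> simp [h]

lemma Fi_succ {G : MG α β} {X : Finset α} {N : β → ℚ} {p : β → ℕ} (k : ℕ) : G.Fi X p N (k + 1) =
    G.Fi X p N k - (-1) ^ k * ∑ e ∈ G.cut X, if p e = k + 1 then N e else 0 := by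
  unfold Fi
  rw [Finset.mul_sum, ← Finset.sum_sub_distrib]
  refine Finset.sum_congr rfl fun e _ => ?_
  by_cases h1 : p e = k + 1
  · rw [if_pos (by omega), if_neg (by omega), if_pos h1, h1, pow_succ]; ring
  · by_cases h2 : p e ≤ k
    · rw [if_pos (by omega), if_pos h2, if_neg h1]; ring
    · rw [if_neg (by omega), if_neg h2, if_neg h1]; ring

/-- coefficients on the cycle -/
def co (G : MG α β) (X : Finset α) (n : ℕ) (p : β → ℕ) (N : β → ℚ) (i : ℕ) : ℚ :=
  (1 - (-1) ^ i * (2 * G.Fi X p N i - G.Fi X p N (n - 1))) / 2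

/-- the unique extension -/
noncomputable def Ev (G : MG α β) (X : Finset α) (n : ℕ) (ε : ℕ → β) (p : β → ℕ) (N : β → ℚ) :
    β → ℚ := N + Cy.vec n ε (G.co X n p N)

section

variable {G : MG α β} {X : Finset α} {n : ℕ} {c : ℕ → α} {ε : ℕ → β} {p : β → ℕ}

lemma Ev_add {N1 N2 N3 N4 : β → ℚ} (h : N1 + N2 = N3 + N4) :
    G.Ev X n ε p N1 + G.Ev X n ε p N2 = G.Ev X n ε p N3 + G.Ev X n ε p N4 := by
  have hF : ∀ i, G.Fi X p N1 i + G.Fi X p N2 i = G.Fi X p N3 i + G.Fi X p N4 i := by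
    intro i
    unfold Fi
    rw [← Finset.sum_add_distrib, ← Finset.sum_add_distrib]
    refine Finset.sum_congr rfl fun e _ => ?_
    have := congrFun h e
    simp only [Pi.add_apply] at this
    rw [← add_mul, ← add_mul, this]
  have hco : ∀ i, G.co X n p N1 i + G.co X n p N2 i = G.co X n p N3 i + G.co X n p N4 i := by
    intro i
    unfold co
    have e1 : G.Fi X p N1 i = G.Fi X p N3 i + G.Fi X p N4 i - G.Fi X p N2 i := by
      rw [← hF]; ring
    have e2 : G.Fi X p N1 (n - 1) = G.Fi X p N3 (n - 1) + G.Fi X p N4 (n - 1)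
      - G.Fi X p N2 (n - 1) := by rw [← hF]; ring
    rw [e1, e2]; ring
  have hv : ∀ f g : ℕ → ℚ, Cy.vec n ε f + Cy.vec n ε g = Cy.vec n ε (f + g) := by
    intro f g
    unfold Cy.vec
    rw [← Finset.sum_add_distrib]
    refine Finset.sum_congr rfl fun i _ => ?_
    rw [Pi.add_apply, add_smul]
  unfold Ev
  rw [add_add_add_comm, h, hv, add_add_add_comm N3, hv]
  congr 2
  funext i
  exact hco i

lemma Nv.reg {N : β → ℚ} {S : Finset β} (h : G.Nv X N S) (hc : G.Cyc X n c ε)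
    (hp : G.Ps X n c p) : G.Reg 1 (G.Ev X n ε p N) := by
  have h3 := hc.cy.three
  refine ⟨fun e he => ?_, fun w => ?_⟩
  · unfold Ev
    rw [Pi.add_apply, Cy.vec_off, add_zero]
    · by_contra h0; exact he (h.sup e h0).1
    · rintro i hi rfl; exact he (mem_EX.1 (hc.cy.mem i hi)).1
  · unfold Ev
    rw [map_add]
    by_cases hw : w ∈ X
    · obtain ⟨i, hi, rfl⟩ := hc.surj w hw
      rw [h.d_pos hc hp hi]
      rcases i with _ | k
      · rw [hc.cy.d_vec_zero, ← Fi_zero]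
        unfold co
        have : Even (n - 1) := by
          have := hc.odd
          rw [Nat.odd_iff] at this
          rw [Nat.even_iff]; omega
        rw [this.neg_one_pow]
        ring
      · rw [hc.cy.d_vec_succ _ hi]
        unfold co
        rw [Fi_succ, pow_succ]
        rcases neg_one_pow_eq_or ℚ k with h | h <;> rw [h] <;> ring
    · rw [h.cov w hw, hc.cy.d_vec_off, add_zero]
      rintro i hi rfl
      exact hw (hc.cy.c_mem hi)

lemma Nv.cases (hc : G.Cyc X n c ε) (N : β → ℚ) (e : β) :
    G.Ev X n ε p N e = N e ∨ ∃ i < n, e = ε i ∧ G.Ev X n ε p N e = N e + G.co X n p N i := by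
  by_cases h1 : ∃ i < n, e = ε i
  · obtain ⟨i, hi, rfl⟩ := h1
    right
    refine ⟨i, hi, rfl, ?_⟩
    unfold Ev
    rw [Pi.add_apply, hc.cy.vec_ε _ hi]
  · push Not at h1
    left
    unfold Ev
    rw [Pi.add_apply, Cy.vec_off _ _ _ h1, add_zero]

lemma Nv.integral {N : β → ℚ} {S : Finset β} (h : G.Nv X N S) (hc : G.Cyc X n c ε)
    (hp : G.Ps X n c p) (hS : Odd S.card) : Integral (G.Ev X n ε p N) := by
  intro e
  have hN : ∃ z : ℤ, N e = z := by
    rcases h.bin e with h | h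
    · exact ⟨0, by simp [h]⟩
    · exact ⟨1, by simp [h]⟩
  rcases Nv.cases (p := p) hc N e with h1 | ⟨i, hi, rfl, h1⟩
  · rw [h1]; exact hN
  · rw [h1]
    obtain ⟨z, hz⟩ := hN
    obtain ⟨a, ha⟩ := sg_int p S i
    obtain ⟨b, hb⟩ := sg_last p S (n := n) fun e he => (hp e (h.sub he)).1
    obtain ⟨k, hk⟩ := hS
    rw [hk] at hb
    unfold co
    rw [h.Fi, h.Fi, ha, hb, hz]
    rcases neg_one_pow_eq_or ℚ i with h | h <;> rw [h]
    · exact ⟨z + (1 - a + k - b), by push_cast; ring⟩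
    · exact ⟨z + (a - k + b), by push_cast; ring⟩

lemma Nv.pm {N : β → ℚ} {S : Finset β} (h : G.Nv X N S) (hc : G.Cyc X n c ε)
    (hp : G.Ps X n c p) (hS : Odd S.card) (hv : Val p n S) : G.PM (G.Ev X n ε p N) := by
  refine PM.of_nonneg (h.reg hc hp) (h.integral hc hp hS) fun e => ?_
  have hN : 0 ≤ N e := by
    rcases h.bin e with h | h <;> rw [h]; norm_num
  rcases Nv.cases (p := p) hc N e with h1 | ⟨i, hi, rfl, h1⟩
  · rw [h1]; exact hN
  · rw [h1]
    have h2 := hv i hi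
    rw [← h.Fi, ← h.Fi, abs_le] at h2
    refine add_nonneg hN ?_
    unfold co
    rcases neg_one_pow_eq_or ℚ i with h | h <;> rw [h] <;> linarith

lemma Nv.d_card {N : β → ℚ} {S : Finset β} (h : G.Nv X N S) (hc : G.Cyc X n c ε) :
    G.d X (G.Ev X n ε p N) = S.card := by
  rw [d_apply, Finset.cast_card, ← Finset.inter_eq_right.2 h.sub, ← Finset.sum_ite_mem]
  refine Finset.sum_congr rfl fun e he => ?_
  rw [← h.ex e he]
  rcases Nv.cases (p := p) hc N e with h1 | ⟨i, hi, rfl, h1⟩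
  · exact h1
  · have h2 := (mem_EX.1 (hc.cy.mem i hi)).2
    have h3 := (mem_cut.1 he).2
    grind

lemma Nv.win3 (hX : G.Fc X) (hc : G.Cyc X n c ε) (hp : G.Ps X n c p) {N : β → ℚ} {a b d : β}
    {S : Finset β} (h : G.Nv X N S) (hS : S = {a, b, d}) (h1 : p a < p b) (h2 : p b < p d)
    (o1 : Odd (p a + p b)) (o2 : Odd (p b + p d)) : G.Win := by
  subst hS
  have h3 : ({a, b, d} : Finset β).card = 3 := by
    rw [Finset.card_eq_three]
    refine ⟨a, b, d, ?_, ?_, ?_, rfl⟩ <;> rintro rfl <;> omega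
  refine Win.of_pm hX (h.pm hc hp (by rw [h3]; decide)
    (val3 h1 h2 (hp d (h.sub (by simp))).1 o1 o2)) ?_
  rw [h.d_card hc, h3]; norm_num

/-- consecutive exits are at odd distance -/
lemma gap {M : β → ℚ} (hM : G.PM M) (hc : G.Cyc X n c ε) (hp : G.Ps X n c p) {a b : ℕ}
    (hab : a < b) (hb : b ≤ n) {ea eb : β} (ea1 : ea ∈ G.cut X) (ea2 : M ea = 1)
    (ea3 : ea ∈ G.cut {c a}) (eb1 : eb ∈ G.cut X) (eb2 : M eb = 1) (eb3 : eb ∈ G.cut {c b})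
    (hno : ∀ e ∈ G.cut X, M e = 1 → ¬ (a < p e ∧ p e < b)) : Odd (b - a) := by
  set I := (Finset.Ioo a b).image c with hI
  have hinj : Set.InjOn c (Finset.Ioo a b) := by
    intro i hi j hj hij
    simp only [Finset.coe_Ioo, Set.mem_Ioo] at hi hj
    exact hc.cy.inj i (by omega) j (by omega) hij
  have hcard : I.card = b - a - 1 := by
    rw [hI, Finset.card_image_of_injOn hinj, Nat.card_Ioo]
  have hmem : ∀ w, w ∈ I ↔ ∃ j, a < j ∧ j < b ∧ c j = w := by
    intro w; simp only [hI, Finset.mem_image, Finset.mem_Ioo, and_assoc]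
  have huniq : ∀ w e e', e ∈ G.cut {w} → e' ∈ G.cut {w} → M e = 1 → M e' = 1 → e = e' := by
    intro w e e' h1 h2 h3 h4
    obtain ⟨f, -, -, hf⟩ := hM.exists_unique_cut (hM.1.2 w)
    have k1 : e = f := by by_contra hne; rw [hf e h1 hne] at h3; norm_num at h3
    have k2 : e' = f := by by_contra hne; rw [hf e' h2 hne] at h4; norm_num at h4
    rw [k1, k2]
  have hd : G.d I M = 0 := by
    rw [d_apply]
    refine Finset.sum_eq_zero fun e he => (hM.2 e).resolve_right fun he1 => ?_
    by_cases heX : e ∈ G.cut X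
    · have : ∃ j, a < j ∧ j < b ∧ e ∈ G.cut {c j} := by
        have h1 := mem_cut.1 he
        by_cases h2 : G.s e ∈ I
        · obtain ⟨j, j1, j2, j3⟩ := (hmem _).1 h2
          exact ⟨j, j1, j2, mem_cut_singleton.2 ⟨h1.1, Or.inl j3.symm⟩⟩
        · have h3 : G.t e ∈ I := by grind
          obtain ⟨j, j1, j2, j3⟩ := (hmem _).1 h3
          exact ⟨j, j1, j2, mem_cut_singleton.2 ⟨h1.1, Or.inr j3.symm⟩⟩
      obtain ⟨j, j1, j2, j3⟩ := this
      rw [en_cut heX (hc.cy.c_mem (by omega)), ← (hp e heX).2] at j3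
      have := hc.cy.inj j (by omega) _ (hp e heX).1 j3
      exact hno e heX he1 ⟨by omega, by omega⟩
    · have hIX : ∀ w ∈ I, w ∈ X := by
        intro w hw
        obtain ⟨j, j1, j2, rfl⟩ := (hmem _).1 hw
        exact hc.cy.c_mem (by omega)
      have h1 := mem_cut.1 he
      have heEX : e ∈ G.EX X := by
        rw [mem_EX]
        rw [mem_cut] at heX
        have := hIX (G.s e)
        have := hIX (G.t e)
        grind
      obtain ⟨k, hk, rfl⟩ := hc.esurj e heEX
      have h2 : ¬ (c k ∈ I ↔ c (k + 1) ∈ I) := by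
        rcases hc.cy.ends k hk with ⟨k1, k2⟩ | ⟨k1, k2⟩
        · rw [k1, k2] at h1; exact h1.2
        · rw [k1, k2] at h1; exact fun h => h1.2 h.symm
      by_cases h3 : c k ∈ I
      · have h4 : c (k + 1) ∉ I := fun h => h2 ⟨fun _ => h, fun _ => h3⟩
        obtain ⟨j, j1, j2, j3⟩ := (hmem _).1 h3
        have := hc.cy.inj j (by omega) k hk j3
        subst this
        have h5 : j + 1 = b := by
          by_contra h5
          exact h4 ((hmem _).2 ⟨j + 1, by omega, by omega, rfl⟩)
        have h6 : ε j ∈ G.cut {c b} := (hc.cy.mem_cut hk _).2 (Or.inr (by rw [h5]))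
        exact heX (huniq _ _ _ h6 eb3 he1 eb2 ▸ eb1)
      · have h4 : c (k + 1) ∈ I := by grind
        obtain ⟨j, j1, j2, j3⟩ := (hmem _).1 h4
        have h5 : j = k + 1 := by
          rcases hc.cy.inj_succ hk (show j < n by omega) j3.symm with h | h
          · exact h
          · omega
        have h6 : k = a := by
          by_contra h6
          exact h3 ((hmem _).2 ⟨k, by omega, by omega, rfl⟩)
        have h7 : ε k ∈ G.cut {c a} := (hc.cy.mem_cut hk _).2 (Or.inl (by rw [h6]))
        exact heX (huniq _ _ _ h7 ea3 he1 ea2 ▸ ea1)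
  obtain ⟨z, hz⟩ := G.parity hM.integral I fun w _ => hM.1.2 w
  rw [hd, hcard] at hz
  have hz' : ((b - a - 1 : ℕ) : ℤ) = 2 * z := by
    have : ((b - a - 1 : ℕ) : ℚ) = 2 * z := by linarith
    exact_mod_cast this
  rw [Nat.odd_iff]
  omega

end

end MG

end Main

end PML

namespace PML

set_option linter.unusedSectionVars false
set_option linter.unusedDecidableInType false
set_option linter.unusedFintypeInType false

universe u v

section Main

variable {α : Type u} [Fintype α] [DecidableEq α] [Nonempty α]
  {β : Type v} [Fintype β] [DecidableEq β]

namespace MG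

section

variable {G : MG α β} {X : Finset α} {n : ℕ} {c : ℕ → α} {ε : ℕ → β} {p : β → ℕ}

lemma Nv.mem {N : β → ℚ} {S : Finset β} (h : G.Nv X N S) (hc : G.Cyc X n c ε)
    (hp : G.Ps X n c p) (hS : Odd S.card) (hv : Val p n S) :
    G.Ev X n ε p N ∈ AddSubgroup.closure (G.pms : Set (β → ℚ)) :=
  AddSubgroup.subset_closure (mem_pms.2 (h.pm hc hp hS hv))

lemma Nv.mem1 {N : β → ℚ} {a : β} (h : G.Nv X N {a}) (hc : G.Cyc X n c ε)
    (hp : G.Ps X n c p) :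
    G.Ev X n ε p N ∈ AddSubgroup.closure (G.pms : Set (β → ℚ)) :=
  h.mem hc hp (by simp) (val1 (hp a (h.sub (by simp))).1)

lemma sd1 {a b : β} (h : b ≠ a) : symmDiff ({a} : Finset β) {a, b} = {b} := by
  ext x; simp only [Finset.mem_symmDiff, Finset.mem_insert, Finset.mem_singleton]; grind

lemma sd3 {a b d f : β} (h1 : a ≠ b) (h2 : a ≠ d) (h3 : a ≠ f) :
    symmDiff ({a, b, d} : Finset β) {f, a} = {b, d, f} ∨ f = b ∨ f = d := by
  by_cases h4 : f = b
  · exact Or.inr (Or.inl h4)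
  by_cases h5 : f = d
  · exact Or.inr (Or.inr h5)
  left
  ext x; simp only [Finset.mem_symmDiff, Finset.mem_insert, Finset.mem_singleton]; grind

lemma sd3' {a b d f : β} (h1 : a ≠ b) (h2 : a ≠ d) (h3 : a ≠ f) (h4 : f ≠ b) (h5 : f ≠ d) :
    symmDiff ({a, b, d} : Finset β) {f, a} = {b, d, f} :=
  (sd3 h1 h2 h3).resolve_right (by grind)

lemma rot (a b d : β) : ({a, b, d} : Finset β) = {b, d, a} := by
  ext x; simp only [Finset.mem_insert, Finset.mem_singleton]; grind

lemma swp (a b d : β) : ({a, b, d} : Finset β) = {a, d, b} := by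
  ext x; simp only [Finset.mem_insert, Finset.mem_singleton]; grind

/-- the exchange game -/
lemma game (hX : G.Fc X) (hc : G.Cyc X n c ε) (hp : G.Ps X n c p) {e0 e1 e2 e3 e4 : β}
    (l1 : p e0 < p e1) (l2 : p e1 < p e2) (l3 : p e2 < p e3) (l4 : p e3 < p e4)
    (o1 : Odd (p e0 + p e1)) (o2 : Odd (p e1 + p e2)) (o3 : Odd (p e2 + p e3))
    (o4 : Odd (p e3 + p e4)) {T2 T4 N0 : β → ℚ} (hT2 : G.Nv X T2 {e2}) (hT4 : G.Nv X T4 {e4})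
    (hN0 : G.Nv X N0 {e0, e1, e3}) : G.Win := by
  have hne : ∀ x y, p x < p y → x ≠ y := by rintro x y h rfl; omega
  have e01 := hne e0 e1 (by omega)
  have e02 := hne e0 e2 (by omega)
  have e03 := hne e0 e3 (by omega)
  have e04 := hne e0 e4 (by omega)
  have e12 := hne e1 e2 (by omega)
  have e13 := hne e1 e3 (by omega)
  have e14 := hne e1 e4 (by omega)
  have e23 := hne e2 e3 (by omega)
  have e24 := hne e2 e4 (by omega)
  have e34 := hne e3 e4 (by omega)
  have o14 : Odd (p e1 + p e4) := by grind
  have o03 : Odd (p e0 + p e3) := by grind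
  -- step B
  obtain ⟨f, A1, N3, hf, hf', hs, hA1, hN3⟩ := hT2.exch hN0 (f := e2) (by simp)
    (by simp [e02.symm, e12.symm, e23])
  rw [sd1 hf] at hA1
  have hfm : e0 = f ∨ e1 = f ∨ e3 = f := by
    simp only [Finset.mem_insert, Finset.mem_singleton] at hf'
    grind
  rcases hfm with rfl | rfl | rfl
  · rw [sd3' e01 e03 e02 e12.symm e23] at hN3
    exact hN3.win3 hX hc hp (swp _ _ _) l2 l3 o2 o3
  rotate_left
  · rw [rot, rot, sd3' e03.symm e13.symm e23.symm e02.symm e12.symm] at hN3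
    exact hN3.win3 hX hc hp rfl l1 l2 o1 o2
  rw [rot, sd3' e13 e01.symm e12 e23 e02.symm, rot] at hN3
  -- step C
  obtain ⟨g, A2, N5, hg, hg', hs2, hA2, hN5⟩ := hT4.exch hN3 (f := e4) (by simp)
    (by simp [e04.symm, e24.symm, e34.symm])
  rw [sd1 hg] at hA2
  have hgm : e0 = g ∨ e2 = g ∨ e3 = g := by
    simp only [Finset.mem_insert, Finset.mem_singleton] at hg'
    grind
  rcases hgm with rfl | rfl | rfl
  · rw [sd3' e02 e03 e04 e24.symm e34.symm] at hN5
    exact hN5.win3 hX hc hp rfl l3 l4 o3 o4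
  · rw [rot, sd3' e23 e02.symm e24 e34.symm e04.symm, rot] at hN5
    exact hN5.win3 hX hc hp (swp _ _ _) (by omega) l4 o03 o4
  rw [rot, rot, sd3' e03.symm e23.symm e34 e04.symm e24.symm] at hN5
  -- step D
  have c3 : ({e0, e1, e3} : Finset β).card = 3 := by
    rw [Finset.card_eq_three]
    exact ⟨e0, e1, e3, e01, e03, e13, rfl⟩
  obtain ⟨k, A3, A4, hk, hk', hs3, hA3, hA4⟩ := hN0.exch hN5 (f := e1) (by simp)
    (by simp [e01.symm, e12, e14])
  have hkm : e2 = k ∨ e3 = k ∨ e4 = k := by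
    simp only [Finset.mem_insert, Finset.mem_singleton] at hk'
    grind
  rcases hkm with rfl | rfl | rfl
  · rw [rot, sd3' e24 e02.symm e12.symm e14 e01.symm, rot] at hA4
    exact hA4.win3 hX hc hp rfl l1 (by omega) o1 o14
  · have q1 : symmDiff ({e0, e1, e3} : Finset β) {e1, e3} = {e0} := by
      ext x; simp only [Finset.mem_symmDiff, Finset.mem_insert, Finset.mem_singleton]; grind
    have q2 : symmDiff ({e0, e2, e4} : Finset β) {e1, e3} = {e0, e1, e2, e3, e4} := by
      ext x; simp only [Finset.mem_symmDiff, Finset.mem_insert, Finset.mem_singleton]; grind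
    have c5 : ({e0, e1, e2, e3, e4} : Finset β).card = 5 := by
      rw [Finset.card_insert_of_notMem (by simp [e01, e02, e03, e04]),
        Finset.card_insert_of_notMem (by simp [e12, e13, e14]),
        Finset.card_insert_of_notMem (by simp [e23, e24]),
        Finset.card_insert_of_notMem (by simp [e34]), Finset.card_singleton]
    rw [q1] at hA3
    rw [q2] at hA4
    have m1 := hT2.mem1 hc hp
    have m2 := hT4.mem1 hc hp
    have m3 := hA1.mem1 hc hp
    have m4 := hA2.mem1 hc hp
    have m5 := hA3.mem1 hc hp
    have m6 := hA4.mem hc hp (by rw [c5]; decide)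
      (val5 l1 l2 l3 l4 (hp e4 (hT4.sub (by simp))).1 o1 o2 o3 o4)
    have s1 := Ev_add (G := G) (X := X) (n := n) (ε := ε) (p := p) hs
    have s2 := Ev_add (G := G) (X := X) (n := n) (ε := ε) (p := p) hs2
    have s3 := Ev_add (G := G) (X := X) (n := n) (ε := ε) (p := p) hs3
    refine ⟨X, hX, G.Ev X n ε p N0, hN0.reg hc hp, hN0.integral hc hp (by rw [c3]; decide),
      by rw [hN0.d_card hc, c3]; norm_num, ?_⟩
    have : (2 : ℚ) • G.Ev X n ε p N0 = G.Ev X n ε p A3 + G.Ev X n ε p A4 +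
        (G.Ev X n ε p A1 - G.Ev X n ε p T2) + (G.Ev X n ε p A2 - G.Ev X n ε p T4) := by
      rw [← s3, two_smul, sub_eq_sub_iff_add_eq_add.2 (s1.symm.trans (add_comm _ _) |>.trans
        (by rfl) : G.Ev X n ε p A1 + G.Ev X n ε p N3 = G.Ev X n ε p N0 + G.Ev X n ε p T2),
        sub_eq_sub_iff_add_eq_add.2 (s2.symm.trans (add_comm _ _) :
          G.Ev X n ε p A2 + G.Ev X n ε p N5 = G.Ev X n ε p N3 + G.Ev X n ε p T4)]
      abel
    rw [this]
    exact add_mem (add_mem (add_mem m5 m6) (sub_mem m3 m1)) (sub_mem m4 m2)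
  · rw [rot, rot, sd3' e04.symm e24.symm e14.symm e01.symm e12, swp] at hA4
    exact hA4.win3 hX hc hp rfl l1 l2 o1 o2

end

lemma min_above (p : β → ℕ) (S : Finset β) (k : ℕ) (h : ∃ e ∈ S, k < p e) :
    ∃ e ∈ S, k < p e ∧ ∀ e' ∈ S, k < p e' → p e ≤ p e' := by
  obtain ⟨e, he, hk⟩ := h
  obtain ⟨f, hf, hmin⟩ := Finset.exists_min_image (S.filter fun e => k < p e) p
    ⟨e, Finset.mem_filter.2 ⟨he, hk⟩⟩
  have := Finset.mem_filter.1 hf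
  exact ⟨f, this.1, this.2, fun e' h1 h2 => hmin e' (Finset.mem_filter.2 ⟨h1, h2⟩)⟩

lemma Hd.win_cyc {G : MG α β} {X : Finset α} (h : G.Hd X) (hfr : G.Fr X) (h5 : 5 ≤ X.card) :
    G.Win := by
  obtain ⟨M, hM, hM1⟩ := h.fX.proper
  have hMn := hM.nv X
  set S := (G.cut X).filter fun e => M e = 1 with hS
  have hdS : G.d X M = S.card := by
    rw [d_apply, Finset.cast_card, hS, Finset.sum_filter]
    refine Finset.sum_congr rfl fun e _ => ?_
    rcases hM.2 e with h1 | h1 <;> simp [h1]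
  have hS0 : S.Nonempty := by
    rw [← Finset.card_pos]
    have := hM.one_le_d h.fX.1
    rw [hdS] at this
    exact_mod_cast this
  have hmS : ∀ {e}, e ∈ S → e ∈ G.cut X ∧ M e = 1 := fun he => Finset.mem_filter.1 he
  obtain ⟨e0, he0⟩ := hS0
  obtain ⟨n, c, ε, hc, hc0⟩ := h.exists_cyc hfr h5 (en_mem (hmS he0).1)
  obtain ⟨p, hp⟩ := hc.exists_ps
  have h3 := hc.cy.three
  have hcut : ∀ {e}, e ∈ S → e ∈ G.cut {c (p e)} := by
    intro e he
    have h1 := hp e (hmS he).1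
    rw [en_cut (hmS he).1 (hc.cy.c_mem h1.1)]
    exact h1.2
  have hp0 : p e0 = 0 := by
    have h1 := hp e0 (hmS he0).1
    rw [← hc0] at h1
    exact hc.cy.inj _ h1.1 0 (by omega) h1.2
  have hpinj : ∀ e ∈ S, ∀ e' ∈ S, p e = p e' → e = e' := by
    intro e he e' he' hpe
    obtain ⟨f, -, -, hf⟩ := hM.exists_unique_cut (hM.1.2 (c (p e)))
    have k1 : e = f := by
      by_contra hne
      have := hf e (hcut he) hne
      rw [(hmS he).2] at this; norm_num at this
    have k2 : e' = f := by
      by_contra hne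
      have := hf e' (by rw [hpe]; exact hcut he') hne
      rw [(hmS he').2] at this; norm_num at this
    rw [k1, k2]
  have hpos : ∀ e ∈ S, e ≠ e0 → 0 < p e := by
    intro e he hne
    by_contra h0
    exact hne (hpinj e he e0 he0 (by omega))
  have hgap : ∀ a ∈ S, ∀ b ∈ S, p a < p b → (∀ e' ∈ S, p a < p e' → p b ≤ p e') →
      Odd (p a + p b) := by
    intro a ha b hb hlt hmin
    have := gap hM hc hp hlt (hp b (hmS hb).1).1.le (hmS ha).1 (hmS ha).2 (hcut ha) (hmS hb).1
      (hmS hb).2 (hcut hb) fun e he hMe hbet => by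
        have := hmin e (Finset.mem_filter.2 ⟨he, hMe⟩) hbet.1
        omega
    rw [Nat.odd_iff] at this ⊢
    omega
  have hT : ∀ e ∈ S, ∃ N, G.Nv X N {e} := by
    intro e he
    obtain ⟨m, hm, hme⟩ := h.fcov h.fX (cut_edges (hmS he).1)
    exact ⟨_, hm.nv (hmS he).1 hme⟩
  -- the first exit
  have hex : ∃ e ∈ S, e ≠ e0 := by
    by_contra hcon
    push Not at hcon
    have : S = {e0} := by
      ext e; rw [Finset.mem_singleton]
      exact ⟨hcon e, fun h => h ▸ he0⟩
    rw [this] at hdS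
    simp at hdS
    exact hM1 hdS
  obtain ⟨e1, he1, hl1, hmin1⟩ := min_above p S (p e0) (by
    obtain ⟨e, he, hne⟩ := hex
    exact ⟨e, he, by rw [hp0]; exact hpos e he hne⟩)
  have o1 := hgap e0 he0 e1 he1 hl1 hmin1
  have hne01 : e1 ≠ e0 := by rintro rfl; omega
  obtain ⟨T0, hT0⟩ := hT e0 he0
  obtain ⟨e3, A, N0, hf, hf', -, -, hN0⟩ := hMn.exch hT0 he1 (by simpa using hne01)
  have he3 : e3 ∈ S ∧ e3 ≠ e0 := by
    simp only [Finset.mem_singleton] at hf'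
    grind
  have hl13 : p e1 < p e3 := by
    have h1 := hmin1 e3 he3.1 (by rw [hp0]; exact hpos e3 he3.1 he3.2)
    rcases h1.lt_or_eq with h2 | h2
    · exact h2
    · exact absurd (hpinj e1 he1 e3 he3.1 h2).symm hf
  have hq : symmDiff ({e0} : Finset β) {e1, e3} = {e0, e1, e3} := by
    have := he3.2
    ext x; simp only [Finset.mem_symmDiff, Finset.mem_insert, Finset.mem_singleton]; grind
  rw [hq] at hN0
  by_cases o3 : Odd (p e1 + p e3)
  · exact hN0.win3 h.fX hc hp rfl hl1 hl13 o1 o3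
  obtain ⟨e2, he2, hl2, hmin2⟩ := min_above p S (p e1) ⟨e3, he3.1, hl13⟩
  have o2 := hgap e1 he1 e2 he2 hl2 hmin2
  have o23 : Odd (p e2 + p e3) := by
    rw [Nat.odd_iff] at *; omega
  have hl3 : p e2 < p e3 := by
    rcases (hmin2 e3 he3.1 hl13).lt_or_eq with h2 | h2
    · exact h2
    · rw [h2, Nat.odd_iff] at o23; omega
  have hex4 : ∃ e ∈ S, p e3 < p e := by
    by_contra hcon
    push Not at hcon
    have hg := gap hM hc hp (hp e3 (hmS he3.1).1).1 le_rfl (hmS he3.1).1 (hmS he3.1).2 (hcut he3.1)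
      (hmS he0).1 (hmS he0).2 (by rw [hc.cy.last, ← hp0]; exact hcut he0) fun e he hMe hbet => by
        have := hcon e (Finset.mem_filter.2 ⟨he, hMe⟩)
        omega
    have hno := hc.odd
    have := (hp e3 (hmS he3.1).1).1
    rw [Nat.odd_iff] at *
    omega
  obtain ⟨e4, he4, hl4, hmin4⟩ := min_above p S (p e3) hex4
  have o4 := hgap e3 he3.1 e4 he4 hl4 hmin4
  obtain ⟨T2, hT2⟩ := hT e2 he2
  obtain ⟨T4, hT4⟩ := hT e4 he4
  exact game h.fX hc hp hl1 hl2 hl3 hl4 o1 o2 o23 o4 hT2 hT4 hN0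

theorem Hd.win {G : MG α β} {X : Finset α} (h : G.Hd X) : G.Win := by
  by_cases hfr : G.Fr X
  · by_cases h5 : 5 ≤ X.card
    · exact h.win_cyc hfr h5
    · obtain ⟨M, hM, hM1⟩ := h.fX.proper
      refine Win.of_pm h.fX hM ?_
      have h1 := hM.1.card X
      have h2 := hM.one_le_d h.fX.1
      have h3 := G.ins_nonneg hM.nonneg X
      obtain ⟨z, hz⟩ := G.ins_integral X hM.integral
      have h4 : (X.card : ℚ) ≤ 3 := by
        have := h.fX.1
        rw [Nat.odd_iff] at this
        have : X.card ≤ 3 := by omega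
        exact_mod_cast this
      rw [hz] at h1 h3
      have h6 : 0 ≤ z := by exact_mod_cast h3
      have h7 : z ≤ 1 := by
        have : (z : ℚ) ≤ 1 := by linarith
        exact_mod_cast this
      have h8 : (X.card : ℚ) = 3 := by
        rcases (show X.card = 1 ∨ X.card = 3 by
          have := h.fX.1
          rw [Nat.odd_iff] at this
          omega) with h9 | h9
        · exfalso
          apply hM1
          rw [h9] at h1
          push_cast at h1
          linarith
        · rw [h9]; norm_num
      rcases (show z = 0 ∨ z = 1 by omega) with rfl | rfl
      · push_cast at h1; linarith
      · exfalso; push_cast at h1; apply hM1; linarith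
  · unfold Fr at hfr
    push Not at hfr
    obtain ⟨z, hz, hin, h0⟩ := hfr
    obtain ⟨Y, P, hU⟩ := h.exists_un hz hin h0
    exact hU.win

end MG

end Main

end PML

namespace PML

set_option linter.unusedSectionVars false
set_option linter.unusedDecidableInType false
set_option linter.unusedFintypeInType false

universe u v

section Main

variable {α : Type u} [Fintype α] [DecidableEq α] [Nonempty α]
  {β : Type v} [Fintype β] [DecidableEq β]

namespace MG

/-- deleting an edge -/
def del (G : MG α β) (e : β) : MG α β where
  edges := G.edges.erase e
  s := G.s
  t := G.t
  ne f hf := G.ne f (Finset.mem_of_mem_erase hf)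

lemma del_cut (G : MG α β) (e : β) (X : Finset α) : (G.del e).cut X = (G.cut X).erase e := by
  ext f
  rw [mem_cut, Finset.mem_erase, mem_cut]
  simp only [del, Finset.mem_erase]
  grind

lemma del_d (G : MG α β) {e : β} {x : β → ℚ} (hx : x e = 0) (X : Finset α) :
    (G.del e).d X x = G.d X x := by
  rw [d_apply, d_apply, del_cut, Finset.sum_erase _ hx]

lemma del_PM {G : MG α β} {e : β} {m : β → ℚ} : (G.del e).PM m ↔ G.PM m ∧ m e = 0 := by
  constructor
  · rintro ⟨⟨h1, h2⟩, h3⟩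
    have h0 : m e = 0 := h1 e (by simp [del])
    refine ⟨⟨⟨fun f hf => h1 f ?_, fun w => ?_⟩, h3⟩, h0⟩
    · simp only [del, Finset.mem_erase]; exact fun h => hf h.2
    · rw [← G.del_d h0]; exact h2 w
  · rintro ⟨⟨⟨h1, h2⟩, h3⟩, h0⟩
    refine ⟨⟨fun f hf => ?_, fun w => ?_⟩, h3⟩
    · by_cases hfe : f = e
      · rw [hfe]; exact h0
      · refine h1 f fun h => hf ?_
        simp only [del, Finset.mem_erase]; exact ⟨hfe, h⟩
    · rw [G.del_d h0]; exact h2 w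

lemma ctr_card_lt {G : MG α β} {X : Finset α} (h1 : Xᶜ.card ≠ 1) (h2 : Odd Xᶜ.card) :
    Fintype.card (Option {v // v ∈ X}) + (G.ctr X).edges.card <
      Fintype.card α + G.edges.card := by
  have h3 : (G.ctr X).edges.card ≤ G.edges.card :=
    Finset.card_le_card fun e he => (mem_ctr_edges.1 he).1
  have h4 := Finset.card_compl_add_card X
  rw [card_option]
  rw [Nat.odd_iff] at h2
  omega

end MG

theorem main (k : ℕ) : ∀ (α : Type u) [Fintype α] [DecidableEq α] [Nonempty α] (G : MG α β),
    Fintype.card α + G.edges.card ≤ k → TT G.pms := by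
  induction k with
  | zero =>
    intro α _ _ _ G h
    have : 0 < Fintype.card α := Fintype.card_pos
    omega
  | succ k ih =>
    intro α _ _ _ G hk
    by_cases hne : ∃ m, G.PM m
    swap
    · push Not at hne
      have h0 : G.pms = ∅ := by
        ext m; simp [hne]
      intro x hx _
      rw [h0] at hx
      simp only [Finset.coe_empty, Submodule.span_empty, Submodule.mem_bot] at hx
      rw [hx, smul_zero]
      exact zero_mem _
    obtain ⟨m0, hm0⟩ := hne
    have hdel : ∀ e ∈ G.edges, TT (G.del e).pms := by
      intro e he
      refine ih α (G.del e) ?_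
      have : (G.del e).edges.card < G.edges.card := by
        simp only [MG.del]
        exact Finset.card_erase_lt_of_mem he
      omega
    by_cases hcov : G.Cov
    swap
    · unfold MG.Cov at hcov
      push Not at hcov
      obtain ⟨e, he, hno⟩ := hcov
      have : G.pms = (G.del e).pms := by
        ext m
        rw [MG.mem_pms, MG.mem_pms, MG.del_PM]
        exact ⟨fun h => ⟨h, (h.2 e).resolve_right (hno m h)⟩, fun h => h.1⟩
      rw [this]
      exact hdel e he
    have hev : Even (Fintype.card α) := by
      have h1 := hm0.1.card Finset.univ
      rw [MG.d_univ] at h1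
      obtain ⟨z, hz⟩ := G.ins_integral Finset.univ hm0.integral
      rw [hz] at h1
      have h2 : ((Finset.univ : Finset α).card : ℤ) = 2 * z := by
        have : ((Finset.univ : Finset α).card : ℚ) = 2 * z := by linarith
        exact_mod_cast this
      rw [Finset.card_univ] at h2
      rw [Nat.even_iff]; omega
    have hctr : ∀ X : Finset α, Odd X.card → X.card ≠ 1 → Xᶜ.card ≠ 1 →
        TT (G.ctr X).pms ∧ TT (G.ctr Xᶜ).pms := by
      intro X hX h1 h2
      constructor
      · refine ih _ _ ?_
        have := MG.ctr_card_lt (G := G) h2 (MG.odd_compl hX hev)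
        omega
      · refine ih _ _ ?_
        have := MG.ctr_card_lt (G := G) (X := Xᶜ) (by rwa [compl_compl]) (by rwa [compl_compl])
        omega
    by_cases hbr : G.Brick
    swap
    · unfold MG.Brick at hbr
      push Not at hbr
      obtain ⟨X, hX, ht, h1, h2⟩ := hbr
      obtain ⟨t1, t2⟩ := hctr X hX h1 h2
      refine MG.TT_glue (X := X) (fun f hf => ?_) t1 t2 fun m => ?_
      · obtain ⟨m, hm, hmf⟩ := hcov f (MG.cut_edges hf)
        exact ⟨m, hm, ht m hm, hmf⟩
      · rw [MG.mem_pms]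
        exact ⟨fun h => ⟨h, ht m h⟩, fun h => h.1⟩
    by_cases hed : ∃ e ∈ G.edges, Facet G.pms G.con (Sum.inl e)
    · obtain ⟨e, he, hfe⟩ := hed
      obtain ⟨m, hm, hme⟩ := hcov e he
      have hface : face G.pms (G.con (Sum.inl e)) = (G.del e).pms := by
        ext m
        rw [mem_face, MG.mem_pms, MG.mem_pms, MG.del_PM, MG.con_inl]
      refine finish G.sys hfe (by rw [hface]; exact hdel e he) (fun x _ hxi => hxi e)
        (γ := m) (Submodule.subset_span (MG.mem_pms.2 hm)) hm.integral hme ?_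
      have := zsmul_closure (S := (G.pms : Set (β → ℚ))) (x := m)
        (AddSubgroup.subset_closure (MG.mem_pms.2 hm)) 2
      exact_mod_cast this
    push Not at hed
    have hfc : ∃ X, G.Fc X := by
      obtain ⟨w⟩ := ‹Nonempty α›
      obtain ⟨f, hf, hf1, -⟩ := hm0.exists_unique_cut (hm0.1.2 w)
      obtain ⟨j, hj, -⟩ := exists_facet (S := G.pms) (g := G.con) (Sum.inl f)
        (face_ne_iff.2 ⟨m0, MG.mem_pms.2 hm0, by rw [MG.con_inl, hf1]; norm_num⟩)
      rcases j with e | X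
      · exfalso
        by_cases he : e ∈ G.edges
        · exact hed e he hj
        · obtain ⟨m, hm, hmne⟩ := face_ne_iff.1 hj.1
          exact hmne ((MG.mem_pms.1 hm).1.1 e he)
      · refine ⟨X, ?_, hj⟩
        by_contra hX
        obtain ⟨m, hm, hmne⟩ := face_ne_iff.1 hj.1
        exact hmne (by simp [MG.con, hX])
    obtain ⟨X0, hX0⟩ := hfc
    obtain ⟨X, hX, hmin⟩ := (Set.toFinite {X | G.Fc X}).exists_minimalFor
      (fun X : Finset α => X.card) _ ⟨X0, hX0⟩
    have hHd : G.Hd X := ⟨hev, hcov, hbr, hed, hX, fun Y hY => by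
      by_contra hlt
      push Not at hlt
      have := hmin hY hlt.le
      exact absurd this (not_le.2 hlt)⟩
    obtain ⟨Y, hY, γ, hγ, hγi, hγ3, hγ2⟩ := hHd.win
    obtain ⟨m, hm, hmne⟩ := hY.proper
    have hone : ∀ Z : Finset α, Z.card = 1 → G.d Z m = 1 := by
      intro Z hZ
      obtain ⟨w, rfl⟩ := Finset.card_eq_one.1 hZ
      exact hm.1.2 w
    obtain ⟨t1, t2⟩ := hctr Y hY.1 (fun h => hmne (hone Y h))
      (fun h => hmne (by rw [← MG.d_compl]; exact hone _ h))
    refine finish G.sys hY.2 (MG.TT_glue (X := Y) (fun f hf => ?_) t1 t2 fun m => MG.mem_faceX hY.1)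
      (fun x hx hxi => ?_) (MG.elp hcov hbr hγ) hγi ?_ hγ2
    · obtain ⟨m, hm, hmf⟩ := hHd.fcov hY (MG.cut_edges hf)
      exact ⟨m, hm.1, hm.2, hmf⟩
    · obtain ⟨r, hr⟩ := MG.span_reg hx
      rw [MG.con_inr _ hY.1, hr.ell]
      exact hr.half_integral hxi hY.1
    · rw [MG.con_inr _ hY.1, hγ.ell, hγ3]; norm_num

end Main

end PML

namespace PML

section Transfer

set_option linter.unusedSectionVars false
set_option linter.unusedDecidableInType false
set_option linter.unusedFintypeInType false

universe w

variable {A : Type w} [Fintype A] [DecidableEq A]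

open Classical in
/-- the multigraph of a simple graph -/
noncomputable def ofS (G : SimpleGraph A) : MG A (Sym2 A) where
  edges := Finset.univ.filter fun e => e ∈ G.edgeSet
  s e := (Quot.out e).1
  t e := (Quot.out e).2
  ne e he := by
    have h1 := (Finset.mem_filter.1 he).2
    intro h2
    have h3 : e = s((Quot.out e).1, (Quot.out e).2) := (Quot.out_eq e).symm
    rw [h3, SimpleGraph.mem_edgeSet, h2] at h1
    exact h1.ne rfl

lemma ofS_edges {G : SimpleGraph A} {e : Sym2 A} : e ∈ (ofS G).edges ↔ e ∈ G.edgeSet := by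
  simp [ofS]

lemma ofS_cut {G : SimpleGraph A} {e : Sym2 A} {a : A} :
    e ∈ (ofS G).cut {a} ↔ e ∈ G.edgeSet ∧ a ∈ e := by
  rw [MG.mem_cut_singleton, ofS_edges]
  refine and_congr_right fun _ => ?_
  have h3 : e = s((Quot.out e).1, (Quot.out e).2) := (Quot.out_eq e).symm
  conv_rhs => rw [h3, Sym2.mem_iff]
  simp only [ofS, eq_comm]

lemma ofS_PM {G : SimpleGraph A} {m : Sym2 A → ℚ} :
    (ofS G).PM m ↔ ∃ M : G.Subgraph, M.IsPerfectMatching ∧ m = incVecQ G M := by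
  classical
  constructor
  · intro h
    have hG : ∀ e, m e = 1 → e ∈ G.edgeSet := by
      intro e he
      by_contra h1
      rw [← ofS_edges] at h1
      rw [h.1.1 e h1] at he
      norm_num at he
    let M : G.Subgraph :=
      { verts := Set.univ
        Adj := fun a b => m s(a, b) = 1
        adj_sub := fun {a b} hab => hG _ hab
        edge_vert := fun _ => Set.mem_univ _
        symm := ⟨fun a b hab => by rw [Sym2.eq_swap]; exact hab⟩ }
    refine ⟨M, ?_, ?_⟩
    · rw [SimpleGraph.Subgraph.isPerfectMatching_iff]
      intro a
      obtain ⟨f, hf, hf1, hu⟩ := h.exists_unique_cut (h.1.2 a)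
      obtain ⟨b, rfl⟩ := Sym2.mem_iff_exists.1 (ofS_cut.1 hf).2
      refine ⟨b, hf1, fun c hc => ?_⟩
      have hc' : m s(a, c) = 1 := hc
      by_contra hne
      have := hu s(a, c) (ofS_cut.2 ⟨hG _ hc', Sym2.mem_mk_left _ _⟩)
        (fun h => hne (Sym2.congr_right.1 h))
      rw [hc'] at this
      norm_num at this
    · funext e
      unfold incVecQ
      induction e using Sym2.ind with
      | _ a b =>
        have : s(a, b) ∈ M.edgeSet ↔ m s(a, b) = 1 := Iff.rfl
        rcases h.2 s(a, b) with h1 | h1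
        · rw [if_neg, h1]
          rw [this, h1]; norm_num
        · rw [if_pos (this.2 h1), h1]
  · rintro ⟨M, hM, rfl⟩
    refine ⟨⟨fun e he => ?_, fun a => ?_⟩, fun e => ?_⟩
    · unfold incVecQ
      rw [if_neg]
      exact fun h => he (ofS_edges.2 (M.edgeSet_subset h))
    · rw [SimpleGraph.Subgraph.isPerfectMatching_iff] at hM
      obtain ⟨b, hb, hu⟩ := hM a
      rw [MG.d_apply, Finset.sum_eq_single_of_mem s(a, b)]
      · unfold incVecQ
        rw [if_pos]
        exact hb
      · exact ofS_cut.2 ⟨M.edgeSet_subset hb, Sym2.mem_mk_left _ _⟩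
      · intro e he hne
        obtain ⟨c, rfl⟩ := Sym2.mem_iff_exists.1 (ofS_cut.1 he).2
        unfold incVecQ
        rw [if_neg]
        intro hc
        exact hne (by rw [hu c hc])
    · unfold incVecQ
      split_ifs
      · exact Or.inr rfl
      · exact Or.inl rfl

end Transfer

end PML

/-- any integer vector in the `ℚ`-linear span of the perfect matching
incidence vectors, when doubled, lies in the perfect matching lattice. -/
theorem two_smul_mem_pmLattice [Fintype V] (G : SimpleGraph V)
    (hG : MatchingCovered G) (x : Sym2 V → ℚ)
    (hint : ∀ e, ∃ n : ℤ, x e = n)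
    (hx : x ∈ Submodule.span ℚ
      {y | ∃ M : G.Subgraph, M.IsPerfectMatching ∧ y = incVecQ G M}) :
    (2 : ℤ) • x ∈ pmLattice G := by
  classical
  have : Nonempty V := hG.1.nonempty
  have hset : {y | ∃ M : G.Subgraph, M.IsPerfectMatching ∧ y = incVecQ G M} =
      ((PML.ofS G).pms : Set (Sym2 V → ℚ)) := by
    ext y
    rw [Finset.mem_coe, PML.MG.mem_pms, PML.ofS_PM]
    rfl
  have h1 := PML.main _ V (PML.ofS G) le_rfl x (by rw [← hset]; exact hx) hint
  have h2 : (2 : ℤ) • x = (2 : ℚ) • x := by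
    funext e; simp
  rw [h2]
  unfold pmLattice
  rw [hset, Submodule.mem_span]
  intro p hp
  exact (AddSubgroup.closure_le p.toAddSubgroup).2 hp h1
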